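/- arXiv:2411.16663 — 2 statements merged into one kernel-verified Lean document; each statement's English description precedes it below -/
import Mathlib

section
/- Let u : ℝ³ → ℂ (with coordinates (t,x,y)) be C^∞ on ℝ³ and satisfy the two-dimensional wave equation ∂²u/∂t² = ∂²u/∂x² + ∂²u/∂y² at every point (t,x,y) with x ≥ 0, together with the Neumann boundary condition (∂u/∂x)(t,0,y) = 0 for all t,y ∈ ℝ. For a,b,c ∈ ℂ with a² = b² + c² define g_{a,b,c} : ℝ³ → ℂ by g_{a,b,c}(t,x,y) = exp(a t + b x + c y) + exp(a t − b x + c y). Then for every compact set K ⊆ ℝ × [0,∞) × ℝ, every m ∈ ℕ, and every ε > 0, there exist r ∈ ℕ, triples (a_j,b_j,c_j) ∈ ℂ³ with a_j² = b_j² + c_j², and coefficients c'_1, …, c'_r ∈ ℂ such that for every k ≤ m, the k-th iterated derivative of u − Σ_{j=1}^r c'_j g_{a_j,b_j,c_j} has norm at most ε at every point of K. -/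
/-- Partial derivative in the first variable `t`. -/
noncomputable def d1 (u : ℝ × ℝ × ℝ → ℂ) : ℝ × ℝ × ℝ → ℂ :=
  fun p => deriv (fun s => u (s, p.2.1, p.2.2)) p.1

/-- Partial derivative in the second variable `x`. -/
noncomputable def d2 (u : ℝ × ℝ × ℝ → ℂ) : ℝ × ℝ × ℝ → ℂ :=
  fun p => deriv (fun s => u (p.1, s, p.2.2)) p.2.1

/-- Partial derivative in the third variable `y`. -/
noncomputable def d3 (u : ℝ × ℝ × ℝ → ℂ) : ℝ × ℝ × ℝ → ℂ :=
  fun p => deriv (fun s => u (p.1, p.2.1, s)) p.2.2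

/-- B-EPGP basis element for the 2D wave equation with Neumann boundary condition on
the plane `{x = 0}`. -/
noncomputable def waveNeumannBasis (a b c : ℂ) : ℝ × ℝ × ℝ → ℂ :=
  fun p => Complex.exp (a * (p.1 : ℂ) + b * (p.2.1 : ℂ) + c * (p.2.2 : ℂ)) +
    Complex.exp (a * (p.1 : ℂ) - b * (p.2.1 : ℂ) + c * (p.2.2 : ℂ))

namespace WaveNeumann

open MeasureTheory Filter Topology
open scoped FourierTransform ContDiff SchwartzMap

section Character

variable {V W : Type*} [NormedAddCommGroup V] [NormedSpace ℝ V] [NormedAddCommGroup W]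
  [NormedSpace ℝ W] (L : V →L[ℝ] W →L[ℝ] ℝ)

/-- The character `w ↦ exp (-2 π i L(v, w))`. -/
noncomputable def character (v : V) (w : W) : ℂ := (𝐞 (-L v w) : ℂ)

variable [MeasurableSpace V] [BorelSpace V] [SecondCountableTopology V]

theorem character_eq_fourierIntegral_dirac (v : V) :
    character L v =
      VectorFourier.fourierIntegral 𝐞 (Measure.dirac v) L.toLinearMap₁₂ (fun _ => (1 : ℂ)) := by
  ext w
  simp [VectorFourier.fourierIntegral, character, Circle.smul_def]

theorem contDiff_character (v : V) : ContDiff ℝ ∞ (character L v) := by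
  rw [character_eq_fourierIntegral_dirac]
  exact VectorFourier.contDiff_fourierIntegral L fun n _ => integrable_dirac (by simp)

theorem iteratedFDeriv_character (v : V) (k : ℕ) (w : W) :
    iteratedFDeriv ℝ k (character L v) w =
      𝐞 (-L v w) • VectorFourier.fourierPowSMulRight L (fun _ => (1 : ℂ)) v k := by
  rw [character_eq_fourierIntegral_dirac,
    VectorFourier.iteratedFDeriv_fourierIntegral (N := ⊤) L
      (fun n _ => integrable_dirac (by simp)) aestronglyMeasurable_const le_top]
  simp [VectorFourier.fourierIntegral]

end Character

theorem _root_.Submodule.integral_mem_of_isClosed {α E : Type*} [MeasurableSpace α]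
    [NormedAddCommGroup E] [NormedSpace ℂ E] [CompleteSpace E] {μ : Measure α}
    (S : Submodule ℂ E) (hS : IsClosed (S : Set E)) {f : α → E} (hf : Integrable f μ)
    (hfS : ∀ᵐ a ∂μ, f a ∈ S) : ∫ a, f a ∂μ ∈ S := by
  have : IsClosed (S : Set E) := hS
  have h := S.mkQL.integral_comp_comm hf
  rw [integral_congr_ae (g := fun _ => 0)] at h
  · simpa using h.symm
  · filter_upwards [hfS] with a ha
    simpa using ha

section Approximation

variable {V W : Type*} [NormedAddCommGroup V] [NormedSpace ℝ V] [NormedAddCommGroup W]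
  [NormedSpace ℝ W] (L : V →L[ℝ] W →L[ℝ] ℝ)
  [MeasurableSpace V] [BorelSpace V] [SecondCountableTopology V]

theorem continuous_iteratedFDeriv_character (k : ℕ) :
    Continuous fun q : V × W => iteratedFDeriv ℝ k (character L q.1) q.2 := by
  simp_rw [iteratedFDeriv_character]
  have h : Continuous fun v : V =>
      VectorFourier.fourierPowSMulRight L (fun _ => (1 : ℂ)) v k :=
    Continuous.fourierPowSMulRight L continuous_const k
  have h2 : Continuous fun q : V × W => (𝐞 (-L q.1 q.2) : ℂ) :=
    continuous_subtype_val.comp (Real.continuous_fourierChar.comp L.continuous₂.neg)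
  exact h2.smul (h.comp continuous_fst)

/-- The values of the derivatives of orders `0, …, m`. -/
def Jet (W : Type*) [NormedAddCommGroup W] [NormedSpace ℝ W] (m : ℕ) : Type _ :=
  ∀ k : Fin (m + 1), ContinuousMultilinearMap ℝ (fun _ : Fin (k : ℕ) => W) ℂ

noncomputable instance (m : ℕ) : NormedAddCommGroup (Jet W m) :=
  inferInstanceAs (NormedAddCommGroup
    (∀ k : Fin (m + 1), ContinuousMultilinearMap ℝ (fun _ : Fin (k : ℕ) => W) ℂ))

noncomputable instance (m : ℕ) : NormedSpace ℂ (Jet W m) :=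
  inferInstanceAs (NormedSpace ℂ
    (∀ k : Fin (m + 1), ContinuousMultilinearMap ℝ (fun _ : Fin (k : ℕ) => W) ℂ))

instance (m : ℕ) : CompleteSpace (Jet W m) :=
  inferInstanceAs (CompleteSpace
    (∀ k : Fin (m + 1), ContinuousMultilinearMap ℝ (fun _ : Fin (k : ℕ) => W) ℂ))

/-- The component of order `k` of a jet. -/
noncomputable def Jet.coord {m : ℕ} (k : Fin (m + 1)) :
    Jet W m →L[ℂ] ContinuousMultilinearMap ℝ (fun _ : Fin (k : ℕ) => W) ℂ :=
  ContinuousLinearMap.proj (R := ℂ)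
    (φ := fun k : Fin (m + 1) => ContinuousMultilinearMap ℝ (fun _ : Fin (k : ℕ) => W) ℂ) k

theorem Jet.norm_coord_le {m : ℕ} (k : Fin (m + 1)) (j : Jet W m) : ‖Jet.coord k j‖ ≤ ‖j‖ :=
  norm_le_pi_norm (G := fun k : Fin (m + 1) =>
    ContinuousMultilinearMap ℝ (fun _ : Fin (k : ℕ) => W) ℂ) j k

theorem Jet.norm_le {m : ℕ} {j : Jet W m} {r : ℝ} (hr : 0 ≤ r)
    (h : ∀ k, ‖Jet.coord k j‖ ≤ r) : ‖j‖ ≤ r :=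
  (pi_norm_le_iff_of_nonneg (G := fun k : Fin (m + 1) =>
    ContinuousMultilinearMap ℝ (fun _ : Fin (k : ℕ) => W) ℂ) hr).2 h

/-- The jet with given components. -/
def Jet.mk (m : ℕ) (F : ∀ k : ℕ, ContinuousMultilinearMap ℝ (fun _ : Fin k => W) ℂ) : Jet W m :=
  fun k => F k

theorem Jet.continuous_mk {X : Type*} [TopologicalSpace X] (m : ℕ)
    {F : X → ∀ k : ℕ, ContinuousMultilinearMap ℝ (fun _ : Fin k => W) ℂ}
    (hF : ∀ k, Continuous fun x => F x k) : Continuous (fun q => Jet.mk m (F q)) :=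
  continuous_pi fun k => hF k

theorem continuous_jet_character (K : Set W) (m : ℕ) :
    Continuous fun q : V × K => Jet.mk m fun k => iteratedFDeriv ℝ k (character L q.1) q.2 := by
  have h : Continuous fun q : V × K => (q.1, (q.2 : W)) := by fun_prop
  refine Jet.continuous_mk m (fun k => ?_)
  have h1 := (continuous_iteratedFDeriv_character L k).comp h
  simpa only [Function.comp_def] using h1

/-- The jets up to order `m` of a character, as a continuous function on `K`. -/
noncomputable def characterJet (K : Set W) (m : ℕ) : C(V, C(K, Jet W m)) :=
  ContinuousMap.curry ⟨_, continuous_jet_character L K m⟩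

theorem coord_characterJet (K : Set W) {m : ℕ} (v : V) (p : K) (k : Fin (m + 1)) :
    Jet.coord k (characterJet L K m v p) = iteratedFDeriv ℝ k (character L v) p := rfl

theorem norm_characterJet_le (K : Set W) [CompactSpace K] (m : ℕ) (v : V) :
    ‖characterJet L K m v‖ ≤ ∑ k : Fin (m + 1), (2 * Real.pi * ‖L‖) ^ (k : ℕ) * ‖v‖ ^ (k : ℕ) := by
  refine (ContinuousMap.norm_le _ (by positivity)).2 fun p => ?_
  refine Jet.norm_le (by positivity) fun k => ?_
  rw [coord_characterJet, iteratedFDeriv_character]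
  rw [Circle.smul_def, norm_smul, Circle.norm_coe, one_mul]
  refine (VectorFourier.norm_fourierPowSMulRight_le L _ v k).trans ?_
  simp only [norm_one, mul_one]
  exact Finset.single_le_sum (f := fun k : Fin (m + 1) =>
    (2 * Real.pi * ‖L‖) ^ (k : ℕ) * ‖v‖ ^ (k : ℕ)) (fun i _ => by positivity) (Finset.mem_univ k)

variable {L} in
/-- A smooth Fourier integral over a set `C` of frequencies is approximated, with its derivatives
and uniformly on compact sets, by linear combinations of characters with frequency in `C`. -/
theorem fourierIntegral_mem_closure_span_character {μ : Measure V} {C : Set V}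
    (hC : ∀ᵐ v ∂μ, v ∈ C) {f : V → ℂ}
    (hf : ∀ n : ℕ, Integrable (fun v => ‖v‖ ^ n * ‖f v‖) μ) (hfm : AEStronglyMeasurable f μ)
    {K : Set W} (hK : IsCompact K) (m : ℕ) {ε : ℝ} (hε : 0 < ε) :
    ∃ s ∈ Submodule.span ℂ (character L '' C), ∀ k ≤ m, ∀ p ∈ K,
      ‖iteratedFDeriv ℝ k
        (fun q => VectorFourier.fourierIntegral 𝐞 μ L.toLinearMap₁₂ f q - s q) p‖ ≤ ε := by
  have : CompactSpace K := isCompact_iff_compactSpace.1 hK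
  set J := characterJet L K m with hJ
  have hint : Integrable (fun v => f v • J v) μ := by
    refine Integrable.mono'
      (g := fun v => ∑ k : Fin (m + 1), (2 * Real.pi * ‖L‖) ^ (k : ℕ) * (‖v‖ ^ (k : ℕ) * ‖f v‖))
      (integrable_finsetSum _ fun k _ => (hf k).const_mul _)
      (hfm.smul J.continuous.aestronglyMeasurable) (Eventually.of_forall fun v => ?_)
    rw [norm_smul]
    refine (mul_le_mul_of_nonneg_left (norm_characterJet_le L K m v) (norm_nonneg _)).trans_eq ?_
    rw [Finset.mul_sum]
    exact Finset.sum_congr rfl fun _ _ => by ring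
  have hmem : ∫ v, f v • J v ∂μ ∈ (Submodule.span ℂ (J '' C)).topologicalClosure := by
    refine Submodule.integral_mem_of_isClosed _ (Submodule.isClosed_topologicalClosure _) hint ?_
    filter_upwards [hC] with v hv
    exact Submodule.smul_mem _ _ (Submodule.le_topologicalClosure _
      (Submodule.subset_span (Set.mem_image_of_mem _ hv)))
  obtain ⟨j, hj, hdist⟩ := Metric.mem_closure_iff.1 hmem ε hε
  obtain ⟨s, hs, hsmooth, hsj⟩ : ∃ s ∈ Submodule.span ℂ (character L '' C), ContDiff ℝ ∞ s ∧
      ∀ (k : Fin (m + 1)) (p : K), iteratedFDeriv ℝ k s p = Jet.coord k (j p) := by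
    clear hdist
    induction hj using Submodule.span_induction with
    | mem x hx =>
      obtain ⟨v, hv, rfl⟩ := hx
      exact ⟨character L v, Submodule.subset_span ⟨v, hv, rfl⟩, contDiff_character L v,
        fun k p => rfl⟩
    | zero =>
      refine ⟨0, Submodule.zero_mem _, contDiff_const, fun k p => ?_⟩
      simp [Pi.zero_def]
    | add x y _ _ hx hy =>
      obtain ⟨s, hs, hsm, hsx⟩ := hx
      obtain ⟨t, ht, htm, hty⟩ := hy
      refine ⟨s + t, Submodule.add_mem _ hs ht, hsm.add htm, fun k p => ?_⟩
      rw [iteratedFDeriv_add_apply (hsm.of_le (mod_cast le_top)).contDiffAt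
        (htm.of_le (mod_cast le_top)).contDiffAt, hsx, hty,
        ContinuousMap.add_apply, map_add]
    | smul c x _ hx =>
      obtain ⟨s, hs, hsm, hsx⟩ := hx
      refine ⟨c • s, Submodule.smul_mem _ c hs, contDiff_const.smul hsm, fun k p => ?_⟩
      rw [iteratedFDeriv_const_smul_apply (hsm.of_le (mod_cast le_top)).contDiffAt, hsx,
        ContinuousMap.smul_apply, map_smul]
  refine ⟨s, hs, fun k hk p hp => ?_⟩
  have hF : ContDiff ℝ ∞ (VectorFourier.fourierIntegral 𝐞 μ L.toLinearMap₁₂ f) :=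
    VectorFourier.contDiff_fourierIntegral L fun n _ => hf n
  have hk' : k < m + 1 := Nat.lt_succ_of_le hk
  have hval : iteratedFDeriv ℝ k (VectorFourier.fourierIntegral 𝐞 μ L.toLinearMap₁₂ f) p =
      Jet.coord ⟨k, hk'⟩ ((∫ v, f v • J v ∂μ) ⟨p, hp⟩) := by
    rw [VectorFourier.iteratedFDeriv_fourierIntegral (N := ⊤) L (fun n _ => hf n) hfm le_top,
      VectorFourier.fourierIntegral]
    let ev := Jet.coord (W := W) ⟨k, hk'⟩ ∘L
      (ContinuousMap.evalCLM ℂ (⟨p, hp⟩ : K))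
    refine Eq.trans ?_ (ev.integral_comp_comm hint)
    congr 1 with v : 1
    change _ = f v • iteratedFDeriv ℝ k (character L v) p
    rw [iteratedFDeriv_character, smul_comm]
    congr 1
    ext w
    simp
    ring
  have hd : iteratedFDeriv ℝ k
      (fun q => VectorFourier.fourierIntegral 𝐞 μ L.toLinearMap₁₂ f q - s q) p =
      Jet.coord ⟨k, hk'⟩ (((∫ v, f v • J v ∂μ) - j) ⟨p, hp⟩) := by
    change iteratedFDeriv ℝ k (VectorFourier.fourierIntegral 𝐞 μ L.toLinearMap₁₂ f - s) p = _
    rw [iteratedFDeriv_sub_apply (hF.of_le (mod_cast le_top)).contDiffAt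
        (hsmooth.of_le (mod_cast le_top)).contDiffAt, hval]
    rw [hsj ⟨k, hk'⟩ ⟨p, hp⟩, ContinuousMap.sub_apply, map_sub]
  rw [hd]
  rw [dist_eq_norm] at hdist
  exact ((Jet.norm_coord_le _ _).trans (ContinuousMap.norm_coe_le_norm _ _)).trans hdist.le

end Approximation

/-- The directional derivative of `f` along `v`. -/
noncomputable def pd {E F : Type*} [NormedAddCommGroup E] [NormedSpace ℝ E] [NormedAddCommGroup F]
    [NormedSpace ℝ F] (v : E) (f : E → F) : E → F := fun p => fderiv ℝ f p v

section Moments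

variable {V : Type*} [NormedAddCommGroup V] [MeasurableSpace V] {μ : Measure V}

/-- All moments of the density `f` with respect to `μ` are finite. -/
structure HasMoments (μ : Measure V) (f : V → ℂ) : Prop where
  aestronglyMeasurable : AEStronglyMeasurable f μ
  integrable : ∀ n : ℕ, Integrable (fun v => ‖v‖ ^ n * ‖f v‖) μ

theorem HasMoments.integrable_density {f : V → ℂ} (hf : HasMoments μ f) : Integrable f μ := by
  have h := hf.integrable 0
  simp only [pow_zero, one_mul] at h
  exact (integrable_norm_iff hf.aestronglyMeasurable).1 h

variable {W : Type*} [NormedSpace ℝ V] [NormedAddCommGroup W] [NormedSpace ℝ W]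
  (L : V →L[ℝ] W →L[ℝ] ℝ) [BorelSpace V]

theorem HasMoments.mul_phase {f : V → ℂ} (hf : HasMoments μ f) (w : W) :
    HasMoments μ fun v => -(2 * Real.pi * Complex.I * L v w) * f v := by
  have hc : Continuous fun v : V => (-(2 * Real.pi * Complex.I * L v w) : ℂ) := by
    have : Continuous fun v : V => L v w :=
      L.continuous₂.comp (by fun_prop : Continuous fun v => (v, w))
    fun_prop
  have hm := hc.aestronglyMeasurable.mul hf.aestronglyMeasurable
  refine ⟨hm, fun n => ?_⟩
  refine ((hf.integrable (n + 1)).const_mul (2 * Real.pi * ‖L‖ * ‖w‖)).mono'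
    ((by fun_prop : Continuous fun v : V => ‖v‖ ^ n).aestronglyMeasurable.mul hm.norm) ?_
  refine Eventually.of_forall fun v => ?_
  have hL := L.le_opNorm₂ v w
  have : ‖(L v w : ℂ)‖ = ‖L v w‖ := by simp
  rw [norm_mul, norm_norm, norm_mul, norm_neg, norm_mul, norm_mul, norm_mul, this]
  simp only [Complex.norm_I, Complex.norm_real, norm_norm, norm_pow, Complex.norm_ofNat,
    Real.norm_of_nonneg Real.pi_nonneg]
  calc ‖v‖ ^ n * (2 * Real.pi * 1 * ‖L v w‖ * ‖f v‖)
      ≤ ‖v‖ ^ n * (2 * Real.pi * 1 * (‖L‖ * ‖v‖ * ‖w‖) * ‖f v‖) := by gcongr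
    _ = _ := by ring

theorem HasMoments.integrable_smul {f : V → ℂ} (hf : HasMoments μ f) (p : W) :
    Integrable (fun v => 𝐞 (-L.toLinearMap₁₂ v p) • f v) μ :=
  (VectorFourier.fourierIntegral_convergent_iff Real.continuous_fourierChar
    L.continuous₂ p).2 hf.integrable_density

variable [SecondCountableTopology V] in
theorem pd_fourierIntegral {f : V → ℂ} (hf : HasMoments μ f) (w : W) :
    pd w (VectorFourier.fourierIntegral 𝐞 μ L.toLinearMap₁₂ f) =
      VectorFourier.fourierIntegral 𝐞 μ L.toLinearMap₁₂
        (fun v => -(2 * Real.pi * Complex.I * L v w) * f v) := by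
  have h1 : Integrable (fun v => ‖v‖ * ‖f v‖) μ := by simpa using hf.integrable 1
  ext p
  rw [pd, (VectorFourier.hasFDerivAt_fourierIntegral L hf.integrable_density h1 p).fderiv,
    VectorFourier.fourierIntegral, VectorFourier.fourierIntegral,
    ContinuousLinearMap.integral_apply]
  · congr 1 with v : 1
    simp [VectorFourier.fourierSMulRight_apply, Circle.smul_def]
    ring
  · exact (VectorFourier.fourierIntegral_convergent_iff Real.continuous_fourierChar
      L.continuous₂ p).2 ((h1.const_mul (2 * Real.pi * ‖L‖)).mono'
        (AEStronglyMeasurable.fourierSMulRight (L := L) hf.aestronglyMeasurable)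
        (Eventually.of_forall fun v => by
          simpa [mul_assoc] using VectorFourier.norm_fourierSMulRight_le L f v))

end Moments

section Cone

/-- The pairing of a frequency `(τ, ξ)` with `(t, x, y)`, with a sign making
`character phase (τ, ξ) (t, x, y) = exp (2 π i (τ t + ξ.re x + ξ.im y))`. -/
noncomputable def phase : (ℝ × ℂ) →L[ℝ] (ℝ × ℝ × ℝ) →L[ℝ] ℝ :=
  (LinearMap.mk₂ ℝ (fun (v : ℝ × ℂ) (p : ℝ × ℝ × ℝ) =>
    -(v.1 * p.1 + v.2.re * p.2.1 + v.2.im * p.2.2))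
    (fun _ _ _ => by simp; ring) (fun _ _ _ => by simp; ring)
    (fun _ _ _ => by simp; ring) (fun _ _ _ => by simp; ring)).toContinuousBilinearMap

@[simp] theorem phase_apply (v : ℝ × ℂ) (p : ℝ × ℝ × ℝ) :
    phase v p = -(v.1 * p.1 + v.2.re * p.2.1 + v.2.im * p.2.2) := rfl

/-- The characteristic cone of the wave operator. -/
def lightCone : Set (ℝ × ℂ) := {v | v.1 ^ 2 = v.2.re ^ 2 + v.2.im ^ 2}

/-- The measure on both sheets of the light cone obtained by lifting Lebesgue measure. -/
noncomputable def coneMeasure : Measure (ℝ × ℂ) :=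
  (volume : Measure ℂ).map (fun ξ => (‖ξ‖, ξ)) + (volume : Measure ℂ).map (fun ξ => (-‖ξ‖, ξ))

theorem measurableEmbedding_upper : MeasurableEmbedding fun ξ : ℂ => (‖ξ‖, ξ) :=
  (Topology.IsClosedEmbedding.measurableEmbedding
    (.of_continuous_injective_isClosedMap (by fun_prop) (fun a b h => (Prod.ext_iff.1 h).2) <| by
      intro s hs
      have : (fun ξ : ℂ => (‖ξ‖, ξ)) '' s = {v : ℝ × ℂ | v.1 = ‖v.2‖} ∩ Prod.snd ⁻¹' s := by
        ext ⟨a, b⟩; constructor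
        · rintro ⟨ξ, h, h'⟩; cases h'; exact ⟨rfl, h⟩
        · rintro ⟨h, h'⟩; exact ⟨b, h', by simpa using Eq.symm h⟩
      rw [this]
      exact (isClosed_eq (by fun_prop) (by fun_prop)).inter (hs.preimage continuous_snd)))

theorem measurableEmbedding_lower : MeasurableEmbedding fun ξ : ℂ => (-‖ξ‖, ξ) :=
  ((MeasurableEquiv.neg ℝ).prodCongr (MeasurableEquiv.refl ℂ)).measurableEmbedding.comp
    measurableEmbedding_upper

theorem ae_mem_lightCone : ∀ᵐ v ∂coneMeasure, v ∈ lightCone := by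
  rw [coneMeasure, ae_add_measure_iff, measurableEmbedding_upper.ae_map_iff,
    measurableEmbedding_lower.ae_map_iff]
  constructor <;> refine Eventually.of_forall fun ξ => ?_ <;>
    simp only [lightCone, Set.mem_ofPred_eq, neg_sq, Complex.sq_norm, Complex.normSq_apply] <;> ring

theorem integrable_coneMeasure_iff {E : Type*} [NormedAddCommGroup E] {f : ℝ × ℂ → E} :
    Integrable f coneMeasure ↔
      Integrable (fun ξ => f (‖ξ‖, ξ)) ∧ Integrable (fun ξ => f (-‖ξ‖, ξ)) := by
  rw [coneMeasure, integrable_add_measure, measurableEmbedding_upper.integrable_map_iff,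
    measurableEmbedding_lower.integrable_map_iff]
  rfl

theorem integral_coneMeasure {f : ℝ × ℂ → ℂ} (hf : Integrable f coneMeasure) :
    ∫ v, f v ∂coneMeasure = ∫ ξ, (f (‖ξ‖, ξ) + f (-‖ξ‖, ξ)) := by
  have h := integrable_coneMeasure_iff.1 hf
  rw [integral_add h.1 h.2]
  rw [coneMeasure, integrable_add_measure] at hf
  rw [coneMeasure, integral_add_measure hf.1 hf.2, measurableEmbedding_upper.integral_map,
    measurableEmbedding_lower.integral_map]

theorem integrable_inv_norm_mul_inv_one_add_sq :
    Integrable fun ξ : ℂ => ‖ξ‖⁻¹ * (1 + ‖ξ‖ ^ 2)⁻¹ := by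
  refine (integrable_fun_norm_addHaar (volume : Measure ℂ)
    (f := fun r : ℝ => r⁻¹ * (1 + r ^ 2)⁻¹)).2 ?_
  refine (integrable_inv_one_add_sq.integrableOn (s := Set.Ioi (0 : ℝ))).congr_fun ?_
    measurableSet_Ioi
  intro r hr
  have : r ≠ 0 := (Set.mem_Ioi.1 hr).ne'
  simp [Complex.finrank_real_complex]
  field_simp

theorem _root_.SchwartzMap.integrable_pow_mul_inv_norm (g : 𝓢(ℂ, ℂ)) (n : ℕ) :
    Integrable fun ξ : ℂ => ‖ξ‖ ^ n * (‖ξ‖⁻¹ * ‖g ξ‖) := by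
  obtain ⟨C₀, -, h₀⟩ := g.decay n 0
  obtain ⟨C₂, -, h₂⟩ := g.decay (n + 2) 0
  simp only [norm_iteratedFDeriv_zero] at h₀ h₂
  refine (integrable_inv_norm_mul_inv_one_add_sq.const_mul (C₀ + C₂)).mono'
    (Measurable.aestronglyMeasurable ?_) (Eventually.of_forall fun ξ => ?_)
  · have := g.continuous.measurable
    fun_prop
  · rw [Real.norm_of_nonneg (by positivity)]
    have h : ‖ξ‖ ^ n * ‖g ξ‖ ≤ (C₀ + C₂) * (1 + ‖ξ‖ ^ 2)⁻¹ := by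
      rw [← div_eq_mul_inv, le_div_iff₀ (by positivity)]
      have := h₀ ξ
      have := h₂ ξ
      rw [pow_add] at this
      nlinarith
    calc ‖ξ‖ ^ n * (‖ξ‖⁻¹ * ‖g ξ‖) = ‖ξ‖⁻¹ * (‖ξ‖ ^ n * ‖g ξ‖) := by ring
      _ ≤ ‖ξ‖⁻¹ * ((C₀ + C₂) * (1 + ‖ξ‖ ^ 2)⁻¹) := by gcongr
      _ = _ := by ring

/-- The density on the light cone of the solution with transformed Cauchy data `f`, `g`. -/
noncomputable def cauchyDensity (f g : 𝓢(ℂ, ℂ)) (v : ℝ × ℂ) : ℂ :=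
  (f v.2 + (2 * Real.pi * Complex.I * v.1)⁻¹ * g v.2) / 2

theorem hasMoments_cauchyDensity (f g : 𝓢(ℂ, ℂ)) :
    HasMoments coneMeasure (cauchyDensity f g) := by
  have hm : Measurable (cauchyDensity f g) := by
    have := g.continuous.measurable
    have := f.continuous.measurable
    unfold cauchyDensity
    fun_prop
  have key (n : ℕ) (σ : ℝ) (hσ : |σ| = 1) :
      Integrable fun ξ : ℂ => ‖((σ * ‖ξ‖, ξ) : ℝ × ℂ)‖ ^ n * ‖cauchyDensity f g (σ * ‖ξ‖, ξ)‖ := by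
    refine ((f.integrable_pow_mul volume n).add (g.integrable_pow_mul_inv_norm n)).mono'
      (Measurable.aestronglyMeasurable (by fun_prop)) (Eventually.of_forall fun ξ => ?_)
    have h1 : ‖((σ * ‖ξ‖, ξ) : ℝ × ℂ)‖ = ‖ξ‖ := by simp [Prod.norm_def, hσ]
    rw [h1, norm_mul, norm_norm, norm_pow, norm_norm, Pi.add_apply, ← mul_add]
    gcongr
    have h2 : ‖((2 * Real.pi * Complex.I * (σ * ‖ξ‖ : ℝ))⁻¹ : ℂ)‖ ≤ ‖ξ‖⁻¹ := by
      simp only [norm_inv, norm_mul, Complex.norm_real, Complex.norm_I, Complex.norm_ofNat,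
        Real.norm_of_nonneg Real.pi_nonneg, Real.norm_eq_abs, hσ, abs_norm]
      rw [mul_inv]
      refine mul_le_of_le_one_left (by positivity) (inv_le_one_of_one_le₀ ?_) |>.trans_eq (by simp)
      linarith [Real.pi_gt_three]
    unfold cauchyDensity
    rw [norm_div, Complex.norm_ofNat]
    refine (half_le_self (norm_nonneg _)).trans ((norm_add_le _ _).trans ?_)
    rw [norm_mul]
    gcongr
  refine ⟨hm.aestronglyMeasurable, fun n => integrable_coneMeasure_iff.2 ⟨?_, ?_⟩⟩
  · simpa using key n 1 (by simp)
  · simpa using key n (-1) (by simp)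

theorem fourierIntegral_coneMeasure_zero {h : ℝ × ℂ → ℂ} (hh : HasMoments coneMeasure h)
    {F : 𝓢(ℂ, ℂ)} (hF : ∀ᵐ ξ : ℂ, h (‖ξ‖, ξ) + h (-‖ξ‖, ξ) = 𝓕 F ξ) (x y : ℝ) :
    VectorFourier.fourierIntegral 𝐞 coneMeasure phase.toLinearMap₁₂ h (0, x, y) = F ⟨x, y⟩ := by
  rw [VectorFourier.fourierIntegral, integral_coneMeasure (hh.integrable_smul phase _)]
  have hinv : 𝓕⁻ (𝓕 F) = F := by simp
  conv_rhs => rw [← hinv, SchwartzMap.fourierInv_coe, Real.fourierInv_eq]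
  refine integral_congr_ae ?_
  filter_upwards [hF] with ξ hξ
  rw [← hξ]
  simp [Circle.smul_def, Complex.inner]
  ring_nf

theorem exists_cauchy_solution (f g : 𝓢(ℂ, ℂ)) :
    ∃ w : ℝ × ℝ × ℝ → ℂ, ContDiff ℝ ∞ w ∧
      (∀ p, pd (1, 0, 0) (pd (1, 0, 0) w) p =
        pd (0, 1, 0) (pd (0, 1, 0) w) p + pd (0, 0, 1) (pd (0, 0, 1) w) p) ∧
      (∀ x y, w (0, x, y) = f ⟨x, y⟩) ∧ (∀ x y, pd (1, 0, 0) w (0, x, y) = g ⟨x, y⟩) ∧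
      ∀ K : Set (ℝ × ℝ × ℝ), IsCompact K → ∀ (m : ℕ) (ε : ℝ), 0 < ε →
        ∃ s ∈ Submodule.span ℂ (character phase '' lightCone), ∀ k ≤ m, ∀ p ∈ K,
          ‖iteratedFDeriv ℝ k (fun q => w q - s q) p‖ ≤ ε := by
  have hM := hasMoments_cauchyDensity (𝓕 f) (𝓕 g)
  have hne : ∀ᵐ ξ : ℂ, ξ ≠ 0 := by simp [ae_iff]
  refine ⟨VectorFourier.fourierIntegral 𝐞 coneMeasure phase.toLinearMap₁₂
    (cauchyDensity (𝓕 f) (𝓕 g)), VectorFourier.contDiff_fourierIntegral phase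
      fun n _ => hM.integrable n, fun p => ?_, fun x y => ?_, fun x y => ?_,
    fun K hK m ε hε => fourierIntegral_mem_closure_span_character ae_mem_lightCone
      hM.integrable hM.aestronglyMeasurable hK m hε⟩
  · have hM1 := hM.mul_phase phase (1, 0, 0)
    have hM2 := hM.mul_phase phase (0, 1, 0)
    have hM3 := hM.mul_phase phase (0, 0, 1)
    rw [pd_fourierIntegral phase hM, pd_fourierIntegral phase hM1, pd_fourierIntegral phase hM,
      pd_fourierIntegral phase hM2, pd_fourierIntegral phase hM, pd_fourierIntegral phase hM3]
    rw [VectorFourier.fourierIntegral, VectorFourier.fourierIntegral,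
      VectorFourier.fourierIntegral, ← integral_add
        ((hM2.mul_phase phase _).integrable_smul phase p)
        ((hM3.mul_phase phase _).integrable_smul phase p)]
    refine integral_congr_ae ?_
    filter_upwards [ae_mem_lightCone] with v hv
    have hv' : (v.1 : ℂ) ^ 2 = v.2.re ^ 2 + v.2.im ^ 2 := by exact_mod_cast hv
    simp only [Circle.smul_def, smul_eq_mul, phase_apply]
    push_cast
    linear_combination ((𝐞 (-(phase.toLinearMap₁₂ v) p) : ℂ) * (2 * Real.pi * Complex.I) ^ 2 *
      cauchyDensity (𝓕 f) (𝓕 g) v) * hv'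
  · refine fourierIntegral_coneMeasure_zero hM ?_ x y
    filter_upwards [hne] with ξ hξ
    simp [cauchyDensity]
    ring
  · rw [pd_fourierIntegral phase hM]
    refine fourierIntegral_coneMeasure_zero (hM.mul_phase phase (1, 0, 0)) ?_ x y
    filter_upwards [hne] with ξ hξ
    have h1 : (‖ξ‖ : ℂ) ≠ 0 := by simpa using hξ
    have h2 : (Real.pi : ℂ) ≠ 0 := by simp [Real.pi_ne_zero]
    simp [cauchyDensity]
    field_simp
    linear_combination (-2 * 𝓕 g ξ) * Complex.I_sq

end Cone

section DirectionalDerivative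

variable {E F : Type*} [NormedAddCommGroup E] [NormedSpace ℝ E] [NormedAddCommGroup F]
  [NormedSpace ℝ F] {f g : E → F}

theorem contDiff_pd (hf : ContDiff ℝ ∞ f) (v : E) : ContDiff ℝ ∞ (pd v f) :=
  (hf.fderiv_right (m := ∞) (by simp)).clm_apply contDiff_const

theorem _root_.ContDiff.differentiable_of_infty (hf : ContDiff ℝ ∞ f) : Differentiable ℝ f :=
  hf.differentiable (by simp)

theorem pd_comm (hf : ContDiff ℝ ∞ f) (v w : E) : pd v (pd w f) = pd w (pd v f) := by
  ext p
  have hd : DifferentiableAt ℝ (fderiv ℝ f) p :=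
    (hf.fderiv_right (m := ∞) (by simp)).differentiable_of_infty p
  have h (a b : E) : pd a (pd b f) p = fderiv ℝ (fderiv ℝ f) p a b := by
    change fderiv ℝ (fun x => fderiv ℝ f x b) p a = _
    rw [fderiv_clm_apply hd (differentiableAt_const b)]
    simp
  rw [h, h]
  exact ((contDiff_infty.1 hf 2).contDiffAt.isSymmSndFDerivAt (by simp)) v w

theorem pd_add (hf : Differentiable ℝ f) (hg : Differentiable ℝ g) (v : E) :
    pd v (fun q => f q + g q) = fun q => pd v f q + pd v g q := by
  ext p
  simp [pd, fderiv_fun_add (hf p) (hg p)]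

theorem pd_sub (hf : Differentiable ℝ f) (hg : Differentiable ℝ g) (v : E) :
    pd v (fun q => f q - g q) = fun q => pd v f q - pd v g q := by
  ext p
  simp [pd, fderiv_fun_sub (hf p) (hg p)]

theorem pd_comp_continuousLinearMap {E' : Type*} [NormedAddCommGroup E'] [NormedSpace ℝ E']
    (hf : Differentiable ℝ f) (R : E' →L[ℝ] E) (v : E') :
    pd v (fun q => f (R q)) = fun q => pd (R v) f (R q) := by
  ext p
  have := (hf (R p)).hasFDerivAt.comp p R.hasFDerivAt
  simp only [pd]
  rw [show (fun q => f (R q)) = f ∘ R from rfl, this.fderiv]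
  rfl

theorem pd_continuousLinearMap_comp {F' : Type*} [NormedAddCommGroup F'] [NormedSpace ℝ F']
    (hf : Differentiable ℝ f) (T : F →L[ℝ] F') (v : E) :
    pd v (fun q => T (f q)) = fun q => T (pd v f q) := by
  ext p
  have := T.hasFDerivAt.comp p (hf p).hasFDerivAt
  simp only [pd]
  rw [show (fun q => T (f q)) = T ∘ f from rfl, this.fderiv]
  rfl

theorem pd_congr_of_eventuallyEq {p : E} (h : f =ᶠ[𝓝 p] g) (v : E) : pd v f p = pd v g p := by
  simp only [pd, h.fderiv_eq]

/-- A family of functions vanishing on a hyperplane and stable under directional derivatives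
stays smooth when cut off along the hyperplane. -/
theorem contDiff_indicator_of_stable [FiniteDimensional ℝ E] (ℓ : E →L[ℝ] ℝ) (S : Set (E → F))
    (hdiff : ∀ f ∈ S, Differentiable ℝ f) (hzero : ∀ f ∈ S, ∀ p, ℓ p = 0 → f p = 0)
    (hpd : ∀ f ∈ S, ∀ v, pd v f ∈ S) (hf : f ∈ S) :
    ContDiff ℝ ∞ ({p | 0 ≤ ℓ p}.indicator f) := by
  have hfd : ∀ f ∈ S, ∀ p,
      HasFDerivAt ({p | 0 ≤ ℓ p}.indicator f) ({p | 0 ≤ ℓ p}.indicator (fderiv ℝ f) p) p := by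
    intro f hf p
    rcases lt_trichotomy (ℓ p) 0 with h | h | h
    · have hp : p ∉ {p | 0 ≤ ℓ p} := by simpa using h
      rw [Set.indicator_of_notMem hp]
      refine (hasFDerivAt_const (0 : F) p).congr_of_eventuallyEq ?_
      filter_upwards [ℓ.continuous.continuousAt.eventually_lt continuousAt_const h] with q hq
      exact Set.indicator_of_notMem (by simpa using hq) f
    · have hp : p ∈ {p | 0 ≤ ℓ p} := by simp [h]
      have h0 : fderiv ℝ f p = 0 := by
        ext v
        exact hzero _ (hpd f hf v) p h
      have hfp : HasFDerivAt f (0 : E →L[ℝ] F) p := h0 ▸ (hdiff f hf p).hasFDerivAt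
      rw [Set.indicator_of_mem hp, h0]
      rw [hasFDerivAt_iff_isLittleO] at hfp ⊢
      refine Asymptotics.IsBigO.trans_isLittleO (Asymptotics.IsBigO.of_bound 1 ?_) hfp
      refine Eventually.of_forall fun q => ?_
      simp only [Set.indicator_of_mem hp, hzero f hf p h, zero_apply, sub_zero,
        one_mul]
      exact norm_indicator_le_norm_self f q
    · have hp : p ∈ {p | 0 ≤ ℓ p} := h.le
      rw [Set.indicator_of_mem hp]
      refine (hdiff f hf p).hasFDerivAt.congr_of_eventuallyEq ?_
      filter_upwards [continuousAt_const.eventually_lt ℓ.continuous.continuousAt h] with q hq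
      exact Set.indicator_of_mem (by simpa using hq.le) f
  refine contDiff_infty.2 fun n => ?_
  induction n generalizing f with
  | zero =>
    exact_mod_cast contDiff_zero.2
      (continuous_iff_continuousAt.2 fun p => (hfd f hf p).continuousAt)
  | succ n ih =>
    rw [Nat.cast_succ, contDiff_succ_iff_fderiv_apply]
    refine ⟨fun p => (hfd f hf p).differentiableAt, by simp, fun v => ?_⟩
    convert ih (hpd f hf v) using 2 with p
    rw [(hfd f hf p).fderiv]
    by_cases hp : p ∈ {p | 0 ≤ ℓ p} <;> simp [hp, pd, Set.indicator]

end DirectionalDerivative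

section Reflection

variable {F : Type*} [NormedAddCommGroup F] [NormedSpace ℝ F] {f : ℝ × ℝ × ℝ → F}

theorem hasDerivAt_fst (hf : Differentiable ℝ f) (t x y : ℝ) :
    HasDerivAt (fun s => f (s, x, y)) (pd (1, 0, 0) f (t, x, y)) t :=
  (hf (t, x, y)).hasFDerivAt.comp_hasDerivAt t
    ((hasDerivAt_id t).prodMk ((hasDerivAt_const t x).prodMk (hasDerivAt_const t y)))

theorem hasDerivAt_snd (hf : Differentiable ℝ f) (t x y : ℝ) :
    HasDerivAt (fun s => f (t, s, y)) (pd (0, 1, 0) f (t, x, y)) x :=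
  (hf (t, x, y)).hasFDerivAt.comp_hasDerivAt x
    ((hasDerivAt_const x t).prodMk ((hasDerivAt_id x).prodMk (hasDerivAt_const x y)))

theorem hasDerivAt_trd (hf : Differentiable ℝ f) (t x y : ℝ) :
    HasDerivAt (fun s => f (t, x, s)) (pd (0, 0, 1) f (t, x, y)) y :=
  (hf (t, x, y)).hasFDerivAt.comp_hasDerivAt y
    ((hasDerivAt_const y t).prodMk ((hasDerivAt_const y x).prodMk (hasDerivAt_id y)))

theorem pd_eq_sum (f : ℝ × ℝ × ℝ → F) (v p : ℝ × ℝ × ℝ) :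
    pd v f p = v.1 • pd (1, 0, 0) f p + v.2.1 • pd (0, 1, 0) f p + v.2.2 • pd (0, 0, 1) f p := by
  simp only [pd, ← map_smul, ← map_add]
  congr 1
  ext <;> simp

/-- The wave operator. -/
noncomputable def dalembertian (f : ℝ × ℝ × ℝ → F) (p : ℝ × ℝ × ℝ) : F :=
  pd (1, 0, 0) (pd (1, 0, 0) f) p - pd (0, 1, 0) (pd (0, 1, 0) f) p -
    pd (0, 0, 1) (pd (0, 0, 1) f) p

theorem contDiff_dalembertian (hf : ContDiff ℝ ∞ f) : ContDiff ℝ ∞ (dalembertian f) :=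
  ((contDiff_pd (contDiff_pd hf _) _).sub (contDiff_pd (contDiff_pd hf _) _)).sub
    (contDiff_pd (contDiff_pd hf _) _)

theorem pd_dalembertian (hf : ContDiff ℝ ∞ f) (v : ℝ × ℝ × ℝ) :
    pd v (dalembertian f) = dalembertian (pd v f) := by
  have h (w : ℝ × ℝ × ℝ) : pd v (pd w (pd w f)) = pd w (pd w (pd v f)) := by
    rw [pd_comm (contDiff_pd hf w), pd_comm hf]
  have hd (w : ℝ × ℝ × ℝ) : Differentiable ℝ (pd w (pd w f)) :=
    (contDiff_pd (contDiff_pd hf w) w).differentiable_of_infty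
  ext p
  simp only [dalembertian, ← h]
  change pd v (fun q => pd (1, 0, 0) (pd (1, 0, 0) f) q - pd (0, 1, 0) (pd (0, 1, 0) f) q -
    pd (0, 0, 1) (pd (0, 0, 1) f) q) p = _
  rw [pd_sub ((hd _).fun_sub (hd _)) (hd _), pd_sub (hd _) (hd _)]

theorem dalembertian_sub {g : ℝ × ℝ × ℝ → F} (hf : ContDiff ℝ ∞ f) (hg : ContDiff ℝ ∞ g) :
    dalembertian (fun q => f q - g q) = fun q => dalembertian f q - dalembertian g q := by
  have hd {f : ℝ × ℝ × ℝ → F} (hf : ContDiff ℝ ∞ f) (w : ℝ × ℝ × ℝ) : Differentiable ℝ (pd w f) :=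
    (contDiff_pd hf w).differentiable_of_infty
  ext p
  simp only [dalembertian]
  rw [pd_sub hf.differentiable_of_infty hg.differentiable_of_infty,
    pd_sub hf.differentiable_of_infty hg.differentiable_of_infty,
    pd_sub hf.differentiable_of_infty hg.differentiable_of_infty,
    pd_sub (hd hf _) (hd hg _), pd_sub (hd hf _) (hd hg _), pd_sub (hd hf _) (hd hg _)]
  module

/-- The reflection across the plane `{x = 0}`. -/
noncomputable def reflX : (ℝ × ℝ × ℝ) →L[ℝ] (ℝ × ℝ × ℝ) :=
  (ContinuousLinearMap.id ℝ ℝ).prodMap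
    ((-ContinuousLinearMap.id ℝ ℝ).prodMap (ContinuousLinearMap.id ℝ ℝ))

@[simp] theorem reflX_apply (t x y : ℝ) : reflX (t, x, y) = (t, -x, y) := rfl

theorem reflX_reflX (p : ℝ × ℝ × ℝ) : reflX (reflX p) = p := by
  obtain ⟨t, x, y⟩ := p
  simp

theorem pd_neg_direction {E : Type*} [NormedAddCommGroup E] [NormedSpace ℝ E] (f : E → F) (v : E) :
    pd (-v) f = fun q => -pd v f q := by
  ext p
  simp [pd]

theorem pd_neg {E : Type*} [NormedAddCommGroup E] [NormedSpace ℝ E] (f : E → F) (v : E) :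
    pd v (fun q => -f q) = fun q => -pd v f q := by
  ext p
  simp [pd, fderiv_fun_neg]

theorem dalembertian_comp_reflX (hf : ContDiff ℝ ∞ f) :
    dalembertian (fun q => f (reflX q)) = fun q => dalembertian f (reflX q) := by
  have hd (w : ℝ × ℝ × ℝ) : Differentiable ℝ (pd w f) :=
    (contDiff_pd hf w).differentiable_of_infty
  have h (v : ℝ × ℝ × ℝ) : pd v (pd v fun q => f (reflX q)) =
      fun q => pd (reflX v) (pd (reflX v) f) (reflX q) := by
    rw [pd_comp_continuousLinearMap hf.differentiable_of_infty,
      pd_comp_continuousLinearMap (hd _)]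
  have h2 : pd (0, -1, 0) (pd (0, -1, 0) f) = pd (0, 1, 0) (pd (0, 1, 0) f) := by
    have : ((0, -1, 0) : ℝ × ℝ × ℝ) = -(0, 1, 0) := by simp
    rw [this, pd_neg_direction, pd_neg_direction, pd_neg]
    simp
  ext p
  simp only [dalembertian, h, reflX_apply, neg_zero, h2]

theorem closure_setOf_pos_snd : closure {p : ℝ × ℝ × ℝ | 0 < p.2.1} = {p | 0 ≤ p.2.1} := by
  have : {p : ℝ × ℝ × ℝ | 0 < p.2.1} = Set.univ ×ˢ Set.Ioi (0 : ℝ) ×ˢ Set.univ := by ext; simp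
  rw [this, closure_prod_eq, closure_prod_eq, closure_Ioi]
  ext; simp

theorem eq_of_eq_on_pos {X : Type*} [TopologicalSpace X] [T2Space X] {f g : ℝ × ℝ × ℝ → X}
    (hf : Continuous f) (hg : Continuous g) (h : ∀ p : ℝ × ℝ × ℝ, 0 < p.2.1 → f p = g p)
    {p : ℝ × ℝ × ℝ} (hp : 0 ≤ p.2.1) : f p = g p := by
  have hcl : Set.EqOn f g (closure {p : ℝ × ℝ × ℝ | 0 < p.2.1}) :=
    Set.EqOn.closure (fun q hq => h q hq) hf hg
  rw [closure_setOf_pos_snd] at hcl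
  exact hcl hp

theorem pd_eq_zero_of_nonneg (hf : ContDiff ℝ ∞ f) (h : ∀ p : ℝ × ℝ × ℝ, 0 ≤ p.2.1 → f p = 0)
    (v p : ℝ × ℝ × ℝ) (hp : 0 ≤ p.2.1) : pd v f p = 0 := by
  refine eq_of_eq_on_pos (contDiff_pd hf v).continuous (g := fun _ => 0) continuous_const
    (fun q hq => ?_) hp
  have : f =ᶠ[𝓝 q] fun _ => 0 := by
    filter_upwards [continuousAt_const.eventually_lt
      (by fun_prop : ContinuousAt (fun p : ℝ × ℝ × ℝ => p.2.1) q) hq] with r hr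
    exact h r hr.le
  rw [pd_congr_of_eventuallyEq this]
  simp [pd]

theorem pd_eq_zero_of_nonpos (hf : ContDiff ℝ ∞ f) (h : ∀ p : ℝ × ℝ × ℝ, p.2.1 ≤ 0 → f p = 0)
    (v p : ℝ × ℝ × ℝ) (hp : p.2.1 ≤ 0) : pd v f p = 0 := by
  have h1 := pd_eq_zero_of_nonneg (f := fun q => f (reflX q)) (hf.comp reflX.contDiff)
    (fun q hq => h _ (by obtain ⟨t, x, y⟩ := q; simpa using hq)) (reflX v) (reflX p)
    (by obtain ⟨t, x, y⟩ := p; simpa using hp)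
  rw [pd_comp_continuousLinearMap hf.differentiable_of_infty] at h1
  simpa only [reflX_reflX] using h1

/-- Functions with vanishing Cauchy data on `{x = 0}` whose image under the wave operator is flat
along `{x = 0}`. -/
def flatFamily (F : Type*) [NormedAddCommGroup F] [NormedSpace ℝ F] : Set (ℝ × ℝ × ℝ → F) :=
  {f | ContDiff ℝ ∞ f ∧ (∀ t y, f (t, 0, y) = 0) ∧ (∀ t y, pd (0, 1, 0) f (t, 0, y) = 0) ∧
    ∃ g h : ℝ × ℝ × ℝ → F, ContDiff ℝ ∞ g ∧ ContDiff ℝ ∞ h ∧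
      (∀ p : ℝ × ℝ × ℝ, 0 ≤ p.2.1 → g p = 0) ∧ (∀ p : ℝ × ℝ × ℝ, p.2.1 ≤ 0 → h p = 0) ∧
      dalembertian f = fun q => g q + h q}

theorem pd_eq_zero_of_tangential (hf : Differentiable ℝ f) (h : ∀ t y, f (t, 0, y) = 0) (t y : ℝ) :
    pd (1, 0, 0) f (t, 0, y) = 0 ∧ pd (0, 0, 1) f (t, 0, y) = 0 := by
  refine ⟨(hasDerivAt_fst hf t 0 y).unique ?_, (hasDerivAt_trd hf t 0 y).unique ?_⟩
  · simpa only [h] using hasDerivAt_const t (0 : F)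
  · simpa only [h] using hasDerivAt_const y (0 : F)

theorem pd_mem_flatFamily (hf : f ∈ flatFamily F) (v : ℝ × ℝ × ℝ) : pd v f ∈ flatFamily F := by
  obtain ⟨hs, h0, h1, g, h, hg, hh, hg0, hh0, hgh⟩ := hf
  have hfd := hs.differentiable_of_infty
  have hd (w : ℝ × ℝ × ℝ) : Differentiable ℝ (pd w f) :=
    (contDiff_pd hs w).differentiable_of_infty
  refine ⟨contDiff_pd hs v, fun t y => ?_, fun t y => ?_, pd v g, pd v h, contDiff_pd hg v,
    contDiff_pd hh v, pd_eq_zero_of_nonneg hg hg0 v, pd_eq_zero_of_nonpos hh hh0 v, ?_⟩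
  · obtain ⟨ha, hb⟩ := pd_eq_zero_of_tangential hfd h0 t y
    rw [pd_eq_sum, ha, hb, h1]
    simp
  · obtain ⟨ha, hb⟩ := pd_eq_zero_of_tangential (hd _) h1 t y
    have hc := (pd_eq_zero_of_tangential (hd (1, 0, 0))
      (fun t y => (pd_eq_zero_of_tangential hfd h0 t y).1) t y).1
    have he := (pd_eq_zero_of_tangential (hd (0, 0, 1))
      (fun t y => (pd_eq_zero_of_tangential hfd h0 t y).2) t y).2
    have hx : dalembertian f (t, 0, y) = 0 := by
      rw [hgh]
      simp [hg0 (t, 0, y) le_rfl, hh0 (t, 0, y) le_rfl]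
    rw [dalembertian, hc, he] at hx
    rw [pd_comm hs, pd_eq_sum, ha, hb]
    simp only [zero_sub, sub_zero, neg_eq_zero] at hx
    simp [hx]
  · rw [← pd_dalembertian hs, hgh, pd_add hg.differentiable_of_infty hh.differentiable_of_infty]

/-- A solution on the halfspace with Neumann boundary condition has a smooth even extension. -/
theorem exists_even_extension {u : ℝ × ℝ × ℝ → F} (hu : ContDiff ℝ ∞ u)
    (hwave : ∀ p : ℝ × ℝ × ℝ, 0 ≤ p.2.1 → dalembertian u p = 0)
    (hbc : ∀ t y, pd (0, 1, 0) u (t, 0, y) = 0) :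
    ∃ v : ℝ × ℝ × ℝ → F, ContDiff ℝ ∞ v ∧ (∀ p : ℝ × ℝ × ℝ, 0 ≤ p.2.1 → v p = u p) ∧
      ∀ p, v (reflX p) = v p := by
  have hur : ContDiff ℝ ∞ fun q => u (reflX q) := hu.comp reflX.contDiff
  let ℓ : (ℝ × ℝ × ℝ) →L[ℝ] ℝ :=
    (ContinuousLinearMap.fst ℝ ℝ ℝ).comp (ContinuousLinearMap.snd ℝ ℝ (ℝ × ℝ))
  have hD : (fun q => u q - u (reflX q)) ∈ flatFamily F := by
    refine ⟨hu.sub hur, by simp, fun t y => ?_, dalembertian u, ?_⟩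
    · rw [pd_sub hu.differentiable_of_infty hur.differentiable_of_infty,
        pd_comp_continuousLinearMap hu.differentiable_of_infty]
      have : ((0, -1, 0) : ℝ × ℝ × ℝ) = -(0, 1, 0) := by simp
      simp only [reflX_apply, neg_zero]
      rw [this, pd_neg_direction]
      simp [hbc]
    · refine ⟨fun q => -dalembertian u (reflX q), contDiff_dalembertian hu,
        ((contDiff_dalembertian hu).comp reflX.contDiff).neg, hwave, fun p hp => ?_, ?_⟩
      · obtain ⟨t, x, y⟩ := p
        simp [hwave (t, -x, y) (by simpa using hp)]
      · rw [dalembertian_sub hu hur, dalembertian_comp_reflX hu]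
        simp only [sub_eq_add_neg]
  refine ⟨fun q => u (reflX q) + {p | 0 ≤ ℓ p}.indicator (fun q => u q - u (reflX q)) q,
    hur.add (contDiff_indicator_of_stable ℓ (flatFamily F)
      (fun f hf => hf.1.differentiable_of_infty)
      (fun f hf p hp => ?_) (fun f hf v => pd_mem_flatFamily hf v) hD), fun p hp => ?_, fun p => ?_⟩
  · obtain ⟨t, x, y⟩ := p
    obtain rfl : x = 0 := hp
    exact hf.2.1 t y
  · change u (reflX p) + {p | 0 ≤ ℓ p}.indicator (fun q => u q - u (reflX q)) p = u p
    rw [Set.indicator_of_mem (show p ∈ {p | 0 ≤ ℓ p} from hp)]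
    abel
  · obtain ⟨t, x, y⟩ := p
    rcases lt_trichotomy x 0 with h | rfl | h
    · simp [Set.indicator, ℓ, h.le, h.not_ge]
    · simp
    · simp [Set.indicator, ℓ, h.le, h.not_ge]

end Reflection

section Energy

/-- If a vector field has nonpositive divergence on a box, vanishes at time `0` and has vanishing
normal components on the lateral faces, then a nonnegative first component vanishes at the final
time. -/
theorem eq_zero_of_divergence_nonpos {F₁ F₂ F₃ : ℝ × ℝ × ℝ → ℝ} (h₁ : ContDiff ℝ ∞ F₁)
    (h₂ : ContDiff ℝ ∞ F₂) (h₃ : ContDiff ℝ ∞ F₃) {T R : ℝ} (hT : 0 ≤ T) (hR : 0 ≤ R)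
    (hdiv : ∀ t x y, 0 ≤ t → t ≤ T → 0 ≤ x →
      pd (1, 0, 0) F₁ (t, x, y) + pd (0, 1, 0) F₂ (t, x, y) + pd (0, 0, 1) F₃ (t, x, y) ≤ 0)
    (hbot : ∀ x y, 0 ≤ x → F₁ (0, x, y) = 0) (hpos : ∀ x y, 0 ≤ F₁ (T, x, y))
    (hx₀ : ∀ t y, F₂ (t, 0, y) = 0) (hx₁ : ∀ t y, 0 ≤ t → t ≤ T → F₂ (t, R, y) = 0)
    (hy : ∀ t x y, 0 ≤ t → t ≤ T → |y| = R → F₃ (t, x, y) = 0) {x y : ℝ} (hx : 0 < x)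
    (hxR : x < R) (hyR : |y| < R) : F₁ (T, x, y) = 0 := by
  let ι : (Fin 3 → ℝ) →L[ℝ] ℝ × ℝ × ℝ :=
    (ContinuousLinearMap.proj 0).prod
      ((ContinuousLinearMap.proj 1).prod (ContinuousLinearMap.proj 2))
  have hι (q : Fin 3 → ℝ) : ι q = (q 0, q 1, q 2) := rfl
  let F : Fin 3 → ℝ × ℝ × ℝ → ℝ := ![F₁, F₂, F₃]
  have hF (i : Fin 3) : ContDiff ℝ ∞ (F i) := by fin_cases i <;> assumption
  have hFι (i : Fin 3) : ContDiff ℝ ∞ fun q => F i (ι q) := (hF i).comp ι.contDiff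
  let a : Fin 3 → ℝ := ![0, 0, -R]
  let b : Fin 3 → ℝ := ![T, R, R]
  have hab : a ≤ b := by
    intro i
    fin_cases i <;> simp [a, b] <;> linarith
  have key := integral_divergence_of_hasFDerivAt_off_countable' a b hab (fun i q => F i (ι q))
    (fun i => fderiv ℝ fun q => F i (ι q)) ∅ Set.countable_empty
    (fun i => (hFι i).continuous.continuousOn)
    (fun q _ i => ((hFι i).differentiable_of_infty q).hasFDerivAt)
    (ContinuousOn.integrableOn_compact isCompact_Icc (continuous_finsetSum _ fun i _ =>
      (contDiff_pd (hFι i) _).continuous).continuousOn)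
  have hdir (i : Fin 3) (q : Fin 3 → ℝ) : fderiv ℝ (fun q => F i (ι q)) q (Pi.single i 1) =
      pd (ι (Pi.single i 1)) (F i) (ι q) :=
    congrFun (pd_comp_continuousLinearMap (hF i).differentiable_of_infty ι (Pi.single i 1)) q
  have hle : (∫ q in Set.Icc a b,
      ∑ i, fderiv ℝ (fun q => F i (ι q)) q (Pi.single i 1)) ≤ 0 := by
    refine setIntegral_nonpos measurableSet_Icc fun q hq => ?_
    have := hdiv (q 0) (q 1) (q 2) (by simpa [a] using hq.1 0) (by simpa [b] using hq.2 0)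
      (by simpa [a] using hq.1 1)
    simp only [hdir, Fin.sum_univ_three]
    simpa [hι, F] using this
  rw [key, Fin.sum_univ_three] at hle
  have hz {s : Set (Fin 2 → ℝ)} {f : (Fin 2 → ℝ) → ℝ}
      (h : ∀ q ∈ s, f q = 0) : ∫ q in s, f q = 0 := setIntegral_eq_zero_of_forall_eq_zero h
  have e0 (c : ℝ) (q : Fin 2 → ℝ) : ι ((0 : Fin 3).insertNth c q) = (c, q 0, q 1) := rfl
  have e1 (c : ℝ) (q : Fin 2 → ℝ) : ι ((1 : Fin 3).insertNth c q) = (q 0, c, q 1) := rfl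
  have e2 (c : ℝ) (q : Fin 2 → ℝ) : ι ((2 : Fin 3).insertNth c q) = (q 0, q 1, c) := rfl
  simp only [e0, e1, e2] at hle
  rw [hz (f := fun q => F 0 (a 0, q 0, q 1))
      (fun q hq => hbot _ _ (hq.1 0)),
    hz (f := fun q => F 1 (q 0, a 1, q 1)) (fun q hq => hx₀ _ _),
    hz (f := fun q => F 1 (q 0, b 1, q 1))
      (fun q hq => hx₁ _ _ (hq.1 0) (hq.2 0)),
    hz (f := fun q => F 2 (q 0, q 1, a 2))
      (fun q hq => hy _ _ _ (hq.1 0) (hq.2 0) (by simp [a, abs_of_nonneg hR])),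
    hz (f := fun q => F 2 (q 0, q 1, b 2))
      (fun q hq => hy _ _ _ (hq.1 0) (hq.2 0) (by simp [b, abs_of_nonneg hR]))] at hle
  simp only [sub_zero, add_zero] at hle
  have hcont : Continuous fun q : Fin 2 → ℝ => F 0 (b 0, q 0, q 1) :=
    (hF 0).continuous.comp (by fun_prop)
  have hnn (q : Fin 2 → ℝ) : 0 ≤ F 0 (b 0, q 0, q 1) := hpos _ _
  have hzero := (setIntegral_eq_zero_iff_of_nonneg_ae (Eventually.of_forall hnn)
    (hcont.continuousOn.integrableOn_compact isCompact_Icc)).1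
    (le_antisymm hle (integral_nonneg hnn))
  have hopen : IsOpen {q : Fin 2 → ℝ | 0 < q 0 ∧ q 0 < R ∧ |q 1| < R} := by
    simp only [Set.ofPred_and]
    refine (isOpen_lt ?_ ?_).inter ((isOpen_lt ?_ ?_).inter (isOpen_lt ?_ ?_)) <;> fun_prop
  have hsub : {q : Fin 2 → ℝ | 0 < q 0 ∧ q 0 < R ∧ |q 1| < R} ⊆
      Set.Icc (a ∘ Fin.succAbove 0) (b ∘ Fin.succAbove 0) := by
    rintro q ⟨hq0, hq1, hq2⟩
    rw [abs_lt] at hq2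
    constructor <;> intro i <;> fin_cases i
    · exact hq0.le
    · exact hq2.1.le
    · exact hq1.le
    · exact hq2.2.le
  exact Measure.eqOn_open_of_ae_eq (ae_restrict_of_ae_restrict_of_subset hsub hzero) hopen
    hcont.continuousOn continuousOn_const (show ![x, y] ∈ _ from ⟨hx, hxR, hyR⟩)

theorem pd_mul {E : Type*} [NormedAddCommGroup E] [NormedSpace ℝ E] {f g : E → ℝ}
    (hf : Differentiable ℝ f) (hg : Differentiable ℝ g) (v : E) :
    pd v (fun q => f q * g q) = fun q => pd v f q * g q + f q * pd v g q := by
  ext p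
  simp only [pd, fderiv_fun_mul (hf p) (hg p)]
  simp
  ring

theorem pd_const_mul {E : Type*} [NormedAddCommGroup E] [NormedSpace ℝ E] {f : E → ℝ}
    (hf : Differentiable ℝ f) (c : ℝ) (v : E) :
    pd v (fun q => c * f q) = fun q => c * pd v f q := by
  ext p
  simp [pd, fderiv_const_mul (hf p)]

theorem two_mul_mul_add_mul_le {ρ x y a b c : ℝ} (hρ : 0 ≤ ρ) (h : x ^ 2 + y ^ 2 ≤ ρ ^ 2) :
    2 * a * (x * b + y * c) ≤ ρ * (a ^ 2 + b ^ 2 + c ^ 2) := by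
  have hs : 0 ≤ b ^ 2 + c ^ 2 := by positivity
  have h1 : |x * b + y * c| ≤ ρ * √(b ^ 2 + c ^ 2) := by
    refine abs_le_of_sq_le_sq ?_ (by positivity)
    rw [mul_pow, Real.sq_sqrt hs]
    nlinarith [sq_nonneg (x * c - y * b), mul_le_mul_of_nonneg_right h hs]
  calc 2 * a * (x * b + y * c) ≤ |2 * a * (x * b + y * c)| := le_abs_self _
    _ = 2 * |a| * |x * b + y * c| := by rw [abs_mul, abs_mul, abs_two]
    _ ≤ 2 * |a| * (ρ * √(b ^ 2 + c ^ 2)) := by gcongr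
    _ ≤ ρ * (|a| ^ 2 + √(b ^ 2 + c ^ 2) ^ 2) := by
      nlinarith [mul_nonneg hρ (sq_nonneg (|a| - √(b ^ 2 + c ^ 2)))]
    _ = ρ * (a ^ 2 + b ^ 2 + c ^ 2) := by rw [sq_abs, Real.sq_sqrt hs, add_assoc]

theorem deriv_expNegInvGlue_of_neg {s : ℝ} (hs : s < 0) : deriv expNegInvGlue s = 0 := by
  have : expNegInvGlue =ᶠ[𝓝 s] fun _ => 0 := by
    filter_upwards [Iio_mem_nhds hs] with r hr
    exact expNegInvGlue.zero_of_nonpos (le_of_lt hr)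
  rw [this.deriv_eq, deriv_const]

/-- A smooth weight supported in the backward light cone with vertex `(R, 0, 0)`. -/
noncomputable def coneWeight (R : ℝ) (q : ℝ × ℝ × ℝ) : ℝ :=
  expNegInvGlue ((R - q.1) ^ 2 - q.2.1 ^ 2 - q.2.2 ^ 2)

theorem contDiff_coneWeight (R : ℝ) : ContDiff ℝ ∞ (coneWeight R) :=
  expNegInvGlue.contDiff.comp (by fun_prop)

theorem pd_coneWeight (R t x y : ℝ) :
    pd (1, 0, 0) (coneWeight R) (t, x, y) =
        deriv expNegInvGlue ((R - t) ^ 2 - x ^ 2 - y ^ 2) * (-2 * (R - t)) ∧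
      pd (0, 1, 0) (coneWeight R) (t, x, y) =
        deriv expNegInvGlue ((R - t) ^ 2 - x ^ 2 - y ^ 2) * (-2 * x) ∧
      pd (0, 0, 1) (coneWeight R) (t, x, y) =
        deriv expNegInvGlue ((R - t) ^ 2 - x ^ 2 - y ^ 2) * (-2 * y) := by
  have hd : Differentiable ℝ expNegInvGlue :=
    (expNegInvGlue.contDiff (n := ⊤)).differentiable_of_infty
  have hη := (hd ((R - t) ^ 2 - x ^ 2 - y ^ 2)).hasDerivAt
  have hw := (contDiff_coneWeight R).differentiable_of_infty
  refine ⟨(hasDerivAt_fst hw t x y).unique ?_, (hasDerivAt_snd hw t x y).unique ?_,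
    (hasDerivAt_trd hw t x y).unique ?_⟩
  · refine HasDerivAt.comp t (h₂ := expNegInvGlue) hη ?_
    exact ((((hasDerivAt_id t).const_sub R).pow 2).sub_const (x ^ 2)).sub_const (y ^ 2)
      |>.congr_deriv (by simp)
  · refine HasDerivAt.comp x (h₂ := expNegInvGlue) hη ?_
    exact (((hasDerivAt_id x).pow 2).const_sub ((R - t) ^ 2)).sub_const (y ^ 2)
      |>.congr_deriv (by simp)
  · refine HasDerivAt.comp y (h₂ := expNegInvGlue) hη ?_
    exact ((hasDerivAt_id y).pow 2).const_sub ((R - t) ^ 2 - x ^ 2) |>.congr_deriv (by simp)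

theorem coneWeight_eq_zero {R t x y : ℝ} (h : (R - t) ^ 2 ≤ x ^ 2 + y ^ 2) :
    coneWeight R (t, x, y) = 0 :=
  expNegInvGlue.zero_of_nonpos (by dsimp only; linarith)

/-- The energy flux of a solution of the wave equation, weighted by `coneWeight`, has nonpositive
divergence. -/
theorem divergence_energy_nonpos {z : ℝ × ℝ × ℝ → ℝ} (hz : ContDiff ℝ ∞ z) {R t x y : ℝ}
    (hwave : dalembertian z (t, x, y) = 0) (htR : t ≤ R) :
    pd (1, 0, 0) (fun q => coneWeight R q * (pd (1, 0, 0) z q * pd (1, 0, 0) z q +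
        pd (0, 1, 0) z q * pd (0, 1, 0) z q + pd (0, 0, 1) z q * pd (0, 0, 1) z q)) (t, x, y) +
      pd (0, 1, 0) (fun q => -2 * (coneWeight R q * (pd (1, 0, 0) z q * pd (0, 1, 0) z q)))
        (t, x, y) +
      pd (0, 0, 1) (fun q => -2 * (coneWeight R q * (pd (1, 0, 0) z q * pd (0, 0, 1) z q)))
        (t, x, y) ≤ 0 := by
  have hw := (contDiff_coneWeight R).differentiable_of_infty
  have hd (v : ℝ × ℝ × ℝ) : Differentiable ℝ (pd v z) := (contDiff_pd hz v).differentiable_of_infty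
  obtain ⟨h1, h2, h3⟩ := pd_coneWeight R t x y
  rw [pd_mul hw (by fun_prop), pd_const_mul (by fun_prop), pd_const_mul (by fun_prop),
    pd_mul hw (by fun_prop), pd_mul hw (by fun_prop), pd_mul (hd _) (hd _), pd_mul (hd _) (hd _),
    pd_add (by fun_prop) (by fun_prop), pd_add (by fun_prop) (by fun_prop), pd_mul (hd _) (hd _),
    pd_mul (hd _) (hd _), pd_mul (hd _) (hd _)]
  simp only [h1, h2, h3]
  rw [pd_comm hz (0, 1, 0) (1, 0, 0), pd_comm hz (0, 0, 1) (1, 0, 0)]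
  rw [dalembertian] at hwave
  have hη : 0 ≤ deriv expNegInvGlue ((R - t) ^ 2 - x ^ 2 - y ^ 2) *
      ((R - t) * (pd (1, 0, 0) z (t, x, y) ^ 2 + pd (0, 1, 0) z (t, x, y) ^ 2 +
          pd (0, 0, 1) z (t, x, y) ^ 2) -
        2 * pd (1, 0, 0) z (t, x, y) *
          (x * pd (0, 1, 0) z (t, x, y) + y * pd (0, 0, 1) z (t, x, y))) := by
    rcases lt_or_ge ((R - t) ^ 2 - x ^ 2 - y ^ 2) 0 with h | h
    · simp [deriv_expNegInvGlue_of_neg h]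
    · exact mul_nonneg expNegInvGlue.monotone.deriv_nonneg
        (sub_nonneg.2 (two_mul_mul_add_mul_le (sub_nonneg.2 htR) (by linarith)))
  linear_combination 2 * hη + 2 * coneWeight R (t, x, y) * pd (1, 0, 0) z (t, x, y) * hwave

/-- Finite speed of propagation on the halfspace with Neumann boundary condition, for real-valued
functions and positive times. -/
theorem eq_zero_of_cauchy_data_zero_real {z : ℝ × ℝ × ℝ → ℝ} (hz : ContDiff ℝ ∞ z)
    (hwave : ∀ p : ℝ × ℝ × ℝ, 0 ≤ p.2.1 → dalembertian z p = 0)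
    (hbc : ∀ t y, pd (0, 1, 0) z (t, 0, y) = 0) {R : ℝ}
    (h₀ : ∀ x y, 0 ≤ x → x ^ 2 + y ^ 2 < R ^ 2 → z (0, x, y) = 0)
    (h₁ : ∀ x y, 0 ≤ x → x ^ 2 + y ^ 2 < R ^ 2 → pd (1, 0, 0) z (0, x, y) = 0) {t x y : ℝ}
    (ht : 0 ≤ t) (htR : t < R) (hx : 0 < x) (h : x ^ 2 + y ^ 2 < (R - t) ^ 2) :
    z (t, x, y) = 0 := by
  have hzd := hz.differentiable_of_infty
  have hd (v : ℝ × ℝ × ℝ) : ContDiff ℝ ∞ (pd v z) := contDiff_pd hz v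
  have hw := contDiff_coneWeight R
  have h₂ (x y : ℝ) (hx : 0 ≤ x) (hxy : x ^ 2 + y ^ 2 < R ^ 2) : pd (0, 1, 0) z (0, x, y) = 0 := by
    rcases hx.eq_or_lt with rfl | hx
    · exact hbc 0 y
    · refine (hasDerivAt_snd hzd 0 x y).unique
        ((hasDerivAt_const x (0 : ℝ)).congr_of_eventuallyEq ?_)
      filter_upwards [Ioi_mem_nhds hx, (isOpen_lt (by fun_prop) continuous_const :
        IsOpen {s : ℝ | s ^ 2 + y ^ 2 < R ^ 2}).mem_nhds hxy] with s hs hs'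
      exact h₀ s y (le_of_lt hs) hs'
  have h₃ (x y : ℝ) (hx : 0 ≤ x) (hxy : x ^ 2 + y ^ 2 < R ^ 2) : pd (0, 0, 1) z (0, x, y) = 0 := by
    refine (hasDerivAt_trd hzd 0 x y).unique
      ((hasDerivAt_const y (0 : ℝ)).congr_of_eventuallyEq ?_)
    filter_upwards [(isOpen_lt (by fun_prop) continuous_const :
      IsOpen {s : ℝ | x ^ 2 + s ^ 2 < R ^ 2}).mem_nhds hxy] with s hs
    exact h₀ x s hx hs
  have key : ∀ s ∈ Set.Icc 0 t, pd (1, 0, 0) z (s, x, y) = 0 := by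
    intro s hs
    have hsR : s < R := hs.2.trans_lt htR
    have hR : 0 < R := hs.1.trans_lt hsR
    have hxy : x ^ 2 + y ^ 2 < (R - s) ^ 2 :=
      h.trans_le (pow_le_pow_left₀ (by linarith) (by linarith [hs.2]) 2)
    have hxyR : x ^ 2 + y ^ 2 < R ^ 2 :=
      hxy.trans_le (pow_le_pow_left₀ (by linarith) (by linarith [hs.1]) 2)
    have hxR : x < R := lt_of_pow_lt_pow_left₀ 2 hR.le (by linarith [sq_nonneg y])
    have hyR : |y| < R := abs_lt_of_sq_lt_sq (by linarith [sq_nonneg x]) hR.le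
    have hlat {s' a b : ℝ} (h0 : 0 ≤ s') (h1 : s' ≤ s) (hab : R ^ 2 ≤ a ^ 2 + b ^ 2) :
        coneWeight R (s', a, b) = 0 :=
      coneWeight_eq_zero ((pow_le_pow_left₀ (by linarith) (by linarith) 2).trans hab)
    have := eq_zero_of_divergence_nonpos (T := s) (R := R)
      (hw.mul ((((hd (1, 0, 0)).mul (hd (1, 0, 0))).add ((hd (0, 1, 0)).mul (hd (0, 1, 0)))).add
        ((hd (0, 0, 1)).mul (hd (0, 0, 1)))))
      (contDiff_const.mul (hw.mul ((hd (1, 0, 0)).mul (hd (0, 1, 0)))))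
      (contDiff_const.mul (hw.mul ((hd (1, 0, 0)).mul (hd (0, 0, 1))))) hs.1 hR.le
      (fun t' x' y' _ ht' hx' => divergence_energy_nonpos hz (hwave (t', x', y') hx')
        (ht'.trans hsR.le))
      (fun x' y' hx' => ?_)
      (fun x' y' => mul_nonneg (expNegInvGlue.nonneg _)
        (add_nonneg (add_nonneg (mul_self_nonneg _) (mul_self_nonneg _)) (mul_self_nonneg _)))
      (fun t' y' => by simp [hbc])
      (fun t' y' h0 h1 => by rw [hlat h0 h1 (by linarith [sq_nonneg y'])]; simp)
      (fun t' x' y' h0 h1 hy => by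
        rw [hlat h0 h1 (by rw [← hy, sq_abs]; linarith [sq_nonneg x'])]; simp)
      hx hxR hyR
    · have hpos : 0 < coneWeight R (s, x, y) :=
        expNegInvGlue.pos_of_pos (by dsimp only; linarith)
      have hsum := (mul_eq_zero.1 this).resolve_left hpos.ne'
      nlinarith [mul_self_nonneg (pd (1, 0, 0) z (s, x, y)),
        mul_self_nonneg (pd (0, 1, 0) z (s, x, y)), mul_self_nonneg (pd (0, 0, 1) z (s, x, y))]
    · rcases lt_or_ge (x' ^ 2 + y' ^ 2) (R ^ 2) with hlt | hge
      · simp [h₁ x' y' hx' hlt, h₂ x' y' hx' hlt, h₃ x' y' hx' hlt]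
      · rw [hlat le_rfl hs.1 hge, zero_mul]
  rw [constant_of_has_deriv_right_zero (f := fun s => z (s, x, y)) (a := 0) (b := t)
    (hz.continuous.comp (by fun_prop)).continuousOn (fun s hs => ?_) t ⟨ht, le_rfl⟩]
  · exact h₀ x y hx.le (h.trans_le (pow_le_pow_left₀ (by linarith) (by linarith) 2))
  · have := (hasDerivAt_fst hzd s x y).hasDerivWithinAt (s := Set.Ici s)
    rwa [key s ⟨hs.1, hs.2.le⟩] at this

end Energy

section HalfspaceUniqueness

theorem dalembertian_add {F : Type*} [NormedAddCommGroup F] [NormedSpace ℝ F]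
    {f g : ℝ × ℝ × ℝ → F} (hf : ContDiff ℝ ∞ f) (hg : ContDiff ℝ ∞ g) :
    dalembertian (fun q => f q + g q) = fun q => dalembertian f q + dalembertian g q := by
  have hd {f : ℝ × ℝ × ℝ → F} (hf : ContDiff ℝ ∞ f) (w : ℝ × ℝ × ℝ) : Differentiable ℝ (pd w f) :=
    (contDiff_pd hf w).differentiable_of_infty
  ext p
  simp only [dalembertian]
  rw [pd_add hf.differentiable_of_infty hg.differentiable_of_infty,
    pd_add hf.differentiable_of_infty hg.differentiable_of_infty,
    pd_add hf.differentiable_of_infty hg.differentiable_of_infty,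
    pd_add (hd hf _) (hd hg _), pd_add (hd hf _) (hd hg _), pd_add (hd hf _) (hd hg _)]
  module

theorem dalembertian_continuousLinearMap_comp {F G : Type*} [NormedAddCommGroup F]
    [NormedSpace ℝ F] [NormedAddCommGroup G] [NormedSpace ℝ G] {f : ℝ × ℝ × ℝ → F}
    (hf : ContDiff ℝ ∞ f) (L : F →L[ℝ] G) :
    dalembertian (fun q => L (f q)) = fun q => L (dalembertian f q) := by
  have h (v : ℝ × ℝ × ℝ) : pd v (pd v fun q => L (f q)) = fun q => L (pd v (pd v f) q) := by
    rw [pd_continuousLinearMap_comp hf.differentiable_of_infty,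
      pd_continuousLinearMap_comp (contDiff_pd hf v).differentiable_of_infty]
  ext p
  simp only [dalembertian, h, map_sub]

/-- Time reversal. -/
noncomputable def reflT : (ℝ × ℝ × ℝ) →L[ℝ] (ℝ × ℝ × ℝ) :=
  (-ContinuousLinearMap.id ℝ ℝ).prodMap (ContinuousLinearMap.id ℝ (ℝ × ℝ))

@[simp] theorem reflT_apply (t x y : ℝ) : reflT (t, x, y) = (-t, x, y) := rfl

theorem dalembertian_comp_reflT {F : Type*} [NormedAddCommGroup F] [NormedSpace ℝ F]
    {f : ℝ × ℝ × ℝ → F} (hf : ContDiff ℝ ∞ f) :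
    dalembertian (fun q => f (reflT q)) = fun q => dalembertian f (reflT q) := by
  have h (v : ℝ × ℝ × ℝ) : pd v (pd v fun q => f (reflT q)) =
      fun q => pd (reflT v) (pd (reflT v) f) (reflT q) := by
    rw [pd_comp_continuousLinearMap hf.differentiable_of_infty,
      pd_comp_continuousLinearMap (contDiff_pd hf _).differentiable_of_infty]
  have h2 : pd (-1, 0, 0) (pd (-1, 0, 0) f) = pd (1, 0, 0) (pd (1, 0, 0) f) := by
    have : ((-1, 0, 0) : ℝ × ℝ × ℝ) = -(1, 0, 0) := by simp
    rw [this, pd_neg_direction, pd_neg_direction, pd_neg]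
    simp
  ext p
  simp only [dalembertian, h, reflT_apply, neg_zero, h2]

/-- The open double light cone `{|t| + |(x, y)| < R}`. -/
def doubleCone (R : ℝ) : Set (ℝ × ℝ × ℝ) :=
  {p | |p.1| < R ∧ p.2.1 ^ 2 + p.2.2 ^ 2 < (R - |p.1|) ^ 2}

theorem isOpen_doubleCone (R : ℝ) : IsOpen (doubleCone R) := by
  simp only [doubleCone, Set.ofPred_and]
  refine (isOpen_lt ?_ ?_).inter (isOpen_lt ?_ ?_) <;> fun_prop

/-- Finite speed of propagation on the halfspace with Neumann boundary condition. -/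
theorem eq_zero_of_cauchy_data_zero {z : ℝ × ℝ × ℝ → ℂ} (hz : ContDiff ℝ ∞ z)
    (hwave : ∀ p : ℝ × ℝ × ℝ, 0 ≤ p.2.1 → dalembertian z p = 0)
    (hbc : ∀ t y, pd (0, 1, 0) z (t, 0, y) = 0) {R : ℝ}
    (h₀ : ∀ x y, 0 ≤ x → x ^ 2 + y ^ 2 < R ^ 2 → z (0, x, y) = 0)
    (h₁ : ∀ x y, 0 ≤ x → x ^ 2 + y ^ 2 < R ^ 2 → pd (1, 0, 0) z (0, x, y) = 0)
    {p : ℝ × ℝ × ℝ} (hp : p ∈ doubleCone R) (hx : 0 < p.2.1) : z p = 0 := by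
  obtain ⟨t, x, y⟩ := p
  have hzd := hz.differentiable_of_infty
  have key (L : ℂ →L[ℝ] ℝ) : L (z (t, x, y)) = 0 := by
    have hL : ContDiff ℝ ∞ fun q => L (z q) := L.contDiff.comp hz
    have hLd := hL.differentiable_of_infty
    have hLwave (p : ℝ × ℝ × ℝ) (hp : 0 ≤ p.2.1) : dalembertian (fun q => L (z q)) p = 0 := by
      simp [dalembertian_continuousLinearMap_comp hz, hwave p hp]
    have hLbc (t y : ℝ) : pd (0, 1, 0) (fun q => L (z q)) (t, 0, y) = 0 := by
      simp [pd_continuousLinearMap_comp hzd, hbc]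
    have hL₀ (x y : ℝ) (hx : 0 ≤ x) (h : x ^ 2 + y ^ 2 < R ^ 2) : L (z (0, x, y)) = 0 := by
      rw [h₀ x y hx h, map_zero]
    have hL₁ (x y : ℝ) (hx : 0 ≤ x) (h : x ^ 2 + y ^ 2 < R ^ 2) :
        pd (1, 0, 0) (fun q => L (z q)) (0, x, y) = 0 := by
      simp [pd_continuousLinearMap_comp hzd, h₁ x y hx h]
    rcases le_total 0 t with ht | ht
    · have := hp.1
      have h2 := hp.2
      simp only [abs_of_nonneg ht] at this h2
      exact eq_zero_of_cauchy_data_zero_real hL hLwave hLbc hL₀ hL₁ ht this hx h2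
    · have := hp.1
      have h2 := hp.2
      simp only [abs_of_nonpos ht] at this h2
      have h3 := eq_zero_of_cauchy_data_zero_real (z := fun q => L (z (reflT q)))
        (hL.comp reflT.contDiff)
        (fun p hp => by
          rw [dalembertian_comp_reflT hL]
          exact hLwave _ hp)
        (fun t y => by
          rw [pd_comp_continuousLinearMap hLd]
          simpa using hLbc (-t) y)
        (R := R) (fun x y hx h => by simpa using hL₀ x y hx h)
        (fun x y hx h => by
          rw [pd_comp_continuousLinearMap hLd]
          have : ((-1, 0, 0) : ℝ × ℝ × ℝ) = -(1, 0, 0) := by simp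
          simp only [reflT_apply, neg_zero]
          rw [this, pd_neg_direction]
          simp [hL₁ x y hx h])
        (t := -t) (by linarith) this hx h2
      simpa using h3
  exact Complex.ext (key Complex.reCLM) (key Complex.imCLM)

theorem iteratedFDeriv_eq_zero_of_cauchy_data_zero {z : ℝ × ℝ × ℝ → ℂ} (hz : ContDiff ℝ ∞ z)
    (hwave : ∀ p : ℝ × ℝ × ℝ, 0 ≤ p.2.1 → dalembertian z p = 0)
    (hbc : ∀ t y, pd (0, 1, 0) z (t, 0, y) = 0) {R : ℝ}
    (h₀ : ∀ x y, 0 ≤ x → x ^ 2 + y ^ 2 < R ^ 2 → z (0, x, y) = 0)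
    (h₁ : ∀ x y, 0 ≤ x → x ^ 2 + y ^ 2 < R ^ 2 → pd (1, 0, 0) z (0, x, y) = 0)
    {p : ℝ × ℝ × ℝ} (hp : p ∈ doubleCone R) (hx : 0 ≤ p.2.1) (k : ℕ) :
    iteratedFDeriv ℝ k z p = 0 := by
  have hU : IsOpen (doubleCone R ∩ {p : ℝ × ℝ × ℝ | 0 < p.2.1}) :=
    (isOpen_doubleCone R).inter (isOpen_lt (by fun_prop) (by fun_prop))
  have hcl : p ∈ closure (doubleCone R ∩ {p : ℝ × ℝ × ℝ | 0 < p.2.1}) :=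
    (isOpen_doubleCone R).inter_closure ⟨hp, by rwa [closure_setOf_pos_snd]⟩
  have hcont : Continuous (iteratedFDeriv ℝ k z) := hz.continuous_iteratedFDeriv (mod_cast le_top)
  refine closure_minimal (fun q hq => ?_)
    (isClosed_eq hcont (continuous_const (y := 0))) hcl
  have : z =ᶠ[𝓝 q] fun _ => 0 := by
    filter_upwards [hU.mem_nhds hq] with r hr
    exact eq_zero_of_cauchy_data_zero hz hwave hbc h₀ h₁ hr.1 hr.2
  change iteratedFDeriv ℝ k z q = 0
  rw [(this.iteratedFDeriv ℝ k).eq_of_nhds]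
  exact congrFun (iteratedFDeriv_fun_zero (𝕜 := ℝ) (n := k)) q

end HalfspaceUniqueness

section EvenSolution

theorem exists_schwartz_cutoff {h : ℂ → ℂ} (hh : ContDiff ℝ ∞ h)
    (heven : ∀ x y : ℝ, h ⟨-x, y⟩ = h ⟨x, y⟩) (R : ℝ) :
    ∃ f : 𝓢(ℂ, ℂ), (∀ x y : ℝ, x ^ 2 + y ^ 2 ≤ R ^ 2 → f ⟨x, y⟩ = h ⟨x, y⟩) ∧
      ∀ x y : ℝ, f ⟨-x, y⟩ = f ⟨x, y⟩ := by
  let f : ℂ → ℂ := fun ξ => Real.smoothTransition (R ^ 2 + 1 - (ξ.re ^ 2 + ξ.im ^ 2)) • h ξ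
  have hsmooth : ContDiff ℝ ∞ f := by
    have h1 : ContDiff ℝ ∞ fun ξ : ℂ => R ^ 2 + 1 - (ξ.re ^ 2 + ξ.im ^ 2) :=
      contDiff_const.sub ((Complex.reCLM.contDiff.pow 2).add (Complex.imCLM.contDiff.pow 2))
    exact (Real.smoothTransition.contDiff.comp h1).smul hh
  have hsupp : HasCompactSupport f := by
    refine HasCompactSupport.intro (isCompact_closedBall (0 : ℂ) (|R| + 1)) fun ξ hξ => ?_
    have h1 : |R| + 1 < ‖ξ‖ := by simpa using hξ
    have h2 : ‖ξ‖ ^ 2 = ξ.re ^ 2 + ξ.im ^ 2 := by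
      rw [← Complex.normSq_eq_norm_sq, Complex.normSq_apply]
      ring
    have h3 : R ^ 2 + 1 - (ξ.re ^ 2 + ξ.im ^ 2) ≤ 0 := by
      rw [← h2, ← sq_abs R]
      nlinarith [abs_nonneg R]
    simp [f, Real.smoothTransition.zero_of_nonpos h3]
  refine ⟨hsupp.toSchwartzMap hsmooth, fun x y hxy => ?_, fun x y => ?_⟩
  · change f ⟨x, y⟩ = h ⟨x, y⟩
    simp only [f]
    rw [Real.smoothTransition.one_of_one_le (by linarith), one_smul]
  · change f ⟨-x, y⟩ = f ⟨x, y⟩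
    simp only [f, heven, neg_sq]

theorem norm_reflX_le : ‖reflX‖ ≤ 1 := by
  refine reflX.opNorm_le_bound zero_le_one fun p => ?_
  obtain ⟨t, x, y⟩ := p
  simp [Prod.norm_def]

theorem norm_iteratedFDeriv_comp_reflX_le {F : Type*} [NormedAddCommGroup F] [NormedSpace ℝ F]
    {f : ℝ × ℝ × ℝ → F} (hf : ContDiff ℝ ∞ f) (k : ℕ) (p : ℝ × ℝ × ℝ) :
    ‖iteratedFDeriv ℝ k (fun q => f (reflX q)) p‖ ≤ ‖iteratedFDeriv ℝ k f (reflX p)‖ := by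
  have := reflX.iteratedFDeriv_comp_right hf p (i := k) (mod_cast le_top)
  rw [show (fun q => f (reflX q)) = f ∘ reflX from rfl, this]
  refine (ContinuousMultilinearMap.norm_compContinuousLinearMap_le _ _).trans
    (mul_le_of_le_one_right (norm_nonneg _) ?_)
  rw [Finset.prod_const]
  exact pow_le_one₀ (norm_nonneg _) norm_reflX_le

/-- The basis functions satisfying the dispersion relation. -/
def basisFunctions : Set (ℝ × ℝ × ℝ → ℂ) :=
  {φ | ∃ a b c : ℂ, a ^ 2 = b ^ 2 + c ^ 2 ∧ φ = waveNeumannBasis a b c}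

theorem character_add_comp_reflX (v : ℝ × ℂ) :
    (fun q => character phase v q + character phase v (reflX q)) =
      waveNeumannBasis (2 * Real.pi * v.1 * Complex.I) (2 * Real.pi * v.2.re * Complex.I)
        (2 * Real.pi * v.2.im * Complex.I) := by
  ext ⟨t, x, y⟩
  simp only [character, waveNeumannBasis, reflX_apply, phase_apply, Real.fourierChar_apply]
  congr 2 <;> push_cast <;> ring

theorem contDiff_of_mem_span {s : ℝ × ℝ × ℝ → ℂ}
    (hs : s ∈ Submodule.span ℂ (character phase '' lightCone)) : ContDiff ℝ ∞ s := by
  induction hs using Submodule.span_induction with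
  | mem s hs =>
    obtain ⟨v, -, rfl⟩ := hs
    exact contDiff_character phase v
  | zero => exact contDiff_const
  | add s t _ _ hs ht => exact hs.add ht
  | smul c s _ hs => exact contDiff_const.mul hs

theorem add_comp_reflX_mem_span {s : ℝ × ℝ × ℝ → ℂ}
    (hs : s ∈ Submodule.span ℂ (character phase '' lightCone)) :
    (fun q => s q + s (reflX q)) ∈ Submodule.span ℂ basisFunctions := by
  induction hs using Submodule.span_induction with
  | mem s hs =>
    obtain ⟨v, hv, rfl⟩ := hs
    refine Submodule.subset_span ⟨_, _, _, ?_, character_add_comp_reflX v⟩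
    have hv' : (v.1 : ℂ) ^ 2 = v.2.re ^ 2 + v.2.im ^ 2 := by exact_mod_cast hv
    linear_combination (2 * Real.pi * Complex.I) ^ 2 * hv'
  | zero =>
    convert Submodule.zero_mem (Submodule.span ℂ basisFunctions) using 1
    ext q
    simp
  | add s t _ _ hs ht =>
    convert Submodule.add_mem _ hs ht using 1
    ext q
    simp only [Pi.add_apply]
    ring
  | smul c s _ hs =>
    convert Submodule.smul_mem _ c hs using 1
    ext q
    simp only [Pi.smul_apply, smul_eq_mul]
    ring

/-- The Cauchy problem with even data has a solution satisfying the Neumann boundary condition which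
is approximable by basis functions. -/
theorem exists_neumann_solution (f g : 𝓢(ℂ, ℂ)) (hf : ∀ x y : ℝ, f ⟨-x, y⟩ = f ⟨x, y⟩)
    (hg : ∀ x y : ℝ, g ⟨-x, y⟩ = g ⟨x, y⟩) :
    ∃ w : ℝ × ℝ × ℝ → ℂ, ContDiff ℝ ∞ w ∧ (∀ p, dalembertian w p = 0) ∧
      (∀ t y, pd (0, 1, 0) w (t, 0, y) = 0) ∧
      (∀ x y, w (0, x, y) = f ⟨x, y⟩) ∧ (∀ x y, pd (1, 0, 0) w (0, x, y) = g ⟨x, y⟩) ∧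
      ∀ K : Set (ℝ × ℝ × ℝ), IsCompact K → ∀ (m : ℕ) (ε : ℝ), 0 < ε →
        ∃ s ∈ Submodule.span ℂ basisFunctions, ContDiff ℝ ∞ s ∧ ∀ k ≤ m, ∀ p ∈ K,
          ‖iteratedFDeriv ℝ k (fun q => w q - s q) p‖ ≤ ε := by
  obtain ⟨w, hw, hwave, h₀, h₁, happ⟩ :=
    exists_cauchy_solution ((2⁻¹ : ℂ) • f) ((2⁻¹ : ℂ) • g)
  have hwr : ContDiff ℝ ∞ fun q => w (reflX q) := hw.comp reflX.contDiff
  have hd := hw.differentiable_of_infty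
  have hzero (p : ℝ × ℝ × ℝ) : dalembertian w p = 0 := by
    rw [dalembertian, hwave]
    ring
  refine ⟨fun q => w q + w (reflX q), hw.add hwr, fun p => ?_, fun t y => ?_, fun x y => ?_,
    fun x y => ?_, fun K hK m ε hε => ?_⟩
  · rw [dalembertian_add hw hwr, dalembertian_comp_reflX hw]
    simp [hzero]
  · rw [pd_add hd hwr.differentiable_of_infty, pd_comp_continuousLinearMap hd]
    have : ((0, -1, 0) : ℝ × ℝ × ℝ) = -(0, 1, 0) := by simp
    simp only [reflX_apply, neg_zero]
    rw [this, pd_neg_direction]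
    simp
  · simp only [reflX_apply, h₀, smul_apply, smul_eq_mul, hf]
    ring
  · rw [pd_add hd hwr.differentiable_of_infty, pd_comp_continuousLinearMap hd]
    simp only [reflX_apply, neg_zero, h₁, smul_apply, smul_eq_mul, hg]
    ring
  · obtain ⟨s, hs, hsw⟩ := happ (K ∪ reflX '' K) (hK.union (hK.image reflX.continuous)) m (ε / 2)
      (half_pos hε)
    have hss := contDiff_of_mem_span hs
    refine ⟨_, add_comp_reflX_mem_span hs, hss.add (hss.comp reflX.contDiff), fun k hk p hp => ?_⟩
    have hws : ContDiff ℝ ∞ fun q => w q - s q := hw.sub hss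
    have hws' : ContDiff ℝ ∞ fun q => w (reflX q) - s (reflX q) := hws.comp reflX.contDiff
    have hsplit : (fun q => w q + w (reflX q) - (s q + s (reflX q))) =
        fun q => (w q - s q) + (w (reflX q) - s (reflX q)) := by
      ext q
      ring
    rw [hsplit, fun_iteratedFDeriv_add_apply (hws.of_le (mod_cast le_top)).contDiffAt
      (hws'.of_le (mod_cast le_top)).contDiffAt]
    calc _ ≤ ε / 2 + ε / 2 := norm_add_le_of_le (hsw k hk p (Or.inl hp))
          ((norm_iteratedFDeriv_comp_reflX_le hws k p).trans
            (hsw k hk _ (Or.inr ⟨p, hp, rfl⟩)))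
      _ = ε := add_halves ε

theorem exists_mem_span_approx {u : ℝ × ℝ × ℝ → ℂ} (hu : ContDiff ℝ ∞ u)
    (hwave : ∀ p : ℝ × ℝ × ℝ, 0 ≤ p.2.1 → dalembertian u p = 0)
    (hbc : ∀ t y, pd (0, 1, 0) u (t, 0, y) = 0) {K : Set (ℝ × ℝ × ℝ)} (hK : IsCompact K)
    (hKx : ∀ p ∈ K, 0 ≤ p.2.1) (m : ℕ) {ε : ℝ} (hε : 0 < ε) :
    ∃ s ∈ Submodule.span ℂ basisFunctions, ∀ k ≤ m, ∀ p ∈ K,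
      ‖iteratedFDeriv ℝ k (fun q => u q - s q) p‖ ≤ ε := by
  obtain ⟨R, hR⟩ : ∃ R, K ⊆ doubleCone R := by
    obtain ⟨C, hC0, hC⟩ := hK.isBounded.exists_pos_norm_le
    refine ⟨4 * C, fun p hp => ?_⟩
    have h1 := hC p hp
    simp only [Prod.norm_def, sup_le_iff, Real.norm_eq_abs] at h1
    obtain ⟨ht, hx, hy⟩ := h1
    refine ⟨by linarith, ?_⟩
    have hx2 := sq_le_sq' (abs_le.1 hx).1 (abs_le.1 hx).2
    have hy2 := sq_le_sq' (abs_le.1 hy).1 (abs_le.1 hy).2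
    have : (3 * C) ^ 2 ≤ (4 * C - |p.1|) ^ 2 :=
      pow_le_pow_left₀ (by positivity) (by linarith) 2
    nlinarith
  obtain ⟨v, hv, hvu, hve⟩ := exists_even_extension hu hwave hbc
  have hpos : ContDiff ℝ ∞ fun ξ : ℂ => ((0, ξ.re, ξ.im) : ℝ × ℝ × ℝ) :=
    contDiff_const.prodMk (Complex.reCLM.contDiff.prodMk Complex.imCLM.contDiff)
  have hvt : ∀ x y, pd (1, 0, 0) v (0, -x, y) = pd (1, 0, 0) v (0, x, y) := by
    intro x y
    have h1 := congrFun (pd_comp_continuousLinearMap hv.differentiable_of_infty reflX (1, 0, 0))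
      (0, x, y)
    simp only [hve, reflX_apply, neg_zero] at h1
    exact h1.symm
  obtain ⟨f, hfv, hfe⟩ := exists_schwartz_cutoff (hv.comp hpos) (fun x y => hve (0, x, y)) R
  obtain ⟨g, hgv, hge⟩ := exists_schwartz_cutoff ((contDiff_pd hv (1, 0, 0)).comp hpos) hvt R
  obtain ⟨w, hw, hwwave, hwbc, hw₀, hw₁, happ⟩ := exists_neumann_solution f g hfe hge
  obtain ⟨s, hs, hss, hsw⟩ := happ K hK m ε hε
  refine ⟨s, hs, fun k hk p hp => ?_⟩
  have hz : ContDiff ℝ ∞ fun q => u q - w q := hu.sub hw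
  have hd := hu.differentiable_of_infty
  have hwd := hw.differentiable_of_infty
  have h0 : iteratedFDeriv ℝ k (fun q => u q - w q) p = 0 := by
    refine iteratedFDeriv_eq_zero_of_cauchy_data_zero hz (fun q hq => ?_) (fun t y => ?_)
      (fun x y hx hxy => ?_) (fun x y hx hxy => ?_) (hR hp) (hKx p hp) k
    · simp [dalembertian_sub hu hw, hwave q hq, hwwave q]
    · simp [pd_sub hd hwd, hbc, hwbc]
    · simp [hw₀, hfv x y hxy.le, hvu (0, x, y) hx]
    · have : pd (1, 0, 0) u (0, x, y) = pd (1, 0, 0) v (0, x, y) :=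
        (hasDerivAt_fst hd 0 x y).unique
          (by simpa only [hvu (_, x, y) hx] using hasDerivAt_fst hv.differentiable_of_infty 0 x y)
      simp [pd_sub hd hwd, hw₁, hgv x y hxy.le, this]
  have hsplit : (fun q => u q - s q) = fun q => (u q - w q) + (w q - s q) := by
    ext q
    ring
  rw [hsplit, fun_iteratedFDeriv_add_apply (hz.of_le (mod_cast le_top)).contDiffAt
    ((hw.sub hss).of_le (mod_cast le_top)).contDiffAt, h0, zero_add]
  exact hsw k hk p hp

end EvenSolution

theorem d1_eq_pd {u : ℝ × ℝ × ℝ → ℂ} (hu : Differentiable ℝ u) : d1 u = pd (1, 0, 0) u := by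
  ext ⟨t, x, y⟩
  exact (hasDerivAt_fst hu t x y).deriv

theorem d2_eq_pd {u : ℝ × ℝ × ℝ → ℂ} (hu : Differentiable ℝ u) : d2 u = pd (0, 1, 0) u := by
  ext ⟨t, x, y⟩
  exact (hasDerivAt_snd hu t x y).deriv

theorem d3_eq_pd {u : ℝ × ℝ × ℝ → ℂ} (hu : Differentiable ℝ u) : d3 u = pd (0, 0, 1) u := by
  ext ⟨t, x, y⟩
  exact (hasDerivAt_trd hu t x y).deriv

end WaveNeumann

/-- The B-EPGP basis has dense span in the smooth solutions of the 2D wave equation on the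
halfspace `{x ≥ 0}` with Neumann boundary condition at `x = 0`. -/
theorem bepgp_wave2D_neumann_dense
    (u : ℝ × ℝ × ℝ → ℂ) (hu : ContDiff ℝ (⊤ : ℕ∞) u)
    (hwave : ∀ t x y : ℝ, 0 ≤ x →
      d1 (d1 u) (t, x, y) = d2 (d2 u) (t, x, y) + d3 (d3 u) (t, x, y))
    (hbc : ∀ t y : ℝ, d2 u (t, 0, y) = 0)
    (K : Set (ℝ × ℝ × ℝ)) (hKc : IsCompact K)
    (hK : K ⊆ Set.univ ×ˢ Set.Ici (0 : ℝ) ×ˢ Set.univ)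
    (m : ℕ) (ε : ℝ) (hε : 0 < ε) :
    ∃ (r : ℕ) (a b c : Fin r → ℂ) (c' : Fin r → ℂ),
      (∀ j, a j ^ 2 = b j ^ 2 + c j ^ 2) ∧
      ∀ k ≤ m, ∀ p ∈ K,
        ‖iteratedFDeriv ℝ k
            (fun q => u q - ∑ j, c' j * waveNeumannBasis (a j) (b j) (c j) q) p‖ ≤ ε := by
  have hd := hu.differentiable_of_infty
  have hdd (v : ℝ × ℝ × ℝ) := (WaveNeumann.contDiff_pd hu v).differentiable_of_infty
  simp only [WaveNeumann.d1_eq_pd hd, WaveNeumann.d2_eq_pd hd, WaveNeumann.d3_eq_pd hd,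
    WaveNeumann.d1_eq_pd (hdd _), WaveNeumann.d2_eq_pd (hdd _),
    WaveNeumann.d3_eq_pd (hdd _)] at hwave hbc
  obtain ⟨s, hs, happ⟩ := WaveNeumann.exists_mem_span_approx hu
    (fun p hp => by
      rw [WaveNeumann.dalembertian, hwave p.1 p.2.1 p.2.2 hp]
      ring)
    hbc hKc (fun p hp => (hK hp).2.1) m hε
  obtain ⟨r, c', φ, rfl⟩ := Submodule.mem_span_set'.1 hs
  choose a b c habc hφ using fun j => (φ j).2
  refine ⟨r, a, b, c, c', habc, fun k hk p hp => ?_⟩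
  simpa [hφ] using happ k hk p hp
end

section
/- Let u : ℝ³ → ℂ (with coordinates (t,x,y)) be C^∞ on ℝ³ and satisfy the two-dimensional heat equation ∂u/∂t = ∂²u/∂x² + ∂²u/∂y² at every point (t,x,y) with y ≥ 0, together with the Dirichlet boundary condition u(t,x,0) = 0 for all t,x ∈ ℝ. For a,b ∈ ℂ define g_{a,b} : ℝ³ → ℂ by g_{a,b}(t,x,y) = exp((a²+b²) t + a x + b y) − exp((a²+b²) t + a x − b y). Then for every compact set K ⊆ ℝ × ℝ × [0,∞), every m ∈ ℕ, and every ε > 0, there exist r ∈ ℕ, pairs (a_j,b_j) ∈ ℂ², and coefficients c_1, …, c_r ∈ ℂ such that for every k ≤ m, the k-th iterated derivative of u − Σ_{j=1}^r c_j g_{a_j,b_j} has norm at most ε at every point of K. -/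
/-- B-EPGP basis element for the 2D heat equation with Dirichlet boundary condition on
the plane `{y = 0}`. -/
noncomputable def heat2DDirichletBasis (a b : ℂ) : ℝ × ℝ × ℝ → ℂ :=
  fun p => Complex.exp ((a ^ 2 + b ^ 2) * (p.1 : ℂ) + a * (p.2.1 : ℂ) + b * (p.2.2 : ℂ)) -
    Complex.exp ((a ^ 2 + b ^ 2) * (p.1 : ℂ) + a * (p.2.1 : ℂ) - b * (p.2.2 : ℂ))

open scoped ContDiff

/-- Partial derivative of a function on `ℝ^d` in the direction of the `i`-th coordinate. -/
noncomputable def pd {d : Type*} [Fintype d] [DecidableEq d] (i : d) (f : (d → ℝ) → ℂ) :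
    (d → ℝ) → ℂ :=
  fun z => fderiv ℝ f z (Pi.single i 1)

section Partial

variable {d : Type*} [Fintype d] [DecidableEq d]

theorem ContDiff.pd {f : (d → ℝ) → ℂ} (hf : ContDiff ℝ ∞ f) (i : d) : ContDiff ℝ ∞ (pd i f) :=
  (hf.fderiv_right (m := ∞) (by norm_num)).clm_apply contDiff_const

theorem pd_add {f g : (d → ℝ) → ℂ} (hf : ContDiff ℝ ∞ f) (hg : ContDiff ℝ ∞ g) (i : d) :
    pd i (fun z => f z + g z) = fun z => pd i f z + pd i g z := by
  funext z
  simp only [pd]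
  rw [fderiv_fun_add (hf.differentiable (by simp) z) (hg.differentiable (by simp) z)]
  rfl

theorem pd_mul {f g : (d → ℝ) → ℂ} (hf : ContDiff ℝ ∞ f) (hg : ContDiff ℝ ∞ g) (i : d) :
    pd i (fun z => f z * g z) = fun z => f z * pd i g z + pd i f z * g z := by
  funext z
  simp only [pd]
  rw [fderiv_fun_mul (hf.differentiable (by simp) z) (hg.differentiable (by simp) z)]
  simp [mul_comm]

/-- The exponential `z ↦ exp (∑ wⱼ zⱼ)`. -/
noncomputable def expo (w : d → ℂ) (z : d → ℝ) : ℂ := Complex.exp (∑ j, w j * (z j : ℂ))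

/-- The linear form `z ↦ ∑ wⱼ zⱼ`. -/
noncomputable def linForm (w : d → ℂ) : (d → ℝ) →L[ℝ] ℂ :=
  ∑ j, w j • (Complex.ofRealCLM.comp (ContinuousLinearMap.proj j))

omit [DecidableEq d] in
theorem linForm_apply (w : d → ℂ) (z : d → ℝ) : linForm w z = ∑ j, w j * (z j : ℂ) := by
  simp [linForm]

theorem linForm_single (w : d → ℂ) (i : d) : linForm w (Pi.single i 1) = w i := by
  rw [linForm_apply, Finset.sum_eq_single i (fun j _ h => by simp [h]) (by simp)]
  simp

omit [DecidableEq d] in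
theorem norm_linForm_le (w : d → ℂ) : ‖linForm w‖ ≤ ∑ j, ‖w j‖ := by
  refine ContinuousLinearMap.opNorm_le_bound _ (by positivity) fun z => ?_
  rw [linForm_apply, Finset.sum_mul]
  refine (norm_sum_le _ _).trans (Finset.sum_le_sum fun j _ => ?_)
  rw [norm_mul, Complex.norm_real]
  gcongr
  exact norm_le_pi_norm z j

omit [DecidableEq d] in
theorem hasFDerivAt_expo (w : d → ℂ) (z : d → ℝ) :
    HasFDerivAt (expo w) (expo w z • linForm w) z := by
  have h := (linForm w).hasFDerivAt (x := z) |>.cexp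
  simp only [linForm_apply] at h
  exact h

omit [DecidableEq d] in
theorem contDiff_expo (w : d → ℂ) : ContDiff ℝ ∞ (expo w) := by
  have : ContDiff ℝ ∞ (fun z => Complex.exp (linForm w z)) := (linForm w).contDiff.cexp
  simp only [linForm_apply] at this
  exact this

theorem pd_expo (w : d → ℂ) (i : d) : pd i (expo w) = fun z => w i * expo w z := by
  funext z
  simp only [pd, (hasFDerivAt_expo w z).fderiv]
  simp [linForm_single, mul_comm]

omit [DecidableEq d] in
theorem norm_iteratedFDeriv_expo_le (w : d → ℂ) (k : ℕ) (z : d → ℝ) :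
    ‖iteratedFDeriv ℝ k (expo w) z‖ ≤ (∑ j, ‖w j‖) ^ k * ‖expo w z‖ := by
  induction k with
  | zero => simp
  | succ k ih =>
    rw [← norm_iteratedFDeriv_fderiv]
    have h : fderiv ℝ (expo w) =
        ((ContinuousLinearMap.toSpanSingleton ℂ (linForm w)).restrictScalars ℝ) ∘ expo w := by
      funext z
      simp [(hasFDerivAt_expo w z).fderiv]
    rw [h]
    refine ((ContinuousLinearMap.norm_iteratedFDeriv_comp_left _
      (N := ∞) (contDiff_expo w).contDiffAt (n := k) (mod_cast le_top))).trans ?_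
    rw [ContinuousLinearMap.norm_restrictScalars, ContinuousLinearMap.norm_toSpanSingleton,
      pow_succ', mul_assoc]
    exact mul_le_mul (norm_linForm_le w) ih (norm_nonneg _) (by positivity)

/-- The frequency vector `2πi n`. -/
noncomputable def freq (n : d → ℤ) : d → ℂ := fun j => 2 * Real.pi * Complex.I * n j

omit [DecidableEq d] in
theorem norm_expo_freq (n : d → ℤ) (z : d → ℝ) : ‖expo (freq n) z‖ = 1 := by
  have : ∑ j, freq n j * (z j : ℂ) = ((∑ j, 2 * Real.pi * n j * z j : ℝ) : ℂ) * Complex.I := by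
    push_cast
    rw [Finset.sum_mul]
    exact Finset.sum_congr rfl fun j _ => by simp only [freq]; ring
  rw [expo, this, Complex.norm_exp_ofReal_mul_I]

omit [DecidableEq d] in
theorem sum_norm_freq_le (n : d → ℤ) :
    ∑ j, ‖freq n j‖ ≤ (2 * Real.pi * Fintype.card d) * (1 + ‖n‖) := by
  have : ∀ j, ‖freq n j‖ ≤ 2 * Real.pi * (1 + ‖n‖) := fun j => by
    have h1 : ‖n j‖ ≤ ‖n‖ := norm_le_pi_norm n j
    have h2 : ‖freq n j‖ = 2 * Real.pi * ‖n j‖ := by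
      simp [freq, abs_of_pos Real.pi_pos]
      rfl
    rw [h2]
    have := Real.pi_pos
    gcongr
    linarith
  refine (Finset.sum_le_sum fun j _ => this j).trans (le_of_eq ?_)
  simp
  ring

/-- A family of coefficients on `ℤ^d` decaying faster than any polynomial. -/
def RapidDecay (c : (d → ℤ) → ℂ) : Prop :=
  ∀ M : ℕ, Summable fun n => ‖c n‖ * (1 + ‖n‖) ^ M

/-- The Fourier series with coefficients `c`. -/
noncomputable def fourierSum (c : (d → ℤ) → ℂ) (z : d → ℝ) : ℂ :=
  ∑' n, c n * expo (freq n) z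

omit [DecidableEq d] in
theorem RapidDecay.summable {c : (d → ℤ) → ℂ} (hc : RapidDecay c) : Summable fun n => ‖c n‖ := by
  simpa using hc 0

omit [DecidableEq d] in
theorem RapidDecay.add {b c : (d → ℤ) → ℂ} (hb : RapidDecay b) (hc : RapidDecay c) :
    RapidDecay (fun n => b n + c n) := fun M => by
  refine Summable.of_nonneg_of_le (fun n => by positivity) (fun n => ?_) ((hb M).add (hc M))
  rw [← add_mul]
  gcongr
  exact norm_add_le _ _

omit [DecidableEq d] in
theorem RapidDecay.mul_of_le {c : (d → ℤ) → ℂ} (hc : RapidDecay c) {q : (d → ℤ) → ℂ} {C : ℝ}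
    {N : ℕ} (hq : ∀ n, ‖q n‖ ≤ C * (1 + ‖n‖) ^ N) : RapidDecay (fun n => q n * c n) := fun M => by
  refine Summable.of_nonneg_of_le (fun n => by positivity) (fun n => ?_)
    ((hc (N + M)).mul_left C)
  rw [norm_mul, pow_add]
  calc ‖q n‖ * ‖c n‖ * (1 + ‖n‖) ^ M
      ≤ (C * (1 + ‖n‖) ^ N) * ‖c n‖ * (1 + ‖n‖) ^ M := by gcongr; exact hq n
    _ = _ := by ring

omit [DecidableEq d] in
theorem norm_freq_le (n : d → ℤ) (i : d) :
    ‖freq n i‖ ≤ (2 * Real.pi * Fintype.card d) * (1 + ‖n‖) ^ 1 := by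
  rw [pow_one]
  exact (Finset.single_le_sum (f := fun j => ‖freq n j‖) (fun j _ => norm_nonneg _)
    (Finset.mem_univ i)).trans (sum_norm_freq_le n)

omit [DecidableEq d] in
theorem RapidDecay.freq_mul {c : (d → ℤ) → ℂ} (hc : RapidDecay c) (i : d) :
    RapidDecay (fun n => freq n i * c n) :=
  hc.mul_of_le (norm_freq_le · i)

omit [DecidableEq d] in
theorem norm_iteratedFDeriv_term_le (c : ℂ) (n : d → ℤ) (k : ℕ) (z : d → ℝ) :
    ‖iteratedFDeriv ℝ k (fun z => c * expo (freq n) z) z‖ ≤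
      (2 * Real.pi * Fintype.card d) ^ k * (‖c‖ * (1 + ‖n‖) ^ k) := by
  have h := iteratedFDeriv_const_smul_apply (𝕜 := ℝ) (i := k) (a := c) (x := z)
    ((contDiff_expo (freq n)).contDiffAt.of_le (mod_cast le_top))
  have h' : (fun z => c * expo (freq n) z) = c • expo (freq n) := rfl
  rw [h', h, norm_smul]
  have := norm_iteratedFDeriv_expo_le (freq n) k z
  rw [norm_expo_freq, mul_one] at this
  calc ‖c‖ * _ ≤ ‖c‖ * ((2 * Real.pi * Fintype.card d) * (1 + ‖n‖)) ^ k := by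
        gcongr
        exact this.trans (by gcongr; exact sum_norm_freq_le n)
    _ = _ := by rw [mul_pow]; ring

omit [DecidableEq d] in
theorem RapidDecay.contDiff_fourierSum {c : (d → ℤ) → ℂ} (hc : RapidDecay c) :
    ContDiff ℝ ∞ (fourierSum c) :=
  contDiff_tsum (N := ⊤) (fun _ => contDiff_const.mul (contDiff_expo _))
    (fun k _ => (hc k).mul_left _) (fun k n _ _ => norm_iteratedFDeriv_term_le (c n) n k _)

omit [DecidableEq d] in
theorem RapidDecay.summable_term {c : (d → ℤ) → ℂ} (hc : RapidDecay c) (z : d → ℝ) :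
    Summable fun n => c n * expo (freq n) z := by
  refine Summable.of_norm ?_
  simpa [norm_expo_freq] using hc.summable

theorem RapidDecay.pd_fourierSum {c : (d → ℤ) → ℂ} (hc : RapidDecay c) (i : d) :
    pd i (fourierSum c) = fourierSum (fun n => freq n i * c n) := by
  funext z
  have hs : ∀ n z, HasFDerivAt (fun z => c n * expo (freq n) z)
      (c n • (expo (freq n) z • linForm (freq n))) z := fun n z =>
    (hasFDerivAt_expo _ z).const_mul (c n)
  have hb : ∀ n z, ‖c n • (expo (freq n) z • linForm (freq n))‖ ≤
      (2 * Real.pi * Fintype.card d) * (‖c n‖ * (1 + ‖n‖) ^ 1) := fun n z => by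
    rw [norm_smul, norm_smul, norm_expo_freq, one_mul, pow_one, mul_left_comm]
    gcongr
    exact (norm_linForm_le _).trans (sum_norm_freq_le n)
  have hsum := (hc 1).mul_left (2 * Real.pi * Fintype.card d)
  have h := hasFDerivAt_tsum hsum hs hb (x₀ := 0) (hc.summable_term 0) z
  have h' : fderiv ℝ (fourierSum c) z = ∑' n, c n • (expo (freq n) z • linForm (freq n)) := h.fderiv
  have hsm : Summable fun n => c n • (expo (freq n) z • linForm (freq n)) :=
    Summable.of_norm_bounded hsum fun n => hb n z
  simp only [pd, h', fourierSum]
  rw [← ContinuousLinearMap.apply_apply (Pi.single i 1) (∑' n, _),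
    ContinuousLinearMap.map_tsum _ hsm]
  refine tsum_congr fun n => ?_
  simp [linForm_single]
  ring

end Partial

section Lattice

variable {d : Type*} [Fintype d]

theorem exists_summable_one_add_norm_pow (d : Type*) [Fintype d] :
    ∃ N : ℕ, Summable fun n : d → ℤ => ((1 + ‖n‖) ^ N)⁻¹ := by
  classical
  let L := Submodule.span ℤ (Set.range (Pi.basisFun ℝ d))
  let φ : (d → ℤ) → L := fun n => ⟨fun j => (n j : ℝ), by
    rw [Module.Basis.mem_span_iff_repr_mem]
    intro j
    exact ⟨n j, by simp⟩⟩
  have hφ : Function.Injective φ := fun a b h => by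
    funext j
    have := congrFun (congrArg Subtype.val h) j
    simpa [φ] using this
  have hn : ∀ n, ‖φ n‖ = ‖n‖ := fun n => by
    simp only [φ, Submodule.coe_norm, Pi.norm_def]
    congr 2
  refine ⟨Module.finrank ℤ L + 1, ?_⟩
  have h := (ZLattice.summable_norm_rpow L (-((Module.finrank ℤ L + 1 : ℕ) : ℝ))
    (by push_cast; linarith)).comp_injective hφ
  refine Summable.of_norm_bounded_eventually h ?_
  filter_upwards [(Set.finite_singleton (0 : d → ℤ)).compl_mem_cofinite] with n hn0
  have hpos : 0 < ‖n‖ := norm_pos_iff.2 (by simpa using hn0)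
  rw [Real.norm_of_nonneg (by positivity), Function.comp_apply, hn, Real.rpow_neg (norm_nonneg _),
    Real.rpow_natCast]
  gcongr
  linarith

theorem rapidDecay_of_bounded {c : (d → ℤ) → ℂ}
    (h : ∀ M : ℕ, ∃ C, ∀ n, ‖c n‖ * (1 + ‖n‖) ^ M ≤ C) : RapidDecay c := fun M => by
  obtain ⟨N, hN⟩ := exists_summable_one_add_norm_pow d
  obtain ⟨C, hC⟩ := h (M + N)
  refine Summable.of_nonneg_of_le (fun n => by positivity) (fun n => ?_) (hN.mul_left C)
  have := hC n
  rw [pow_add, ← mul_assoc] at this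
  rw [← div_eq_mul_inv, le_div_iff₀ (by positivity)]
  exact this

theorem expo_freq_eq_mFourier (n : d → ℤ) (z : d → ℝ) :
    expo (freq n) z = UnitAddTorus.mFourier n (fun j => (z j : UnitAddCircle)) := by
  simp only [expo, UnitAddTorus.mFourier, ContinuousMap.coe_mk, Complex.exp_sum]
  refine Finset.prod_congr rfl fun j _ => ?_
  rw [fourier_coe_apply]
  simp [freq]

/-- Periodicity with respect to the lattice `ℤ^d`. -/
def LatticePeriodic (f : (d → ℝ) → ℂ) : Prop :=
  ∀ (n : d → ℤ) (z : d → ℝ), f (z + fun j => (n j : ℝ)) = f z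

theorem latticePeriodic_expo_freq (m : d → ℤ) : LatticePeriodic (expo (freq m)) := fun n z => by
  rw [expo_freq_eq_mFourier, expo_freq_eq_mFourier]
  congr 1
  funext j
  simp only [Pi.add_apply]
  have h : ((n j : ℝ) : UnitAddCircle) = 0 :=
    (AddCircle.coe_eq_zero_iff (1 : ℝ)).2 ⟨n j, by simp⟩
  rw [AddCircle.coe_add, h, add_zero]

omit [Fintype d] in
theorem LatticePeriodic.mul {f g : (d → ℝ) → ℂ} (hf : LatticePeriodic f)
    (hg : LatticePeriodic g) : LatticePeriodic fun z => f z * g z := fun n z => by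
  simp only [hf n z, hg n z]

theorem LatticePeriodic.pd [DecidableEq d] {f : (d → ℝ) → ℂ} (hf : LatticePeriodic f) (i : d) :
    LatticePeriodic (pd i f) := fun n z => by
  have h : (fun z => f (z + fun j => (n j : ℝ))) = f := funext fun z => hf n z
  simp only [_root_.pd]
  rw [← fderiv_comp_add_right, h]

/-- A summable trigonometric series vanishing identically has zero coefficients. -/
theorem eq_zero_of_tsum_expo_eq_zero {c : (d → ℤ) → ℂ} (hc : Summable fun n => ‖c n‖)
    (h : ∀ z, ∑' n, c n * expo (freq n) z = 0) : c = 0 := by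
  have hs : Summable fun n => c n • UnitAddTorus.mFourier n := by
    refine Summable.of_norm ?_
    simpa [norm_smul, UnitAddTorus.mFourier_norm] using hc
  have h0 : HasSum (fun n => c n • UnitAddTorus.mFourier n) 0 := by
    have : ∑' n, c n • UnitAddTorus.mFourier n = 0 := by
      ext x
      obtain ⟨z, rfl⟩ : ∃ z : d → ℝ, (fun j => (z j : UnitAddCircle)) = x := by
        choose z hz using fun j => QuotientAddGroup.mk_surjective (x j)
        exact ⟨z, funext hz⟩
      rw [← ContinuousMap.tsum_apply hs]
      simpa [expo_freq_eq_mFourier] using h z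
    rw [← this]
    exact hs.hasSum
  funext m
  let _ : MeasureTheory.MeasureSpace UnitAddCircle := ⟨AddCircle.haarAddCircle⟩
  have : MeasureTheory.IsProbabilityMeasure
      (MeasureTheory.volume : MeasureTheory.Measure UnitAddCircle) :=
    inferInstanceAs (MeasureTheory.IsProbabilityMeasure AddCircle.haarAddCircle)
  have h1 := (h0.mapL (ContinuousMap.toLp (E := ℂ) 2
    (MeasureTheory.volume : MeasureTheory.Measure (UnitAddTorus d)) ℂ)).mapL
    (innerSL ℂ (UnitAddTorus.mFourierLp 2 m))
  simp only [map_smul, map_zero] at h1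
  have h2 : ∀ n, c n • innerSL ℂ (UnitAddTorus.mFourierLp 2 m) (UnitAddTorus.mFourierLp 2 n) =
      if n = m then c m else 0 := fun n => by
    rw [innerSL_apply_apply, orthonormal_iff_ite.1 UnitAddTorus.orthonormal_mFourier]
    by_cases h : n = m
    · simp [h]
    · simp [h, Ne.symm h]
  have h3 := (hasSum_ite_eq m (c m)).unique ((funext h2) ▸ h1)
  exact h3

end Lattice

section Box

variable {N : ℕ}

theorem integral_pd_eq_zero {f : (Fin (N + 1) → ℝ) → ℂ} (hf : ContDiff ℝ ∞ f)
    (hp : LatticePeriodic f) (i : Fin (N + 1)) :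
    ∫ z in Set.Icc (0 : Fin (N + 1) → ℝ) 1, pd i f z = 0 := by
  have h := MeasureTheory.integral_divergence_of_hasFDerivAt_off_countable'
    (0 : Fin (N + 1) → ℝ) 1 zero_le_one (fun j => if j = i then f else 0)
    (fun j => if j = i then fderiv ℝ f else 0) ∅ Set.countable_empty
    (fun j => by
      by_cases hj : j = i
      · simp [hj, hf.continuous.continuousOn]
      · simp [hj, continuousOn_const, Pi.zero_def])
    (fun z _ j => by
      by_cases hj : j = i
      · simp [hj, (hf.differentiable (by simp) z).hasFDerivAt]
      · simp only [hj, if_false]; exact hasFDerivAt_const (0 : ℂ) z)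
    (by
      have : ∀ z, ∑ j, (if j = i then fderiv ℝ f else 0) z (Pi.single j 1) = pd i f z := fun z => by
        rw [Finset.sum_eq_single i (fun j _ hj => by simp [hj]) (by simp)]
        simp [pd]
      simp only [this]
      exact (hf.pd i).continuous.continuousOn.integrableOn_Icc)
  rw [Finset.sum_eq_zero] at h
  · rw [← h]
    congr 1
    funext z
    rw [Finset.sum_eq_single i (fun j _ hj => by simp [hj]) (by simp)]
    simp [pd]
  · intro j _
    by_cases hj : j = i
    · subst hj
      have : ∀ x : Fin N → ℝ, f (j.insertNth (1 : ℝ) x) = f (j.insertNth (0 : ℝ) x) := fun x => by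
        rw [← hp (Pi.single j 1) (j.insertNth (0 : ℝ) x)]
        congr 1
        funext k
        refine Fin.succAboveCases j ?_ (fun l => ?_) k <;> simp
      simp [this]
    · simp [hj]

/-- The Fourier coefficients over the unit box. -/
noncomputable def boxCoeff (f : (Fin (N + 1) → ℝ) → ℂ) (n : Fin (N + 1) → ℤ) : ℂ :=
  ∫ z in Set.Icc (0 : Fin (N + 1) → ℝ) 1, expo (freq (-n)) z * f z

theorem boxCoeff_pd {f : (Fin (N + 1) → ℝ) → ℂ} (hf : ContDiff ℝ ∞ f)
    (hp : LatticePeriodic f) (i : Fin (N + 1)) (n : Fin (N + 1) → ℤ) :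
    boxCoeff (pd i f) n = freq n i * boxCoeff f n := by
  have h := integral_pd_eq_zero ((contDiff_expo (freq (-n))).mul hf)
    ((latticePeriodic_expo_freq _).mul hp) i
  rw [pd_mul (contDiff_expo _) hf, MeasureTheory.integral_add] at h
  · have h3 : freq (-n) i = - freq n i := by simp [freq]
    simp only [pd_expo, mul_assoc, MeasureTheory.integral_const_mul, h3] at h
    simp only [boxCoeff]
    linear_combination h
  · exact ((contDiff_expo _).continuous.mul (hf.pd i).continuous).continuousOn.integrableOn_Icc
  · exact (((contDiff_expo _).pd i).continuous.mul hf.continuous).continuousOn.integrableOn_Icc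

theorem exists_norm_boxCoeff_le {f : (Fin (N + 1) → ℝ) → ℂ} (hf : Continuous f) :
    ∃ C, ∀ n, ‖boxCoeff f n‖ ≤ C := by
  obtain ⟨C, hC⟩ :=
    (isCompact_Icc (a := (0 : Fin (N + 1) → ℝ)) (b := 1)).exists_bound_of_continuousOn
    hf.continuousOn
  refine ⟨C, fun n => ?_⟩
  refine (MeasureTheory.norm_setIntegral_le_of_norm_le_const (C := C) ?_ fun z hz => ?_).trans ?_
  · simp [Real.volume_Icc_pi]
  · rw [norm_mul, norm_expo_freq, one_mul]
    exact hC z hz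
  · simp [MeasureTheory.measureReal_def, Real.volume_Icc_pi]

theorem rapidDecay_boxCoeff {f : (Fin (N + 1) → ℝ) → ℂ} (hf : ContDiff ℝ ∞ f)
    (hp : LatticePeriodic f) : RapidDecay (boxCoeff f) := by
  refine rapidDecay_of_bounded fun M => ?_
  induction M generalizing f with
  | zero => simpa using exists_norm_boxCoeff_le hf.continuous
  | succ M ih =>
    obtain ⟨C, hC⟩ := ih hf hp
    choose D hD using fun i => ih (hf.pd i) (hp.pd i)
    refine ⟨C + ∑ i, D i, fun n => ?_⟩
    have h1 : ‖n‖ ≤ ∑ i, ‖freq n i‖ := by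
      rw [pi_norm_le_iff_of_nonneg (by positivity)]
      intro i
      refine le_trans ?_ (Finset.single_le_sum (f := fun i => ‖freq n i‖)
        (fun _ _ => norm_nonneg _) (Finset.mem_univ i))
      have : ‖freq n i‖ = 2 * Real.pi * ‖n i‖ := by
        simp [freq, abs_of_pos Real.pi_pos]
        rfl
      rw [this]
      nlinarith [Real.pi_gt_three, norm_nonneg (n i)]
    have h2 : ∀ i, ‖freq n i‖ * (‖boxCoeff f n‖ * (1 + ‖n‖) ^ M) ≤ D i := fun i => by
      have := hD i n
      rwa [boxCoeff_pd hf hp, norm_mul, mul_assoc] at this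
    calc ‖boxCoeff f n‖ * (1 + ‖n‖) ^ (M + 1)
        = ‖boxCoeff f n‖ * (1 + ‖n‖) ^ M + ‖n‖ * (‖boxCoeff f n‖ * (1 + ‖n‖) ^ M) := by ring
      _ ≤ C + (∑ i, ‖freq n i‖) * (‖boxCoeff f n‖ * (1 + ‖n‖) ^ M) := by
        gcongr
        exact hC n
      _ ≤ C + ∑ i, D i := by
        rw [Finset.sum_mul]
        gcongr with i
        exact h2 i

/-- A smooth periodic function is the sum of its Fourier series. -/
theorem exists_eq_fourierSum {f : (Fin (N + 1) → ℝ) → ℂ} (hf : ContDiff ℝ ∞ f)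
    (hp : LatticePeriodic f) : ∃ c, RapidDecay c ∧ f = fourierSum c := by
  refine ⟨boxCoeff f, rapidDecay_boxCoeff hf hp, ?_⟩
  have hq' : IsOpenQuotientMap
      (fun (z : Fin (N + 1) → ℝ) => (fun j => (z j : UnitAddCircle))) :=
    IsOpenQuotientMap.piMap fun _ => QuotientAddGroup.isOpenQuotientMap_mk
  let q : C(Fin (N + 1) → ℝ, UnitAddTorus (Fin (N + 1))) := ⟨_, hq'.continuous⟩
  have hq : Topology.IsQuotientMap q := hq'.isQuotientMap
  have hfac : ∀ a b, q a = q b → f a = f b := fun a b hab => by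
    have : ∀ j, ∃ k : ℤ, b j = a j + k := fun j => by
      have h : ((b j - a j : ℝ) : UnitAddCircle) = 0 := by
        rw [AddCircle.coe_sub, sub_eq_zero]
        exact (congrFun hab j).symm
      obtain ⟨k, hk⟩ := (AddCircle.coe_eq_zero_iff (1 : ℝ)).1 h
      refine ⟨k, ?_⟩
      simp at hk
      linarith
    choose k hk using this
    rw [show b = a + fun j => (k j : ℝ) from funext hk, hp]
  let F : C(UnitAddTorus (Fin (N + 1)), ℂ) :=
    hq.lift ⟨f, hf.continuous⟩ fun a b => hfac a b
  have hF : ∀ z, F (q z) = f z := fun z =>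
    congrFun (congrArg DFunLike.coe (hq.lift_comp ⟨f, hf.continuous⟩ fun a b => hfac a b)) z
  have hcoef : ∀ n, UnitAddTorus.mFourierCoeff F n = boxCoeff f n := fun n => by
    rw [UnitAddTorus.mFourierCoeff_eq_integral _ _ 0, boxCoeff]
    have hset : {x : Fin (N + 1) → ℝ | ∀ i, x i ∈ Set.Ioc ((0 : Fin (N + 1) → ℝ) i)
        ((0 : Fin (N + 1) → ℝ) i + 1)} = Set.univ.pi fun i => Set.Ioc ((0 : Fin (N + 1) → ℝ) i)
        ((1 : Fin (N + 1) → ℝ) i) := by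
      ext x
      simp
    rw [hset, MeasureTheory.setIntegral_congr_set (t := Set.Icc 0 1) (by
      rw [MeasureTheory.volume_pi]
      exact MeasureTheory.Measure.univ_pi_Ioc_ae_eq_Icc)]
    refine MeasureTheory.integral_congr_ae (Filter.Eventually.of_forall fun z => ?_)
    simp only [expo_freq_eq_mFourier, smul_eq_mul, ← hF]
    rfl
  funext z
  have hs := UnitAddTorus.hasSum_mFourier_series_apply_of_summable (f := F)
    (by simpa only [funext hcoef] using (rapidDecay_boxCoeff hf hp).summable.of_norm) (q z)
  rw [hF] at hs
  rw [← hs.tsum_eq, fourierSum]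
  refine tsum_congr fun n => ?_
  rw [hcoef, expo_freq_eq_mFourier]
  rfl

end Box

section Approx

variable {E F : Type*} [NormedAddCommGroup E] [NormedSpace ℝ E] [NormedAddCommGroup F]
  [NormedSpace ℝ F]

/-- `f` can be approximated by elements of `S`, uniformly on `K` together with all derivatives up
to any given order. -/
def ApproxOn (S : Submodule ℂ (E → ℂ)) (K : Set E) (f : E → ℂ) : Prop :=
  ∀ (m : ℕ) (ε : ℝ), 0 < ε →
    ∃ s ∈ S, ∀ k ≤ m, ∀ z ∈ K, ‖iteratedFDeriv ℝ k (fun z => f z - s z) z‖ ≤ ε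

variable {S : Submodule ℂ (E → ℂ)} {K : Set E} {f g : E → ℂ}

theorem ApproxOn.add (hS : ∀ s ∈ S, ContDiff ℝ ∞ s) (hf : ContDiff ℝ ∞ f) (hg : ContDiff ℝ ∞ g)
    (hfa : ApproxOn S K f) (hga : ApproxOn S K g) : ApproxOn S K fun z => f z + g z := by
  intro m ε hε
  obtain ⟨s, hs, hs'⟩ := hfa m (ε / 2) (by positivity)
  obtain ⟨t, ht, ht'⟩ := hga m (ε / 2) (by positivity)
  refine ⟨s + t, S.add_mem hs ht, fun k hk z hz => ?_⟩
  have h : (fun z => f z + g z - (s + t) z) = (fun z => f z - s z) + fun z => g z - t z := by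
    funext z
    simp only [Pi.add_apply]
    ring
  rw [h, iteratedFDeriv_add
    ((hf.sub (hS s hs)).of_le (mod_cast le_top)) ((hg.sub (hS t ht)).of_le (mod_cast le_top))]
  refine (norm_add_le _ _).trans ?_
  linarith [hs' k hk z hz, ht' k hk z hz]

theorem ApproxOn.mul_left {S' : Submodule ℂ (E → ℂ)} (hS : ∀ s ∈ S, ContDiff ℝ ∞ s)
    (hK : IsCompact K) (hf : ContDiff ℝ ∞ f) (hg : ContDiff ℝ ∞ g)
    (hS' : ∀ s ∈ S, (fun z => g z * s z) ∈ S') (hfa : ApproxOn S K f) :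
    ApproxOn S' K fun z => g z * f z := by
  intro m ε hε
  have hb : ∀ i : ℕ, ∃ C, ∀ z ∈ K, ‖iteratedFDeriv ℝ i g z‖ ≤ C := fun i =>
    hK.exists_bound_of_continuousOn (hg.continuous_iteratedFDeriv (mod_cast le_top)).continuousOn
  choose C hC using hb
  set D : ℝ := ∑ k ∈ Finset.range (m + 1), ∑ i ∈ Finset.range (k + 1), k.choose i * |C i| with hD
  have hD0 : 0 ≤ D := by positivity
  obtain ⟨s, hs, hs'⟩ := hfa m (ε / (D + 1)) (by positivity)
  refine ⟨_, hS' s hs, fun k hk z hz => ?_⟩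
  have h : (fun z => g z * f z - g z * s z) = fun z => g z * (f z - s z) := by
    funext z
    ring
  rw [h]
  refine (norm_iteratedFDeriv_mul_le hg (hf.sub (hS s hs)) z (n := k)
    (mod_cast le_top)).trans ?_
  calc _ ≤ ∑ i ∈ Finset.range (k + 1), k.choose i * |C i| * (ε / (D + 1)) := by
        refine Finset.sum_le_sum fun i _ => ?_
        gcongr
        · exact (hC i z hz).trans (le_abs_self _)
        · exact hs' (k - i) (by omega) z hz
    _ ≤ D * (ε / (D + 1)) := by
        rw [← Finset.sum_mul]
        gcongr
        exact Finset.single_le_sum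
          (f := fun k => ∑ i ∈ Finset.range (k + 1), (k.choose i : ℝ) * |C i|)
          (fun _ _ => by positivity) (Finset.mem_range.2 (by omega))
    _ ≤ ε := by
        rw [mul_div_assoc', div_le_iff₀ (by positivity)]
        nlinarith

theorem norm_iteratedFDeriv_comp_clm_le (L : F →L[ℝ] E) (hf : ContDiff ℝ ∞ f) (k : ℕ) (z : F) :
    ‖iteratedFDeriv ℝ k (fun z => f (L z)) z‖ ≤ ‖iteratedFDeriv ℝ k f (L z)‖ * ‖L‖ ^ k := by
  rw [show (fun z => f (L z)) = f ∘ L from rfl,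
    L.iteratedFDeriv_comp_right hf z (i := k) (mod_cast le_top)]
  refine (ContinuousMultilinearMap.norm_compContinuousLinearMap_le _ _).trans (le_of_eq ?_)
  rw [Finset.prod_const, Finset.card_univ, Fintype.card_fin]

theorem ApproxOn.comp_sub_comp {S' : Submodule ℂ (F → ℂ)} {K' : Set F} (L₁ L₂ : F →L[ℝ] E)
    (hS : ∀ s ∈ S, ContDiff ℝ ∞ s) (hf : ContDiff ℝ ∞ f) (hL₁ : Set.MapsTo L₁ K' K)
    (hL₂ : Set.MapsTo L₂ K' K) (hS' : ∀ s ∈ S, (fun z => s (L₁ z) - s (L₂ z)) ∈ S')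
    (hfa : ApproxOn S K f) : ApproxOn S' K' fun z => f (L₁ z) - f (L₂ z) := by
  intro m ε hε
  set C : ℝ := 1 + ‖L₁‖ + ‖L₂‖ with hC
  have hn₁ := norm_nonneg L₁
  have hn₂ := norm_nonneg L₂
  have hC0 : 0 < C := by positivity
  obtain ⟨s, hs, hs'⟩ := hfa m (ε / (2 * C ^ m)) (by positivity)
  refine ⟨_, hS' s hs, fun k hk z hz => ?_⟩
  have hfs : ContDiff ℝ ∞ fun z => f z - s z := hf.sub (hS s hs)
  have hle : ∀ L : F →L[ℝ] E, ‖L‖ ≤ C → L z ∈ K →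
      ‖iteratedFDeriv ℝ k (fun z => f (L z) - s (L z)) z‖ ≤ ε / 2 := fun L hLC hLz => by
    refine (norm_iteratedFDeriv_comp_clm_le L hfs k z).trans ?_
    calc _ ≤ ε / (2 * C ^ m) * C ^ m := by
          gcongr
          · exact hs' k hk _ hLz
          · calc ‖L‖ ^ k ≤ C ^ k := by gcongr
              _ ≤ C ^ m := by gcongr; linarith
      _ = ε / 2 := by field_simp
  have h : (fun z => f (L₁ z) - f (L₂ z) - (s (L₁ z) - s (L₂ z))) =
      (fun z => f (L₁ z) - s (L₁ z)) - fun z => f (L₂ z) - s (L₂ z) := by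
    funext z
    simp only [Pi.sub_apply]
    ring
  have hc : ∀ L : F →L[ℝ] E, ContDiff ℝ k fun z => f (L z) - s (L z) := fun L =>
    (hfs.comp L.contDiff).of_le (mod_cast le_top)
  rw [h, iteratedFDeriv_sub (hc L₁) (hc L₂)]
  refine (norm_sub_le _ _).trans ?_
  linarith [hle L₁ (by linarith) (hL₁ hz), hle L₂ (by linarith) (hL₂ hz)]

theorem ApproxOn.comp_clm {S' : Submodule ℂ (F → ℂ)} {K' : Set F} (L : F →L[ℝ] E)
    (hS : ∀ s ∈ S, ContDiff ℝ ∞ s) (hf : ContDiff ℝ ∞ f) (hL : Set.MapsTo L K' K)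
    (hS' : ∀ s ∈ S, (fun z => s (L z)) ∈ S') (hfa : ApproxOn S K f) :
    ApproxOn S' K' fun z => f (L z) := by
  intro m ε hε
  obtain ⟨s, hs, hs'⟩ := hfa m (ε / (1 + ‖L‖) ^ m) (by positivity)
  refine ⟨_, hS' s hs, fun k hk z hz => ?_⟩
  refine (norm_iteratedFDeriv_comp_clm_le L (hf.sub (hS s hs)) k z).trans ?_
  calc _ ≤ ε / (1 + ‖L‖) ^ m * (1 + ‖L‖) ^ m := by
        gcongr
        · exact hs' k hk _ (hL hz)
        · calc ‖L‖ ^ k ≤ (1 + ‖L‖) ^ k := by gcongr; linarith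
            _ ≤ (1 + ‖L‖) ^ m := by gcongr; linarith [norm_nonneg L]
    _ = ε := by field_simp

theorem ApproxOn.congr {U : Set E} (hU : IsOpen U) (hKU : K ⊆ U) (h : Set.EqOn f g U)
    (hfa : ApproxOn S K f) : ApproxOn S K g := by
  intro m ε hε
  obtain ⟨s, hs, hs'⟩ := hfa m ε hε
  refine ⟨s, hs, fun k hk z hz => ?_⟩
  rw [← Filter.EventuallyEq.eq_of_nhds (Filter.EventuallyEq.iteratedFDeriv (𝕜 := ℝ) (n := k)
    (f₁ := fun z => f z - s z) ?_)]
  · exact hs' k hk z hz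
  · filter_upwards [hU.mem_nhds (hKU hz)] with y hy
    rw [h hy]

end Approx

/-- The span of the exponential solutions of `∂₀ v + c v = ∂₁² v + ∂₂² v`. -/
noncomputable def expSpan (c : ℂ) : Submodule ℂ ((Fin 3 → ℝ) → ℂ) :=
  Submodule.span ℂ (expo '' {w | w 0 + c = w 1 ^ 2 + w 2 ^ 2})

theorem contDiff_of_mem_expSpan {c : ℂ} {s : (Fin 3 → ℝ) → ℂ} (hs : s ∈ expSpan c) :
    ContDiff ℝ ∞ s := by
  induction hs using Submodule.span_induction with
  | mem x h =>
    obtain ⟨w, -, rfl⟩ := h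
    exact contDiff_expo w
  | zero => exact contDiff_const
  | add x y _ _ hx hy => exact hx.add hy
  | smul a x _ hx => exact contDiff_const.mul hx

theorem expo_mem_expSpan {c : ℂ} {w : Fin 3 → ℂ} (hw : w 0 + c = w 1 ^ 2 + w 2 ^ 2) :
    expo w ∈ expSpan c :=
  Submodule.subset_span ⟨w, hw, rfl⟩

theorem comp_mem_of_mem_span {α β : Type*} {A : Set (α → ℂ)} {T : Submodule ℂ (β → ℂ)}
    (φ : (α → ℂ) →ₗ[ℂ] (β → ℂ)) (h : ∀ s ∈ A, φ s ∈ T) {s : α → ℂ}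
    (hs : s ∈ Submodule.span ℂ A) : φ s ∈ T :=
  (Submodule.span_le (p := T.comap φ)).2 h hs

section Fourier

variable {d : Type*} [Fintype d]

theorem RapidDecay.indicator {c : (d → ℤ) → ℂ} (hc : RapidDecay c) (A : Set (d → ℤ)) :
    RapidDecay (A.indicator c) := fun M => by
  refine Summable.of_nonneg_of_le (fun n => by positivity) (fun n => ?_) (hc M)
  gcongr
  exact norm_indicator_le_norm_self c n

theorem RapidDecay.fourierSum_add {b c : (d → ℤ) → ℂ} (hb : RapidDecay b) (hc : RapidDecay c)
    (z : d → ℝ) : fourierSum (fun n => b n + c n) z = fourierSum b z + fourierSum c z := by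
  simp only [fourierSum, add_mul]
  exact (hb.summable_term z).tsum_add (hc.summable_term z)

theorem fourierSum_const_mul (a : ℂ) (c : (d → ℤ) → ℂ) (z : d → ℝ) :
    fourierSum (fun n => a * c n) z = a * fourierSum c z := by
  simp only [fourierSum, mul_assoc, tsum_mul_left]

theorem RapidDecay.const_mul {c : (d → ℤ) → ℂ} (hc : RapidDecay c) (a : ℂ) :
    RapidDecay (fun n => a * c n) :=
  hc.mul_of_le (C := ‖a‖) (N := 0) (by simp)

theorem RapidDecay.norm_iteratedFDeriv_fourierSum_le {c : (d → ℤ) → ℂ} (hc : RapidDecay c)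
    (k : ℕ) (z : d → ℝ) :
    ‖iteratedFDeriv ℝ k (fourierSum c) z‖ ≤
      (2 * Real.pi * Fintype.card d) ^ k * ∑' n, ‖c n‖ * (1 + ‖n‖) ^ k := by
  have h := iteratedFDeriv_tsum_apply (𝕜 := ℝ) (N := ⊤) (f := fun n z => c n * expo (freq n) z)
    (fun n => contDiff_const.mul (contDiff_expo _)) (fun k _ => (hc k).mul_left _)
    (fun k n x _ => norm_iteratedFDeriv_term_le (c n) n k x) (k := k) le_top z
  have h' : fourierSum c = fun z => ∑' n, c n * expo (freq n) z := rfl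
  rw [h', h, ← tsum_mul_left]
  exact tsum_of_norm_bounded ((hc k).mul_left _).hasSum
    fun n => norm_iteratedFDeriv_term_le (c n) n k z

/-- Partial sums over the fibres of a map converge together with all derivatives. -/
theorem RapidDecay.exists_finset_fiber {γ : Type*} {c : (d → ℤ) → ℂ} (hc : RapidDecay c)
    (ρ : (d → ℤ) → γ) (m : ℕ) {ε : ℝ} (hε : 0 < ε) :
    ∃ T : Finset γ, ∀ k ≤ m, ∀ z, ‖iteratedFDeriv ℝ k (fun z => fourierSum c z -
      ∑ p ∈ T, fourierSum ((ρ ⁻¹' {p}).indicator c) z) z‖ ≤ ε := by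
  classical
  set D : ℝ := (1 + 2 * Real.pi * Fintype.card d) ^ m with hD
  have hpi := Real.pi_pos
  have hD0 : 0 < D := by positivity
  have ht := (tendsto_tsum_compl_atTop_zero fun n => ‖c n‖ * (1 + ‖n‖) ^ m).eventually
    (gt_mem_nhds (show (0 : ℝ) < ε / D by positivity))
  obtain ⟨F, hF⟩ := ht.exists
  refine ⟨F.image ρ, fun k hk z => ?_⟩
  have hsub : (fun z => fourierSum c z - ∑ p ∈ F.image ρ, fourierSum ((ρ ⁻¹' {p}).indicator c) z) =
      fourierSum ({n | ρ n ∉ F.image ρ}.indicator c) := by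
    funext z
    simp only [fourierSum]
    rw [← Summable.tsum_finsetSum fun p _ => (hc.indicator _).summable_term z,
      ← (hc.summable_term z).tsum_sub
        (summable_sum fun p _ => (hc.indicator (ρ ⁻¹' {p})).summable_term z)]
    refine tsum_congr fun n => ?_
    rw [← Finset.sum_mul, ← sub_mul]
    congr 1
    simp only [Set.indicator_apply, Set.mem_preimage, Set.mem_singleton_iff, Set.mem_ofPred_eq]
    rw [Finset.sum_ite_eq]
    split_ifs <;> simp_all
  rw [hsub]
  refine ((hc.indicator _).norm_iteratedFDeriv_fourierSum_le k z).trans ?_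
  have h1 : ∑' n, ‖{n | ρ n ∉ F.image ρ}.indicator c n‖ * (1 + ‖n‖) ^ k ≤ ε / D := by
    refine le_trans ?_ ((tsum_subtype {n | n ∉ F} fun n => ‖c n‖ * (1 + ‖n‖) ^ m).ge.trans hF.le)
    refine ((hc.indicator _) k).tsum_le_tsum (fun n => ?_) ((hc m).indicator _)
    by_cases hn : n ∈ F
    · have : ρ n ∈ F.image ρ := Finset.mem_image_of_mem ρ hn
      simp only [Set.indicator_apply, Set.mem_ofPred_eq, this, not_true_eq_false, if_false, hn,
        norm_zero, zero_mul, le_refl]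
    · rw [Set.indicator_of_mem (s := {n | n ∉ F}) hn]
      gcongr
      · exact norm_indicator_le_norm_self c n
      · linarith [norm_nonneg n]
  calc _ ≤ D * (ε / D) := by
        refine mul_le_mul ?_ h1 (tsum_nonneg fun n => by positivity) hD0.le
        calc _ ≤ (1 + 2 * Real.pi * Fintype.card d) ^ k := by gcongr; linarith
          _ ≤ D := by
            rw [hD]
            gcongr
            have : (0 : ℝ) ≤ 2 * Real.pi * Fintype.card d := by positivity
            linarith
    _ = ε := by field_simp

end Fourier

section Slice

variable {N : ℕ} (j : Fin (N + 1))

theorem freq_eq_insertNth (n : Fin (N + 1) → ℤ) :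
    freq n = j.insertNth (freq n j) (freq fun l => n (j.succAbove l)) := by
  funext k
  refine Fin.succAboveCases j ?_ (fun l => ?_) k <;> simp [freq]

theorem expo_insertNth (x : ℂ) (q : Fin N → ℂ) (z : Fin (N + 1) → ℝ) :
    expo (j.insertNth x q) z = Complex.exp (x * z j) * expo q fun l => z (j.succAbove l) := by
  simp only [expo, Fin.sum_univ_succAbove _ j, Complex.exp_add, Fin.insertNth_apply_same,
    Fin.insertNth_apply_succAbove]

/-- The part of a Fourier series with a given frequency transversal to the `j`-th axis,
restricted to that axis. -/
noncomputable def axisSum (c : (Fin (N + 1) → ℤ) → ℂ) (p : Fin N → ℤ) (s : ℝ) : ℂ :=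
  fourierSum (((fun n l => n (j.succAbove l)) ⁻¹' {p}).indicator c) (Pi.single j s)

theorem fourierSum_fiber_eq (c : (Fin (N + 1) → ℤ) → ℂ) (p : Fin N → ℤ) (z : Fin (N + 1) → ℝ) :
    fourierSum (((fun n l => n (j.succAbove l)) ⁻¹' {p}).indicator c) z =
      axisSum j c p (z j) * expo (freq p) fun l => z (j.succAbove l) := by
  simp only [axisSum, fourierSum, ← tsum_mul_right]
  refine tsum_congr fun n => ?_
  by_cases hn : n ∈ (fun (n : Fin (N + 1) → ℤ) l => n (j.succAbove l)) ⁻¹' {p}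
  · have hn' : (fun l => n (j.succAbove l)) = p := hn
    rw [freq_eq_insertNth j n, expo_insertNth, expo_insertNth, hn']
    have : ∀ l, (Pi.single j (z j) : Fin (N + 1) → ℝ) (j.succAbove l) = 0 := fun l => by simp
    simp only [this, Pi.single_eq_same]
    simp [expo]
    ring
  · simp [Set.indicator_of_notMem hn]

theorem axisSum_eq_zero {c : (Fin (N + 1) → ℤ) → ℂ} (hc : RapidDecay c) {s : ℝ}
    (h : ∀ z : Fin (N + 1) → ℝ, z j = s → fourierSum c z = 0) (p : Fin N → ℤ) :
    axisSum j c p s = 0 := by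
  have hfib : ∀ z : Fin (N + 1) → ℝ, z j = s → HasSum
      (fun p => axisSum j c p s * expo (freq p) fun l => z (j.succAbove l)) 0 := fun z hz => by
    have h1 := (hc.summable_term z).hasSum.tsum_fiberwise fun n l => n (j.succAbove l)
    have h2 : ∑' n, c n * expo (freq n) z = 0 := h z hz
    rw [h2] at h1
    suffices h3 : (fun p => axisSum j c p s * expo (freq p) fun l => z (j.succAbove l)) =
        fun p => ∑' n : (fun (n : Fin (N + 1) → ℤ) l => n (j.succAbove l)) ⁻¹' {p},
          c n * expo (freq (n : Fin (N + 1) → ℤ)) z by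
      rw [h3]
      exact h1
    funext p
    rw [tsum_subtype (_ ⁻¹' {p}) fun n => c n * expo (freq n) z, ← hz, ← fourierSum_fiber_eq,
      fourierSum]
    refine tsum_congr fun n => ?_
    rw [Set.indicator_mul_left]
  have hsum : Summable fun p => ‖axisSum j c p s‖ := by
    have h1 := (hc.summable.hasSum.tsum_fiberwise fun n l => n (j.succAbove l)).summable
    refine Summable.of_nonneg_of_le (fun p => norm_nonneg _) (fun p => ?_) h1
    rw [tsum_subtype (_ ⁻¹' {p}) fun n => ‖c n‖]
    refine tsum_of_norm_bounded (hc.summable.indicator _).hasSum fun n => ?_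
    rw [norm_mul, norm_expo_freq, mul_one, norm_indicator_eq_indicator_norm]
  refine congrFun (eq_zero_of_tsum_expo_eq_zero hsum fun z' => ?_) p
  have := (hfib (j.insertNth s z') (by simp)).tsum_eq
  simpa using this

theorem hasDerivAt_axisSum {c : (Fin (N + 1) → ℤ) → ℂ} (hc : RapidDecay c) (p : Fin N → ℤ)
    (s : ℝ) : HasDerivAt (axisSum j c p) (axisSum j (fun n => freq n j * c n) p s) s := by
  have hc' := hc.indicator ((fun n l => n (j.succAbove l)) ⁻¹' {p})
  have h1 := (hc'.contDiff_fourierSum.differentiable (by simp) (Pi.single j s)).hasFDerivAt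
  have h2 : HasDerivAt (fun s : ℝ => (Pi.single j s : Fin (N + 1) → ℝ)) (Pi.single j 1) s :=
    hasDerivAt_single j s
  have h3 := h1.comp_hasDerivAt s h2
  have h4 := congrFun (hc'.pd_fourierSum j) (Pi.single j s)
  rw [pd] at h4
  rw [h4] at h3
  have h5 : axisSum j (fun n => freq n j * c n) p s = fourierSum (fun n => freq n j *
      ((fun n l => n (j.succAbove l)) ⁻¹' {p}).indicator c n) (Pi.single j s) := by
    simp only [axisSum]
    congr 1
    funext n
    rw [Set.indicator_mul_right]
  rw [h5]
  exact h3

end Slice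

section ODE

variable {r : ℝ} {g g' : ℝ → ℂ}

theorem exists_eq_exp_of_hasDerivAt {μ : ℂ}
    (hg : ∀ s ∈ Set.Ioo (-r) r, HasDerivAt g (μ * g s) s) :
    ∃ A : ℂ, ∀ s ∈ Set.Ioo (-r) r, g s = A * Complex.exp (μ * s) := by
  have hd : ∀ s ∈ Set.Ioo (-r) r, HasDerivAt (fun s : ℝ => g s * Complex.exp (-μ * s)) 0 s :=
    fun s hs => by
      have h1 : HasDerivAt (fun s : ℝ => Complex.exp (-μ * s)) (Complex.exp (-μ * s) * (-μ)) s := by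
        have := ((hasDerivAt_id s).ofReal_comp.const_mul (-μ)).cexp
        simpa using this
      refine ((hg s hs).mul h1).congr_deriv ?_
      ring
  refine ⟨g 0, fun s hs => ?_⟩
  have h0 : (0 : ℝ) ∈ Set.Ioo (-r) r := by
    constructor <;> linarith [hs.1, hs.2]
  have := isOpen_Ioo.is_const_of_deriv_eq_zero isPreconnected_Ioo
    (fun s hs => (hd s hs).differentiableAt.differentiableWithinAt)
    (fun s hs => (hd s hs).deriv) hs h0
  simp only [Complex.ofReal_zero, mul_zero, Complex.exp_zero, mul_one] at this
  rw [← this, mul_assoc, ← Complex.exp_add]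
  simp

theorem exists_eq_exp_add_exp_of_hasDerivAt {κ : ℂ} (hκ : κ ≠ 0)
    (hg : ∀ s ∈ Set.Ioo (-r) r, HasDerivAt g (g' s) s)
    (hg' : ∀ s ∈ Set.Ioo (-r) r, HasDerivAt g' (κ ^ 2 * g s) s) :
    ∃ A B : ℂ, ∀ s ∈ Set.Ioo (-r) r,
      g s = A * Complex.exp (κ * s) + B * Complex.exp (-κ * s) := by
  obtain ⟨A, hA⟩ := exists_eq_exp_of_hasDerivAt (g := fun s => g' s + κ * g s) (μ := κ)
    fun s hs => by
      refine ((hg' s hs).add ((hg s hs).const_mul κ)).congr_deriv ?_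
      ring
  obtain ⟨B, hB⟩ := exists_eq_exp_of_hasDerivAt (g := fun s => g' s - κ * g s) (μ := -κ)
    fun s hs => by
      refine ((hg' s hs).sub ((hg s hs).const_mul κ)).congr_deriv ?_
      ring
  refine ⟨A / (2 * κ), -B / (2 * κ), fun s hs => ?_⟩
  have h1 := hA s hs
  have h2 := hB s hs
  rw [neg_div, neg_mul, ← sub_eq_add_neg, div_mul_eq_mul_div, div_mul_eq_mul_div, ← sub_div,
    eq_div_iff (mul_ne_zero two_ne_zero hκ)]
  linear_combination h1 - h2

end ODE

/-- The symbol of the operator `∂₀ + 1 - ∂₁² - ∂₂²`. -/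
def heatSymbol (w : Fin 3 → ℂ) : ℂ := w 0 + 1 - w 1 ^ 2 - w 2 ^ 2

theorem expo_mem_expSpan_one {w : Fin 3 → ℂ} (hw : heatSymbol w = 0) : expo w ∈ expSpan 1 := by
  refine expo_mem_expSpan ?_
  simp only [heatSymbol] at hw
  linear_combination hw

theorem re_freq_sq {d : Type*} [Fintype d] (n : d → ℤ) (i : d) : (freq n i ^ 2).re ≤ 0 := by
  have : freq n i ^ 2 = ((-(2 * Real.pi * n i) ^ 2 : ℝ) : ℂ) := by
    simp only [freq]
    push_cast
    linear_combination (2 * Real.pi * n i : ℂ) ^ 2 * Complex.I_sq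
  rw [this, Complex.ofReal_re]
  nlinarith [sq_nonneg (2 * Real.pi * n i)]

theorem re_freq {d : Type*} [Fintype d] (n : d → ℤ) (i : d) : (freq n i).re = 0 := by
  simp [freq]

theorem RapidDecay.heatSymbol_mul {a : (Fin 3 → ℤ) → ℂ} (ha : RapidDecay a) :
    RapidDecay fun n => heatSymbol (freq n) * a n := by
  have h1 := (ha.freq_mul 0).add (ha.add
    ((((ha.freq_mul 1).freq_mul 1).add ((ha.freq_mul 2).freq_mul 2)).const_mul (-1)))
  convert h1 using 2
  simp only [heatSymbol]
  ring

theorem one_le_norm_heatSymbol_freq (n : Fin 3 → ℤ) : 1 ≤ ‖heatSymbol (freq n)‖ := by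
  refine le_trans ?_ (Complex.re_le_norm _)
  simp only [heatSymbol, Complex.sub_re, Complex.add_re, Complex.one_re, re_freq]
  linarith [re_freq_sq n 1, re_freq_sq n 2]

theorem heatSymbol_insertNth (j : Fin 3) (p : Fin 2 → ℤ) :
    (∃ μ : ℂ, ∀ x, heatSymbol (j.insertNth x (freq p)) = x + μ) ∨
      ∃ κ : ℂ, κ ≠ 0 ∧ ∀ x, heatSymbol (j.insertNth x (freq p)) = κ ^ 2 - x ^ 2 := by
  have key : ∀ i i' : Fin 2, ∃ κ : ℂ, κ ≠ 0 ∧ κ ^ 2 = freq p i + 1 - freq p i' ^ 2 :=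
    fun i i' => by
      obtain ⟨κ, hκ⟩ := IsAlgClosed.exists_pow_nat_eq (freq p i + 1 - freq p i' ^ 2) two_pos
      refine ⟨κ, ?_, hκ⟩
      rintro rfl
      have := congrArg Complex.re hκ
      simp only [ne_eq, OfNat.ofNat_ne_zero, not_false_eq_true, zero_pow, Complex.zero_re,
        Complex.sub_re, Complex.add_re, Complex.one_re, re_freq] at this
      linarith [re_freq_sq p i']
  have h0 : ∀ x, (Fin.insertNth 0 x (freq p) : Fin 3 → ℂ) = ![x, freq p 0, freq p 1] := fun x => by
    funext k; fin_cases k <;> rfl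
  have h1 : ∀ x, (Fin.insertNth 1 x (freq p) : Fin 3 → ℂ) = ![freq p 0, x, freq p 1] := fun x => by
    funext k; fin_cases k <;> rfl
  have h2 : ∀ x, (Fin.insertNth 2 x (freq p) : Fin 3 → ℂ) = ![freq p 0, freq p 1, x] := fun x => by
    funext k; fin_cases k <;> rfl
  obtain rfl | rfl | rfl : j = 0 ∨ j = 1 ∨ j = 2 := by omega
  · refine Or.inl ⟨1 - freq p 0 ^ 2 - freq p 1 ^ 2, fun x => ?_⟩
    rw [h0]
    simp only [heatSymbol, Matrix.cons_val]
    ring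
  · obtain ⟨κ, hκ, h⟩ := key 0 1
    refine Or.inr ⟨κ, hκ, fun x => ?_⟩
    rw [h1, h]
    simp only [heatSymbol, Matrix.cons_val]
    ring
  · obtain ⟨κ, hκ, h⟩ := key 0 1
    refine Or.inr ⟨κ, hκ, fun x => ?_⟩
    rw [h2, h]
    simp only [heatSymbol, Matrix.cons_val]

section Slab

variable (j : Fin 3) {a : (Fin 3 → ℤ) → ℂ} {r : ℝ}

theorem axisSum_heatSymbol_mul (p : Fin 2 → ℤ) {φ : ℂ → ℂ}
    (h : ∀ x, heatSymbol (j.insertNth x (freq p)) = φ x) (s : ℝ) :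
    axisSum j (fun n => heatSymbol (freq n) * a n) p s =
      axisSum j (fun n => φ (freq n j) * a n) p s := by
  simp only [axisSum]
  refine congrArg (fourierSum · (Pi.single j s)) (funext fun n => ?_)
  by_cases hn : n ∈ (fun (n : Fin 3 → ℤ) l => n (j.succAbove l)) ⁻¹' {p}
  · have hn' : (fun l => n (j.succAbove l)) = p := hn
    rw [Set.indicator_of_mem hn, Set.indicator_of_mem hn, freq_eq_insertNth j n, hn', h]
    simp
  · rw [Set.indicator_of_notMem hn, Set.indicator_of_notMem hn]

theorem axisSum_add {N : ℕ} {j : Fin (N + 1)} {b c : (Fin (N + 1) → ℤ) → ℂ} (hb : RapidDecay b)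
    (hc : RapidDecay c) (p : Fin N → ℤ) (s : ℝ) :
    axisSum j (fun n => b n + c n) p s = axisSum j b p s + axisSum j c p s := by
  simp only [axisSum]
  rw [← (hb.indicator _).fourierSum_add (hc.indicator _), ← Set.indicator_add]

theorem axisSum_const_mul {N : ℕ} {j : Fin (N + 1)} (x : ℂ) (c : (Fin (N + 1) → ℤ) → ℂ)
    (p : Fin N → ℤ) (s : ℝ) :
    axisSum j (fun n => x * c n) p s = x * axisSum j c p s := by
  simp only [axisSum]
  rw [← fourierSum_const_mul]
  congr 1
  funext n
  rw [Set.indicator_mul_right]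

theorem exists_mem_expSpan_eqOn_fiber (ha : RapidDecay a)
    (h : ∀ z : Fin 3 → ℝ, z j ∈ Set.Ioo (-r) r →
      fourierSum (fun n => heatSymbol (freq n) * a n) z = 0)
    (p : Fin 2 → ℤ) : ∃ s ∈ expSpan 1, ∀ z : Fin 3 → ℝ, z j ∈ Set.Ioo (-r) r →
      fourierSum (((fun n l => n (j.succAbove l)) ⁻¹' {p}).indicator a) z = s z := by
  have hz : ∀ s ∈ Set.Ioo (-r) r, axisSum j (fun n => heatSymbol (freq n) * a n) p s = 0 :=
    fun s hs => axisSum_eq_zero j ha.heatSymbol_mul (fun z hz => h z (hz ▸ hs)) p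
  have hd := hasDerivAt_axisSum j ha p
  have hd' := hasDerivAt_axisSum j (ha.freq_mul j) p
  obtain ⟨μ, hμ⟩ | ⟨κ, hκ, hκ'⟩ := heatSymbol_insertNth j p
  · obtain ⟨A, hA⟩ := exists_eq_exp_of_hasDerivAt (g := axisSum j a p) (μ := -μ) (r := r)
      fun s hs => by
        have h1 := hz s hs
        rw [axisSum_heatSymbol_mul j p hμ] at h1
        simp only [add_mul] at h1
        rw [axisSum_add (ha.freq_mul j) (ha.const_mul μ), axisSum_const_mul] at h1
        convert hd s using 1
        linear_combination -h1
    refine ⟨A • expo (j.insertNth (-μ) (freq p)), Submodule.smul_mem _ _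
      (expo_mem_expSpan_one (by rw [hμ]; ring)), fun z hzj => ?_⟩
    rw [fourierSum_fiber_eq, hA _ hzj, Pi.smul_apply, expo_insertNth, smul_eq_mul]
    ring
  · obtain ⟨A, B, hAB⟩ := exists_eq_exp_add_exp_of_hasDerivAt (g := axisSum j a p) (r := r) hκ
      (fun s _ => hd s) fun s hs => by
        have h1 := hz s hs
        rw [axisSum_heatSymbol_mul j p hκ'] at h1
        have h2 : (fun n => (κ ^ 2 - freq n j ^ 2) * a n) =
            fun n => κ ^ 2 * a n + (-1) * (freq n j * (freq n j * a n)) := by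
          funext n
          ring
        rw [h2, axisSum_add (ha.const_mul _) (((ha.freq_mul j).freq_mul j).const_mul _),
          axisSum_const_mul, axisSum_const_mul] at h1
        convert hd' s using 1
        linear_combination h1
    refine ⟨A • expo (j.insertNth κ (freq p)) + B • expo (j.insertNth (-κ) (freq p)),
      Submodule.add_mem _
        (Submodule.smul_mem _ _ (expo_mem_expSpan_one (by rw [hκ']; ring)))
        (Submodule.smul_mem _ _ (expo_mem_expSpan_one (by rw [hκ']; ring))), fun z hzj => ?_⟩
    rw [fourierSum_fiber_eq, hAB _ hzj]
    simp only [Pi.add_apply, Pi.smul_apply, expo_insertNth, smul_eq_mul]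
    ring

theorem approxOn_fourierSum_of_slab (ha : RapidDecay a)
    (h : ∀ z : Fin 3 → ℝ, z j ∈ Set.Ioo (-r) r →
      fourierSum (fun n => heatSymbol (freq n) * a n) z = 0)
    {K : Set (Fin 3 → ℝ)} (hK : ∀ z ∈ K, z j ∈ Set.Ioo (-r) r) :
    ApproxOn (expSpan 1) K (fourierSum a) := by
  intro m ε hε
  choose s hs hs' using exists_mem_expSpan_eqOn_fiber j ha h
  obtain ⟨T, hT⟩ := ha.exists_finset_fiber (fun n l => n (j.succAbove l)) m hε
  refine ⟨∑ p ∈ T, s p, Submodule.sum_mem _ fun p _ => hs p, fun k hk z hz => ?_⟩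
  refine le_trans (le_of_eq ?_) (hT k hk z)
  refine congrArg _ (Filter.EventuallyEq.eq_of_nhds (Filter.EventuallyEq.iteratedFDeriv (𝕜 := ℝ)
    (n := k) ?_))
  have : ∀ᶠ y : Fin 3 → ℝ in nhds z, y j ∈ Set.Ioo (-r) r :=
    (continuous_apply j).continuousAt.eventually (isOpen_Ioo.mem_nhds (hK z hz))
  filter_upwards [this] with y hy
  rw [Finset.sum_apply]
  congr 1
  exact Finset.sum_congr rfl fun p _ => (hs' p y hy).symm

end Slab

theorem RapidDecay.ext_of_fourierSum_eq {d : Type*} [Fintype d] {b c : (d → ℤ) → ℂ}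
    (hb : RapidDecay b) (hc : RapidDecay c) (h : fourierSum b = fourierSum c) : b = c := by
  have h0 := eq_zero_of_tsum_expo_eq_zero (hb.add (hc.const_mul (-1))).summable fun z => by
    have := hb.fourierSum_add (hc.const_mul (-1)) z
    rw [fourierSum_const_mul, h] at this
    simpa [fourierSum] using this
  funext n
  have := congrFun h0 n
  simp only [Pi.zero_apply] at this
  linear_combination this

/-- The operator `∂₀ + 1 - ∂₁² - ∂₂²`. -/
noncomputable def heatOp (f : (Fin 3 → ℝ) → ℂ) (z : Fin 3 → ℝ) : ℂ :=
  pd 0 f z + f z - pd 1 (pd 1 f) z - pd 2 (pd 2 f) z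

theorem ContDiff.heatOp {f : (Fin 3 → ℝ) → ℂ} (hf : ContDiff ℝ ∞ f) : ContDiff ℝ ∞ (heatOp f) :=
  (((hf.pd 0).add hf).sub ((hf.pd 1).pd 1)).sub ((hf.pd 2).pd 2)

theorem LatticePeriodic.heatOp {f : (Fin 3 → ℝ) → ℂ} (hf : LatticePeriodic f) :
    LatticePeriodic (heatOp f) := fun n z => by
  simp only [_root_.heatOp, hf n z, hf.pd 0 n z, (hf.pd 1).pd 1 n z, (hf.pd 2).pd 2 n z]

theorem pd_congr {d : Type*} [Fintype d] [DecidableEq d] {f g : (d → ℝ) → ℂ} {U : Set (d → ℝ)}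
    (hU : IsOpen U) (h : Set.EqOn f g U) (i : d) : Set.EqOn (pd i f) (pd i g) U := fun z hz => by
  have : f =ᶠ[nhds z] g := Filter.eventuallyEq_of_mem (hU.mem_nhds hz) h
  simp only [pd, this.fderiv_eq]

theorem heatOp_congr {f g : (Fin 3 → ℝ) → ℂ} {U : Set (Fin 3 → ℝ)} (hU : IsOpen U)
    (h : Set.EqOn f g U) : Set.EqOn (heatOp f) (heatOp g) U := fun z hz => by
  have h1 := pd_congr hU (pd_congr hU h 1) 1 hz
  have h2 := pd_congr hU (pd_congr hU h 2) 2 hz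
  simp only [heatOp, h hz, pd_congr hU h 0 hz, h1, h2]

theorem RapidDecay.heatOp_fourierSum {a : (Fin 3 → ℤ) → ℂ} (ha : RapidDecay a) :
    heatOp (fourierSum a) = fourierSum fun n => heatSymbol (freq n) * a n := by
  funext z
  simp only [heatOp, ha.pd_fourierSum, (ha.freq_mul 1).pd_fourierSum,
    (ha.freq_mul 2).pd_fourierSum]
  have h1 := ((ha.freq_mul 1).freq_mul 1).add ((ha.freq_mul 2).freq_mul 2)
  have h2 : (fun n => heatSymbol (freq n) * a n) = fun n => freq n 0 * a n + (a n + (-1) *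
      (freq n 1 * (freq n 1 * a n) + freq n 2 * (freq n 2 * a n))) := by
    funext n
    simp only [heatSymbol]
    ring
  rw [h2, (ha.freq_mul 0).fourierSum_add (ha.add (h1.const_mul _)),
    ha.fourierSum_add (h1.const_mul _), fourierSum_const_mul,
    ((ha.freq_mul 1).freq_mul 1).fourierSum_add ((ha.freq_mul 2).freq_mul 2)]
  ring

section Cutoff

/-- A smooth `1`-periodic function which is the identity near `0`. -/
theorem exists_periodic_eq_id : ∃ ψ : ℝ → ℝ, ContDiff ℝ ∞ ψ ∧ (∀ (n : ℤ) s, ψ (s + n) = ψ s) ∧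
    ∀ s, |s| < 1 / 16 → ψ s = s := by
  let χ : ContDiffBump (0 : ℝ) := ⟨1 / 2, 3 / 4, by norm_num, by norm_num⟩
  have hA : ContDiff ℝ ∞ fun σ => χ σ * (Real.arcsin σ / (2 * Real.pi)) := by
    rw [contDiff_iff_contDiffAt]
    intro σ
    by_cases h : |σ| < 1
    · refine χ.contDiffAt.mul (ContDiffAt.div_const (Real.contDiffAt_arcsin ?_ ?_) _)
      · linarith [(abs_lt.1 h).1]
      · linarith [(abs_lt.1 h).2]
    · have hσ : (3 / 4 : ℝ) < |σ| := by linarith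
      refine (contDiffAt_const (c := (0 : ℝ))).congr_of_eventuallyEq ?_
      filter_upwards [(continuous_abs.continuousAt.eventually (lt_mem_nhds hσ))] with x hx
      rw [χ.zero_of_le_dist, zero_mul]
      rw [Real.dist_0_eq_abs]
      exact hx.le
  refine ⟨_, hA.comp (Real.contDiff_sin.comp (contDiff_const.mul contDiff_id) :
    ContDiff ℝ ∞ fun s : ℝ => Real.sin (2 * Real.pi * s)), fun n s => ?_, fun s hs => ?_⟩
  · simp only [Function.comp_apply]
    rw [show 2 * Real.pi * (s + n) = 2 * Real.pi * s + n * (2 * Real.pi) by ring,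
      Real.sin_add_int_mul_two_pi]
  · have h1 := Real.pi_gt_three
    have h2 := Real.pi_lt_d2
    have h3 : |2 * Real.pi * s| < 2 * Real.pi * (1 / 16) := by
      rw [abs_mul, abs_of_pos (by positivity)]
      gcongr
    have h4 := abs_lt.1 h3
    simp only [Function.comp_apply]
    rw [χ.one_of_mem_closedBall, Real.arcsin_sin (by linarith) (by linarith)]
    · field_simp
    · rw [mem_closedBall_zero_iff, Real.norm_eq_abs]
      refine Real.abs_sin_le_abs.trans ?_
      change _ ≤ (1 / 2 : ℝ)
      linarith

/-- A smooth `1`-periodic cutoff, vanishing near the integers and equal to `1` away from them. -/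
theorem exists_periodic_cutoff : ∃ θ : ℝ → ℝ, ContDiff ℝ ∞ θ ∧ (∀ (n : ℤ) s, θ (s + n) = θ s) ∧
    (∀ s, |s| < 1 / 32 → θ s = 0) ∧ ∀ s, θ s ≠ 1 → ∃ n : ℤ, |s + n| < 1 / 16 := by
  have hpi := Real.pi_pos
  have hc : Real.cos (Real.pi / 8) < Real.cos (Real.pi / 16) :=
    Real.cos_lt_cos_of_nonneg_of_le_pi (by positivity) (by linarith) (by linarith)
  refine ⟨fun s => Real.smoothTransition ((Real.cos (Real.pi / 16) - Real.cos (2 * Real.pi * s)) /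
    (Real.cos (Real.pi / 16) - Real.cos (Real.pi / 8))), ?_, fun n s => ?_, fun s hs => ?_,
    fun s hs => ?_⟩
  · exact Real.smoothTransition.contDiff.comp ((contDiff_const.sub
      (Real.contDiff_cos.comp (contDiff_const.mul contDiff_id))).div_const _)
  · beta_reduce
    rw [show 2 * Real.pi * (s + n) = 2 * Real.pi * s + n * (2 * Real.pi) by ring,
      Real.cos_add_int_mul_two_pi]
  · refine Real.smoothTransition.zero_of_nonpos (div_nonpos_of_nonpos_of_nonneg ?_ (by linarith))
    rw [sub_nonpos, ← Real.cos_abs (2 * Real.pi * s), abs_mul,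
      abs_of_pos (show 0 < 2 * Real.pi by positivity)]
    refine Real.cos_le_cos_of_nonneg_of_le_pi (by positivity) (by linarith) ?_
    nlinarith
  · refine ⟨-round s, ?_⟩
    by_contra! h
    refine hs (Real.smoothTransition.one_of_one_le ?_)
    rw [one_le_div (by linarith)]
    have h1 : Real.cos (2 * Real.pi * s) = Real.cos (2 * Real.pi * |s + (-round s : ℤ)|) := by
      rw [← abs_of_pos (show 0 < 2 * Real.pi by positivity), ← abs_mul, Real.cos_abs,
        abs_of_pos (show 0 < 2 * Real.pi by positivity), mul_add, mul_comm _ ((-round s : ℤ) : ℝ),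
        Real.cos_add_int_mul_two_pi]
    have h2 : |s + (-round s : ℤ)| ≤ 1 / 2 := by
      have := abs_sub_round s
      push_cast
      rwa [← sub_eq_add_neg]
    rw [h1]
    have := Real.cos_le_cos_of_nonneg_of_le_pi (x := Real.pi / 8)
      (y := 2 * Real.pi * |s + (-round s : ℤ)|) (by positivity) (by nlinarith) (by nlinarith)
    linarith

end Cutoff

theorem approxOn_expSpan_of_heatOp_eq_zero {v : (Fin 3 → ℝ) → ℂ} (hv : ContDiff ℝ ∞ v)
    (h : ∀ z, heatOp v z = 0) {K : Set (Fin 3 → ℝ)} (hK : ∀ z ∈ K, ∀ j, |z j| < 1 / 32) :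
    ApproxOn (expSpan 1) K v := by
  obtain ⟨ψ, hψ, hψp, hψ0⟩ := exists_periodic_eq_id
  obtain ⟨θ, hθ, hθp, hθ0, hθ1⟩ := exists_periodic_cutoff
  set U : Set (Fin 3 → ℝ) := {z | ∀ j, |z j| < 1 / 16} with hUdef
  have hU : IsOpen U := by
    simp only [hUdef, Set.ofPred_forall]
    exact isOpen_iInter_of_finite fun j =>
      isOpen_lt (continuous_abs.comp (continuous_apply j)) continuous_const
  set W : (Fin 3 → ℝ) → ℂ := fun z => v fun j => ψ (z j) with hWdef
  have hW : ContDiff ℝ ∞ W :=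
    hv.comp (contDiff_pi.2 fun j => hψ.comp (contDiff_apply ℝ ℝ j))
  have hWp : LatticePeriodic W := fun n z => by simp [hWdef, hψp]
  have hWv : Set.EqOn W v U := fun z hz => by
    simp only [hWdef]
    congr 1
    funext j
    exact hψ0 _ (hz j)
  have hf0 : ∀ z, (∀ j, θ (z j) ≠ 1) → heatOp W z = 0 := fun z hz => by
    choose n hn using fun j => hθ1 (z j) (hz j)
    rw [← hWp.heatOp n z, heatOp_congr hU hWv (x := z + fun j => (n j : ℝ)) hn, h]
  let Θ : Fin 3 → (Fin 3 → ℝ) → ℂ := fun j z => (θ (z j) : ℂ)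
  have hΘ : ∀ j, ContDiff ℝ ∞ (Θ j) := fun j =>
    Complex.ofRealCLM.contDiff.comp (hθ.comp (contDiff_apply ℝ ℝ j))
  have hΘp : ∀ j, LatticePeriodic (Θ j) := fun j n z => by simp [Θ, hθp]
  have hΘ' : ∀ j, ContDiff ℝ ∞ fun z => 1 - Θ j z := fun j => contDiff_const.sub (hΘ j)
  have hΘp' : ∀ j, LatticePeriodic fun z => 1 - Θ j z := fun j n z => by simp only [hΘp j n z]
  obtain ⟨b, hb, hbW⟩ := exists_eq_fourierSum hW hWp
  obtain ⟨c0, hc0, hf0'⟩ := exists_eq_fourierSum ((hΘ 0).mul hW.heatOp) ((hΘp 0).mul hWp.heatOp)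
  obtain ⟨c1, hc1, hf1'⟩ := exists_eq_fourierSum (((hΘ' 0).mul (hΘ 1)).mul hW.heatOp)
    (((hΘp' 0).mul (hΘp 1)).mul hWp.heatOp)
  obtain ⟨c2, hc2, hf2'⟩ := exists_eq_fourierSum (((hΘ' 0).mul (hΘ' 1)).mul hW.heatOp)
    (((hΘp' 0).mul (hΘp' 1)).mul hWp.heatOp)
  have hsum : (fun n => heatSymbol (freq n) * b n) = fun n => c0 n + (c1 n + c2 n) := by
    refine hb.heatSymbol_mul.ext_of_fourierSum_eq (hc0.add (hc1.add hc2)) ?_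
    rw [← hb.heatOp_fourierSum, ← hbW]
    funext z
    rw [hc0.fourierSum_add (hc1.add hc2), hc1.fourierSum_add hc2, ← hf0', ← hf1', ← hf2']
    ring
  have hne : ∀ n : Fin 3 → ℤ, heatSymbol (freq n) ≠ 0 := fun n h0 => by
    have := one_le_norm_heatSymbol_freq n
    rw [h0, norm_zero] at this
    linarith
  have hdiv : ∀ {c : (Fin 3 → ℤ) → ℂ}, RapidDecay c →
      RapidDecay fun n => (heatSymbol (freq n))⁻¹ * c n := fun hc =>
    hc.mul_of_le (C := 1) (N := 0) fun n => by
      rw [norm_inv, pow_zero, mul_one]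
      exact inv_le_one_of_one_le₀ (one_le_norm_heatSymbol_freq n)
  have hpiece : ∀ {c : (Fin 3 → ℤ) → ℂ} (j : Fin 3), RapidDecay c →
      (∀ z : Fin 3 → ℝ, θ (z j) = 0 → fourierSum c z = 0) →
      ApproxOn (expSpan 1) K (fourierSum fun n => (heatSymbol (freq n))⁻¹ * c n) :=
    fun {c} j hc hz => by
      refine approxOn_fourierSum_of_slab (r := 1 / 32) j (hdiv hc) (fun z hzj => ?_)
        fun z hz => abs_lt.1 (hK z hz j)
      simp only [mul_inv_cancel_left₀ (hne _)]
      exact hz z (hθ0 _ (abs_lt.2 hzj))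
  have hA0 := hpiece 0 hc0 fun z hz => by
    rw [← hf0']
    simp [Θ, hz]
  have hA1 := hpiece 1 hc1 fun z hz => by
    rw [← hf1']
    simp [Θ, hz]
  have hA2 := hpiece 2 hc2 fun z hz => by
    rw [← hf2']
    by_cases h0 : θ (z 0) = 1
    · simp [Θ, h0]
    by_cases h1 : θ (z 1) = 1
    · simp [Θ, h1]
    beta_reduce
    rw [hf0 z fun j => ?_, mul_zero]
    fin_cases j
    · exact h0
    · exact h1
    · change θ (z 2) ≠ 1
      rw [hz]
      exact zero_ne_one
  refine ApproxOn.congr (f := W) hU (fun z hz j => (hK z hz j).trans (by norm_num)) hWv ?_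
  have hbW' : W = fun z => fourierSum (fun n => (heatSymbol (freq n))⁻¹ * c0 n) z +
      (fourierSum (fun n => (heatSymbol (freq n))⁻¹ * c1 n) z +
        fourierSum (fun n => (heatSymbol (freq n))⁻¹ * c2 n) z) := by
    funext z
    rw [← (hdiv hc1).fourierSum_add (hdiv hc2),
      ← (hdiv hc0).fourierSum_add ((hdiv hc1).add (hdiv hc2)), hbW]
    congr 1
    funext n
    rw [← mul_add, ← mul_add, ← congrFun hsum n, inv_mul_cancel_left₀ (hne n)]
  rw [hbW']
  have hS : ∀ s ∈ expSpan 1, ContDiff ℝ ∞ s := fun s hs => contDiff_of_mem_expSpan hs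
  exact hA0.add hS (hdiv hc0).contDiff_fourierSum
    ((hdiv hc1).contDiff_fourierSum.add (hdiv hc2).contDiff_fourierSum)
    (hA1.add hS (hdiv hc1).contDiff_fourierSum (hdiv hc2).contDiff_fourierSum hA2)

section General

variable {d : Type*} [Fintype d] [DecidableEq d]

theorem pd_comm {f : (d → ℝ) → ℂ} (hf : ContDiff ℝ ∞ f) (i j : d) :
    pd i (pd j f) = pd j (pd i f) := by
  have h : ∀ i j z, pd i (pd j f) z = fderiv ℝ (fderiv ℝ f) z (Pi.single i 1) (Pi.single j 1) :=
    fun i j z => by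
      have h1 : DifferentiableAt ℝ (fderiv ℝ f) z :=
        (hf.fderiv_right (m := ∞) (by norm_num)).differentiable (by simp) z
      simp only [pd]
      rw [show pd j f = fun z => fderiv ℝ f z (Pi.single j 1) from rfl,
        fderiv_clm_apply h1 (differentiableAt_const _)]
      simp
  funext z
  rw [h, h]
  exact ((hf.of_le (WithTop.coe_le_coe.2 le_top)).contDiffAt.isSymmSndFDerivAt (n := 2)
    (by simp)).eq _ _

theorem pd_const_mul (a : ℂ) {f : (d → ℝ) → ℂ} (hf : ContDiff ℝ ∞ f) (i : d) :
    pd i (fun z => a * f z) = fun z => a * pd i f z := by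
  funext z
  simp only [pd]
  rw [fderiv_const_mul (hf.differentiable (by simp) z)]
  rfl

theorem pd_eq_zero_of_hyperplane {f : (d → ℝ) → ℂ} (hf : Differentiable ℝ f) {i j : d}
    (hij : i ≠ j) (h : ∀ z, z j = 0 → f z = 0) {z : d → ℝ} (hz : z j = 0) : pd i f z = 0 := by
  have h1 : HasDerivAt (fun s : ℝ => z + s • (Pi.single i 1 : d → ℝ)) (Pi.single i 1) 0 := by
    simpa using ((hasDerivAt_id (0 : ℝ)).smul_const (Pi.single i 1 : d → ℝ)).const_add z
  have h2 : HasFDerivAt f (fderiv ℝ f z) (z + (0 : ℝ) • (Pi.single i 1 : d → ℝ)) := by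
    simpa using (hf z).hasFDerivAt
  have h3 := h2.comp_hasDerivAt (0 : ℝ) h1
  have h4 : (f ∘ fun s : ℝ => z + s • (Pi.single i 1 : d → ℝ)) = fun _ => 0 := by
    funext s
    exact h _ (by simp [hz, hij.symm])
  rw [h4] at h3
  exact h3.unique (hasDerivAt_const _ _)

theorem fderiv_eq_sum_pd (f : (d → ℝ) → ℂ) (z : d → ℝ) :
    fderiv ℝ f z = ∑ i, (ContinuousLinearMap.proj i : (d → ℝ) →L[ℝ] ℝ).smulRight (pd i f z) := by
  ext v
  conv_lhs => rw [pi_eq_sum_univ' v]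
  simp only [map_sum, map_smul, sum_apply, ContinuousLinearMap.smulRight_apply,
    ContinuousLinearMap.proj_apply, pd]

theorem contDiff_succ_of_pd {f : (d → ℝ) → ℂ} {n : ℕ} (hf : Differentiable ℝ f)
    (h : ∀ i, ContDiff ℝ n (pd i f)) : ContDiff ℝ (n + 1) f := by
  rw [contDiff_succ_iff_fderiv]
  refine ⟨hf, by simp, ?_⟩
  rw [funext (fderiv_eq_sum_pd f)]
  exact ContDiff.sum fun i _ => contDiff_const.smulRight (h i)

/-- The coordinatewise scaling by `c`. -/
noncomputable def diag (c : d → ℝ) : (d → ℝ) →L[ℝ] (d → ℝ) :=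
  ContinuousLinearMap.pi fun i => c i • ContinuousLinearMap.proj i

omit [DecidableEq d] [Fintype d] in
theorem diag_apply (c z : d → ℝ) (i : d) : diag c z i = c i * z i := by
  simp [diag]

omit [Fintype d] in
theorem diag_single (c : d → ℝ) (i : d) (x : ℝ) :
    diag c (Pi.single i x) = c i • Pi.single i x := by
  funext j
  by_cases h : j = i
  · subst h
    simp [diag_apply]
  · simp [diag_apply, h]

theorem pd_comp_diag (c : d → ℝ) {f : (d → ℝ) → ℂ} (hf : Differentiable ℝ f) (i : d) :
    pd i (fun z => f (diag c z)) = fun z => c i * pd i f (diag c z) := by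
  funext z
  have h := (hf (diag c z)).hasFDerivAt.comp z (diag c).hasFDerivAt
  simp only [pd]
  rw [show (fun z => f (diag c z)) = f ∘ diag c from rfl, h.fderiv]
  simp [diag_single]

omit [DecidableEq d] in
theorem expo_diag (w : d → ℂ) (c z : d → ℝ) :
    expo w (diag c z) = expo (fun i => w i * c i) z := by
  simp only [expo, diag_apply]
  push_cast
  simp only [mul_assoc]

omit [DecidableEq d] in
theorem expo_mul_expo (w w' : d → ℂ) (z : d → ℝ) : expo w z * expo w' z = expo (w + w') z := by
  simp only [expo, ← Complex.exp_add, ← Finset.sum_add_distrib, Pi.add_apply, add_mul]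

theorem HasFDerivAt.piecewise_of_eq {E F : Type*} [NormedAddCommGroup E] [NormedSpace ℝ E]
    [NormedAddCommGroup F] [NormedSpace ℝ F] {f g : E → F} {L : E →L[ℝ] F} {x : E} (A : Set E)
    [∀ z, Decidable (z ∈ A)] (hf : HasFDerivAt f L x) (hg : HasFDerivAt g L x) (h : f x = g x) :
    HasFDerivAt (A.piecewise f g) L x := by
  have hx : A.piecewise f g x = f x := by
    by_cases hx : x ∈ A
    · rw [Set.piecewise_eq_of_mem _ _ _ hx]
    · rw [Set.piecewise_eq_of_notMem _ _ _ hx, h]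
  rw [← hasFDerivWithinAt_univ, ← Set.union_compl_self A]
  exact (hf.hasFDerivWithinAt.congr (fun z hz => Set.piecewise_eq_of_mem _ _ _ hz) hx).union
    (hg.hasFDerivWithinAt.congr (fun z hz => Set.piecewise_eq_of_notMem _ _ _ hz) (hx.trans h))

end General

/-- The sign of the `i`-th coordinate under reflection in the last coordinate. -/
def mirrorSign (i : Fin 3) : ℝ := if i = 2 then -1 else 1

/-- The reflection in the last coordinate. -/
noncomputable def mirror : (Fin 3 → ℝ) →L[ℝ] (Fin 3 → ℝ) := diag mirrorSign

theorem mirror_apply (z : Fin 3 → ℝ) (i : Fin 3) : mirror z i = mirrorSign i * z i :=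
  diag_apply _ _ _

theorem mirror_apply_two (z : Fin 3 → ℝ) : mirror z 2 = -z 2 := by
  simp [mirror_apply, mirrorSign]

theorem mirror_mirror (z : Fin 3 → ℝ) : mirror (mirror z) = z := by
  funext i
  simp only [mirror_apply, mirrorSign]
  split_ifs <;> simp

theorem mirror_eq_self {z : Fin 3 → ℝ} (hz : z 2 = 0) : mirror z = z := by
  funext i
  simp only [mirror_apply, mirrorSign]
  split_ifs with h
  · simp [h, hz]
  · simp

/-- The functions solving the heat equation on the half space, satisfying the boundary condition
compatible with the reflection of sign `e`. -/
structure IsHalfHeat (e : ℂ) (f : (Fin 3 → ℝ) → ℂ) : Prop where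
  contDiff : ContDiff ℝ ∞ f
  heat : ∀ z, 0 ≤ z 2 → pd 0 f z = pd 1 (pd 1 f) z + pd 2 (pd 2 f) z
  bdry : ∀ z, z 2 = 0 → (1 - e) * f z = 0
  bdry_pd : ∀ z, z 2 = 0 → (1 + e) * pd 2 f z = 0

theorem eq_zero_of_eqOn_pos {f : (Fin 3 → ℝ) → ℂ} (hf : Continuous f)
    (h : ∀ z, 0 < z 2 → f z = 0) {z : Fin 3 → ℝ} (hz : 0 ≤ z 2) : f z = 0 := by
  have hlim : Filter.Tendsto (fun s : ℝ => f (z + s • Pi.single 2 1))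
      (nhdsWithin 0 (Set.Ioi 0)) (nhds (f z)) := by
    have : Continuous fun s : ℝ => f (z + s • Pi.single 2 1) := by fun_prop
    simpa using (this.tendsto 0).mono_left nhdsWithin_le_nhds
  refine tendsto_nhds_unique_of_eventuallyEq hlim tendsto_const_nhds ?_
  filter_upwards [self_mem_nhdsWithin] with s hs
  refine h _ ?_
  have : 0 < s := hs
  simp
  linarith

namespace IsHalfHeat

variable {e : ℂ} {f : (Fin 3 → ℝ) → ℂ}

theorem heat_pd (hf : IsHalfHeat e f) (i : Fin 3) (z : Fin 3 → ℝ) (hz : 0 ≤ z 2) :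
    pd 0 (pd i f) z = pd 1 (pd 1 (pd i f)) z + pd 2 (pd 2 (pd i f)) z := by
  have hc := hf.contDiff
  have hH : ContDiff ℝ ∞ fun z => pd 1 (pd 1 f) z + pd 2 (pd 2 f) z :=
    ((hc.pd 1).pd 1).add ((hc.pd 2).pd 2)
  have h1 : Set.EqOn (pd i (pd 0 f)) (pd i fun z => pd 1 (pd 1 f) z + pd 2 (pd 2 f) z)
      {z | 0 < z 2} :=
    pd_congr (isOpen_lt continuous_const (continuous_apply 2))
      (fun z hz => hf.heat z (le_of_lt hz)) i
  have h2 : pd i (pd 0 f) z - pd i (fun z => pd 1 (pd 1 f) z + pd 2 (pd 2 f) z) z = 0 :=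
    eq_zero_of_eqOn_pos (f := fun z => pd i (pd 0 f) z -
      pd i (fun z => pd 1 (pd 1 f) z + pd 2 (pd 2 f) z) z)
      (((hc.pd 0).pd i).continuous.sub (hH.pd i).continuous)
      (fun z hz => sub_eq_zero.2 (h1 hz)) hz
  rw [sub_eq_zero, pd_add ((hc.pd 1).pd 1) ((hc.pd 2).pd 2), pd_comm hc i 0,
    pd_comm (hc.pd 1) i 1, pd_comm hc i 1, pd_comm (hc.pd 2) i 2, pd_comm hc i 2] at h2
  exact h2

theorem mul_pd_eq_zero {a : ℂ} {g : (Fin 3 → ℝ) → ℂ} (hg : ContDiff ℝ ∞ g)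
    (h : ∀ z, z 2 = 0 → a * g z = 0) {i : Fin 3} (hi : i ≠ 2) (z : Fin 3 → ℝ) (hz : z 2 = 0) :
    a * pd i g z = 0 := by
  have := pd_eq_zero_of_hyperplane (f := fun z => a * g z)
    ((contDiff_const.mul hg).differentiable (n := ∞) (by simp)) hi h hz
  rwa [pd_const_mul a hg] at this

theorem pd (hf : IsHalfHeat e f) (i : Fin 3) : IsHalfHeat (e * mirrorSign i) (pd i f) where
  contDiff := hf.contDiff.pd i
  heat := hf.heat_pd i
  bdry z hz := by
    by_cases hi : i = 2
    · subst hi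
      simpa [mirrorSign] using hf.bdry_pd z hz
    · simpa [mirrorSign, hi] using mul_pd_eq_zero hf.contDiff hf.bdry hi z hz
  bdry_pd z hz := by
    by_cases hi : i = 2
    · subst hi
      have h0 := mul_pd_eq_zero hf.contDiff hf.bdry (i := 0) (by decide)
      have h1 := mul_pd_eq_zero hf.contDiff hf.bdry (i := 1) (by decide)
      have h11 := mul_pd_eq_zero (hf.contDiff.pd 1) h1 (i := 1) (by decide) z hz
      have := hf.heat z hz.ge
      simp only [mirrorSign, if_true, Complex.ofReal_neg, Complex.ofReal_one, mul_neg, mul_one]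
      linear_combination h0 z hz - h11 - (1 - e) * this
    · rw [pd_comm hf.contDiff 2 i]
      simpa [mirrorSign, hi] using mul_pd_eq_zero (hf.contDiff.pd 2) hf.bdry_pd hi z hz

end IsHalfHeat

open Classical in
/-- The extension of `f` from the half space by reflection with sign `e`. -/
noncomputable def mirrorExtend (e : ℂ) (f : (Fin 3 → ℝ) → ℂ) : (Fin 3 → ℝ) → ℂ :=
  Set.piecewise {z | 0 ≤ z 2} f fun z => e * f (mirror z)

theorem mirrorExtend_of_nonneg {e : ℂ} {f : (Fin 3 → ℝ) → ℂ} {z : Fin 3 → ℝ} (hz : 0 ≤ z 2) :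
    mirrorExtend e f z = f z :=
  Set.piecewise_eq_of_mem _ _ _ hz

theorem mirrorExtend_of_neg {e : ℂ} {f : (Fin 3 → ℝ) → ℂ} {z : Fin 3 → ℝ} (hz : z 2 < 0) :
    mirrorExtend e f z = e * f (mirror z) :=
  Set.piecewise_eq_of_notMem _ _ _ (not_le.2 hz)

namespace IsHalfHeat

variable {e : ℂ} {f : (Fin 3 → ℝ) → ℂ}

theorem differentiable_pd_mirrorExtend (hf : IsHalfHeat e f) :
    Differentiable ℝ (mirrorExtend e f) ∧
      ∀ i, _root_.pd i (mirrorExtend e f) = mirrorExtend (e * mirrorSign i) (_root_.pd i f) := by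
  have hd := hf.contDiff.differentiable (by simp)
  have hg : Differentiable ℝ fun z => e * f (mirror z) :=
    (hd.comp mirror.differentiable).const_mul e
  have hgc : ContDiff ℝ ∞ fun z => f (mirror z) := hf.contDiff.comp mirror.contDiff
  have hpdg : ∀ i z, _root_.pd i (fun z => e * f (mirror z)) z =
      e * mirrorSign i * _root_.pd i f (mirror z) := fun i z => by
    rw [pd_const_mul e hgc]
    simp only [mirror, pd_comp_diag _ hd, mul_assoc]
  have key : ∀ z, DifferentiableAt ℝ (mirrorExtend e f) z ∧
      ∀ i, _root_.pd i (mirrorExtend e f) z = mirrorExtend (e * mirrorSign i) (_root_.pd i f) z :=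
    fun z => by
      rcases lt_trichotomy (z 2) 0 with hz | hz | hz
      · have hev : mirrorExtend e f =ᶠ[nhds z] fun z => e * f (mirror z) := by
          filter_upwards [(isOpen_lt (continuous_apply 2) continuous_const).mem_nhds hz] with y hy
          exact mirrorExtend_of_neg hy
        refine ⟨(hg z).congr_of_eventuallyEq hev, fun i => ?_⟩
        rw [mirrorExtend_of_neg hz, ← hpdg]
        simp only [_root_.pd, hev.fderiv_eq]
      · have hfd : fderiv ℝ (fun z => e * f (mirror z)) z = fderiv ℝ f z := by
          rw [fderiv_eq_sum_pd, fderiv_eq_sum_pd]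
          refine Finset.sum_congr rfl fun i _ => ?_
          congr 1
          rw [hpdg, mirror_eq_self hz]
          have := (hf.pd i).bdry z hz
          linear_combination -this
        have h := (hd z).hasFDerivAt.piecewise_of_eq {z | 0 ≤ z 2}
          (hfd ▸ (hg z).hasFDerivAt) (by
            rw [mirror_eq_self hz]
            linear_combination hf.bdry z hz)
        refine ⟨h.differentiableAt, fun i => ?_⟩
        rw [mirrorExtend_of_nonneg hz.ge]
        simp only [_root_.pd]
        rw [mirrorExtend, h.fderiv]
      · have hev : mirrorExtend e f =ᶠ[nhds z] f := by
          filter_upwards [(isOpen_lt continuous_const (continuous_apply 2)).mem_nhds hz] with y hy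
          exact mirrorExtend_of_nonneg (le_of_lt hy)
        refine ⟨(hd z).congr_of_eventuallyEq hev, fun i => ?_⟩
        rw [mirrorExtend_of_nonneg hz.le]
        simp only [_root_.pd, hev.fderiv_eq]
  exact ⟨fun z => (key z).1, fun i => funext fun z => (key z).2 i⟩

theorem contDiff_mirrorExtend (hf : IsHalfHeat e f) : ContDiff ℝ ∞ (mirrorExtend e f) := by
  rw [contDiff_infty]
  intro n
  induction n generalizing e f with
  | zero =>
    exact contDiff_zero.2 hf.differentiable_pd_mirrorExtend.1.continuous
  | succ n ih =>
    refine contDiff_succ_of_pd hf.differentiable_pd_mirrorExtend.1 fun i => ?_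
    rw [hf.differentiable_pd_mirrorExtend.2 i]
    exact ih (hf.pd i)

theorem heat_mirrorExtend (hf : IsHalfHeat e f) (z : Fin 3 → ℝ) :
    _root_.pd 0 (mirrorExtend e f) z = _root_.pd 1 (_root_.pd 1 (mirrorExtend e f)) z +
      _root_.pd 2 (_root_.pd 2 (mirrorExtend e f)) z := by
  simp only [hf.differentiable_pd_mirrorExtend.2, (hf.pd _).differentiable_pd_mirrorExtend.2]
  rcases le_or_gt 0 (z 2) with hz | hz
  · simp only [mirrorExtend_of_nonneg hz]
    exact hf.heat z hz
  · simp only [mirrorExtend_of_neg hz]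
    have := hf.heat (mirror z) (by rw [mirror_apply_two]; linarith)
    simp [mirrorSign, this]
    ring

end IsHalfHeat

/-- The coefficients of the parabolic scaling by `ρ`. -/
def parabolic (ρ : ℝ) (i : Fin 3) : ℝ := if i = 0 then ρ ^ 2 else ρ

theorem parabolic_inv_mul {ρ : ℝ} (hρ : ρ ≠ 0) (i : Fin 3) :
    parabolic ρ i * parabolic ρ⁻¹ i = 1 := by
  simp only [parabolic]
  split_ifs <;> field_simp

theorem diag_parabolic_inv {ρ : ℝ} (hρ : ρ ≠ 0) (z : Fin 3 → ℝ) :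
    diag (parabolic ρ) (diag (parabolic ρ⁻¹) z) = z := by
  funext i
  rw [diag_apply, diag_apply, ← mul_assoc, parabolic_inv_mul hρ, one_mul]

theorem heatOp_expo_mul_comp_diag {v : (Fin 3 → ℝ) → ℂ} (hv : ContDiff ℝ ∞ v)
    (h : ∀ z, pd 0 v z = pd 1 (pd 1 v) z + pd 2 (pd 2 v) z) (ρ : ℝ) (z : Fin 3 → ℝ) :
    heatOp (fun z => expo (Pi.single 0 (-1)) z * v (diag (parabolic ρ) z)) z = 0 := by
  have hc : ∀ {f : (Fin 3 → ℝ) → ℂ}, ContDiff ℝ ∞ f →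
      ContDiff ℝ ∞ fun z => f (diag (parabolic ρ) z) := fun hf =>
    hf.comp (diag (parabolic ρ)).contDiff
  have hd : ∀ {f : (Fin 3 → ℝ) → ℂ}, ContDiff ℝ ∞ f → Differentiable ℝ f := fun hf =>
    hf.differentiable (by simp)
  have he : ∀ {f : (Fin 3 → ℝ) → ℂ}, ContDiff ℝ ∞ f → ∀ i : Fin 3, i ≠ 0 →
      pd i (fun z => expo (Pi.single 0 (-1)) z * f (diag (parabolic ρ) z)) =
        fun z => ρ * (expo (Pi.single 0 (-1)) z * pd i f (diag (parabolic ρ) z)) :=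
    fun hf i hi => by
      rw [pd_mul (contDiff_expo _) (hc hf), pd_comp_diag _ (hd hf), pd_expo]
      funext z
      simp [hi, parabolic]
      ring
  have he2 : ∀ i : Fin 3, i ≠ 0 →
      pd i (pd i fun z => expo (Pi.single 0 (-1)) z * v (diag (parabolic ρ) z)) =
        fun z => ρ * (ρ * (expo (Pi.single 0 (-1)) z * pd i (pd i v) (diag (parabolic ρ) z))) :=
    fun i hi => by
      rw [he hv i hi, pd_const_mul _ ((contDiff_expo _).mul (hc (hv.pd i))), he (hv.pd i) i hi]
  have he0 : pd 0 (fun z => expo (Pi.single 0 (-1)) z * v (diag (parabolic ρ) z)) = fun z =>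
      ρ ^ 2 * (expo (Pi.single 0 (-1)) z * pd 0 v (diag (parabolic ρ) z)) -
        expo (Pi.single 0 (-1)) z * v (diag (parabolic ρ) z) := by
    rw [pd_mul (contDiff_expo _) (hc hv), pd_comp_diag _ (hd hv), pd_expo]
    funext z
    simp [parabolic]
    ring
  simp only [heatOp, he0, he2 1 (by decide), he2 2 (by decide), h]
  ring

theorem approxOn_expSpan_of_heat {v : (Fin 3 → ℝ) → ℂ} (hv : ContDiff ℝ ∞ v)
    (h : ∀ z, pd 0 v z = pd 1 (pd 1 v) z + pd 2 (pd 2 v) z) {K : Set (Fin 3 → ℝ)}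
    (hK : IsCompact K) : ApproxOn (expSpan 0) K v := by
  obtain ⟨B, hB⟩ := hK.exists_bound_of_continuousOn continuousOn_id
  obtain ⟨ρ, hρ1, hρB⟩ : ∃ ρ : ℝ, 1 ≤ ρ ∧ 32 * B < ρ :=
    ⟨max 1 (32 * B + 1), le_max_left _ _, lt_max_of_lt_right (by linarith)⟩
  have hρ0 : ρ ≠ 0 := by positivity
  have hsmall : ∀ z ∈ diag (parabolic ρ⁻¹) '' K, ∀ j, |z j| < 1 / 32 := by
    rintro _ ⟨z, hz, rfl⟩ j
    have hzj : |z j| ≤ B := (norm_le_pi_norm z j).trans (hB z hz)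
    have hp : |parabolic ρ⁻¹ j| ≤ ρ⁻¹ := by
      have h1 : ρ⁻¹ ≤ 1 := inv_le_one_of_one_le₀ hρ1
      have h0 : 0 ≤ ρ⁻¹ := by positivity
      simp only [parabolic]
      split_ifs
      · rw [abs_of_nonneg (by positivity)]
        nlinarith
      · rw [abs_of_nonneg h0]
    rw [diag_apply, abs_mul]
    calc |parabolic ρ⁻¹ j| * |z j| ≤ ρ⁻¹ * B := by gcongr
      _ < 1 / 32 := by
        rw [inv_mul_lt_iff₀ (by positivity)]
        linarith
  have hv1 : ContDiff ℝ ∞ fun z => expo (Pi.single 0 (-1)) z * v (diag (parabolic ρ) z) :=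
    (contDiff_expo _).mul (hv.comp (diag (parabolic ρ)).contDiff)
  have h1 := (approxOn_expSpan_of_heatOp_eq_zero hv1 (heatOp_expo_mul_comp_diag hv h ρ)
    hsmall).comp_clm (S' := expSpan (ρ⁻¹ ^ 2 : ℝ)) (diag (parabolic ρ⁻¹))
    (fun s hs => contDiff_of_mem_expSpan hs) hv1 (Set.mapsTo_image _ K) fun s hs =>
      comp_mem_of_mem_span (LinearMap.funLeft ℂ ℂ (diag (parabolic ρ⁻¹))) (by
        rintro _ ⟨w, hw, rfl⟩
        have he : LinearMap.funLeft ℂ ℂ (diag (parabolic ρ⁻¹)) (expo w) =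
            expo fun i => w i * parabolic ρ⁻¹ i := funext fun z => expo_diag w _ z
        rw [he]
        refine expo_mem_expSpan ?_
        have hw' : w 0 + 1 = w 1 ^ 2 + w 2 ^ 2 := hw
        simp [parabolic]
        linear_combination ((ρ : ℂ)⁻¹) ^ 2 * hw') hs
  have h2 := h1.mul_left (S' := expSpan 0) (g := expo (Pi.single 0 ((ρ⁻¹ ^ 2 : ℝ) : ℂ)))
    (fun s hs => contDiff_of_mem_expSpan hs) hK (hv1.comp (diag (parabolic ρ⁻¹)).contDiff)
    (contDiff_expo _) fun s hs =>
      comp_mem_of_mem_span (LinearMap.mulLeft ℂ (expo (Pi.single 0 ((ρ⁻¹ ^ 2 : ℝ) : ℂ)))) (by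
        rintro _ ⟨w, hw, rfl⟩
        have he : LinearMap.mulLeft ℂ (expo (Pi.single 0 ((ρ⁻¹ ^ 2 : ℝ) : ℂ))) (expo w) =
            expo (Pi.single 0 ((ρ⁻¹ ^ 2 : ℝ) : ℂ) + w) := funext fun z => expo_mul_expo _ w z
        rw [he]
        refine expo_mem_expSpan ?_
        have hw' : w 0 + ((ρ⁻¹ ^ 2 : ℝ) : ℂ) = w 1 ^ 2 + w 2 ^ 2 := hw
        simp only [Pi.add_apply, Pi.single_eq_same, Pi.single_apply]
        simpa [add_comm] using hw') hs
  refine h2.congr isOpen_univ (Set.subset_univ K) fun z _ => ?_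
  simp only [Function.comp_apply]
  rw [diag_parabolic_inv hρ0, expo_diag, ← mul_assoc, expo_mul_expo]
  have h0 : (Pi.single 0 ((ρ⁻¹ ^ 2 : ℝ) : ℂ) + fun i => (Pi.single 0 (-1) : Fin 3 → ℂ) i *
      parabolic ρ⁻¹ i) = 0 := by
    funext i
    by_cases hi : i = 0
    · subst hi
      simp [parabolic]
    · simp [hi]
  rw [h0]
  simp [expo]

/-- The identification of `ℝ³` with `ℝ × ℝ × ℝ`. -/
def toProd : (Fin 3 → ℝ) →L[ℝ] ℝ × ℝ × ℝ :=
  (ContinuousLinearMap.proj 0).prod ((ContinuousLinearMap.proj 1).prod (ContinuousLinearMap.proj 2))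

theorem toProd_apply (z : Fin 3 → ℝ) : toProd z = (z 0, z 1, z 2) := rfl

/-- The identification of `ℝ × ℝ × ℝ` with `ℝ³`. -/
def ofProd : ℝ × ℝ × ℝ →L[ℝ] (Fin 3 → ℝ) :=
  ContinuousLinearMap.pi ![ContinuousLinearMap.fst ℝ ℝ (ℝ × ℝ),
    (ContinuousLinearMap.fst ℝ ℝ ℝ).comp (ContinuousLinearMap.snd ℝ ℝ (ℝ × ℝ)),
    (ContinuousLinearMap.snd ℝ ℝ ℝ).comp (ContinuousLinearMap.snd ℝ ℝ (ℝ × ℝ))]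

theorem ofProd_apply_zero (p : ℝ × ℝ × ℝ) : ofProd p 0 = p.1 := rfl

theorem ofProd_apply_one (p : ℝ × ℝ × ℝ) : ofProd p 1 = p.2.1 := rfl

theorem ofProd_apply_two (p : ℝ × ℝ × ℝ) : ofProd p 2 = p.2.2 := rfl

theorem toProd_ofProd (p : ℝ × ℝ × ℝ) : toProd (ofProd p) = p := rfl

theorem ofProd_toProd (z : Fin 3 → ℝ) : ofProd (toProd z) = z := by
  funext i
  fin_cases i <;> rfl

theorem deriv_comp_ofProd {f : (Fin 3 → ℝ) → ℂ} (hf : Differentiable ℝ f) {c : ℝ → ℝ × ℝ × ℝ}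
    {s : ℝ} {i : Fin 3} (hc : HasDerivAt (fun s => ofProd (c s)) (Pi.single i 1) s) :
    deriv (fun s => f (ofProd (c s))) s = pd i f (ofProd (c s)) :=
  ((hf (ofProd (c s))).hasFDerivAt.comp_hasDerivAt s hc).deriv

theorem d1_comp_ofProd {f : (Fin 3 → ℝ) → ℂ} (hf : ContDiff ℝ ∞ f) :
    d1 (fun p => f (ofProd p)) = fun p => pd 0 f (ofProd p) := by
  funext p
  refine deriv_comp_ofProd (hf.differentiable (by simp)) (i := 0) (hasDerivAt_pi.2 fun j => ?_)
  fin_cases j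
  · exact hasDerivAt_id _
  · exact hasDerivAt_const _ _
  · exact hasDerivAt_const _ _

theorem d2_comp_ofProd {f : (Fin 3 → ℝ) → ℂ} (hf : ContDiff ℝ ∞ f) :
    d2 (fun p => f (ofProd p)) = fun p => pd 1 f (ofProd p) := by
  funext p
  refine deriv_comp_ofProd (hf.differentiable (by simp)) (i := 1) (hasDerivAt_pi.2 fun j => ?_)
  fin_cases j
  · exact hasDerivAt_const _ _
  · exact hasDerivAt_id _
  · exact hasDerivAt_const _ _

theorem d3_comp_ofProd {f : (Fin 3 → ℝ) → ℂ} (hf : ContDiff ℝ ∞ f) :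
    d3 (fun p => f (ofProd p)) = fun p => pd 2 f (ofProd p) := by
  funext p
  refine deriv_comp_ofProd (hf.differentiable (by simp)) (i := 2) (hasDerivAt_pi.2 fun j => ?_)
  fin_cases j
  · exact hasDerivAt_const _ _
  · exact hasDerivAt_const _ _
  · exact hasDerivAt_id _

theorem isHalfHeat_comp_toProd {u : ℝ × ℝ × ℝ → ℂ} (hu : ContDiff ℝ ∞ u)
    (hheat : ∀ t x y : ℝ, 0 ≤ y → d1 u (t, x, y) = d2 (d2 u) (t, x, y) + d3 (d3 u) (t, x, y))
    (hbc : ∀ t x : ℝ, u (t, x, 0) = 0) : IsHalfHeat (-1) fun z => u (toProd z) := by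
  have hf : ContDiff ℝ ∞ fun z => u (toProd z) := hu.comp toProd.contDiff
  refine ⟨hf, fun z hz => ?_, fun z hz => ?_, by simp⟩
  · have h := hheat (z 0) (z 1) (z 2) hz
    have hu' : u = fun p => (fun z => u (toProd z)) (ofProd p) := rfl
    rw [hu', d1_comp_ofProd hf, d2_comp_ofProd hf, d3_comp_ofProd hf, d2_comp_ofProd (hf.pd 1),
      d3_comp_ofProd (hf.pd 2), ← toProd_apply] at h
    simpa only [ofProd_toProd] using h
  · rw [toProd_apply, hz, hbc, mul_zero]

theorem mirrorExtend_neg_one_mirror {f : (Fin 3 → ℝ) → ℂ} (hf : IsHalfHeat (-1) f)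
    (z : Fin 3 → ℝ) : mirrorExtend (-1) f (mirror z) = -mirrorExtend (-1) f z := by
  rcases lt_trichotomy (z 2) 0 with hz | hz | hz
  · rw [mirrorExtend_of_neg hz, mirrorExtend_of_nonneg (by rw [mirror_apply_two]; linarith)]
    ring
  · rw [mirror_eq_self hz, mirrorExtend_of_nonneg hz.ge]
    linear_combination hf.bdry z hz
  · rw [mirrorExtend_of_nonneg hz.le,
      mirrorExtend_of_neg (by rw [mirror_apply_two]; linarith), mirror_mirror]
    ring

theorem expo_sub_expo_mirror {w : Fin 3 → ℂ} (hw : w 0 + 0 = w 1 ^ 2 + w 2 ^ 2)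
    (p : ℝ × ℝ × ℝ) :
    expo w (ofProd p) - expo w (mirror (ofProd p)) = heat2DDirichletBasis (w 1) (w 2) p := by
  rw [add_zero] at hw
  simp only [expo, heat2DDirichletBasis, Fin.sum_univ_three, mirror_apply, mirrorSign,
    ofProd_apply_zero, ofProd_apply_one, ofProd_apply_two, hw]
  simp [sub_eq_add_neg]

theorem contDiff_heat2DDirichletBasis (a b : ℂ) : ContDiff ℝ ∞ (heat2DDirichletBasis a b) := by
  have h := funext (expo_sub_expo_mirror (w := ![a ^ 2 + b ^ 2, a, b]) (by simp))
  simp only [Matrix.cons_val_one, Matrix.cons_val] at h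
  rw [← h]
  exact ((contDiff_expo _).comp ofProd.contDiff).sub
    ((contDiff_expo _).comp (mirror.comp ofProd).contDiff)

theorem iteratedFDeriv_eq_of_eqOn_halfSpace {f g : ℝ × ℝ × ℝ → ℂ} (hf : ContDiff ℝ ∞ f)
    (hg : ContDiff ℝ ∞ g) (h : ∀ p : ℝ × ℝ × ℝ, 0 ≤ p.2.2 → f p = g p) (k : ℕ) {p : ℝ × ℝ × ℝ}
    (hp : 0 ≤ p.2.2) : iteratedFDeriv ℝ k f p = iteratedFDeriv ℝ k g p := by
  have hopen : IsOpen {p : ℝ × ℝ × ℝ | 0 < p.2.2} :=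
    isOpen_lt continuous_const (continuous_snd.comp continuous_snd)
  have h1 : Set.EqOn (iteratedFDeriv ℝ k f) (iteratedFDeriv ℝ k g)
      {p : ℝ × ℝ × ℝ | 0 < p.2.2} := fun p hp => by
    refine Filter.EventuallyEq.eq_of_nhds (Filter.EventuallyEq.iteratedFDeriv (𝕜 := ℝ) (n := k) ?_)
    filter_upwards [hopen.mem_nhds hp] with q hq
    exact h q (le_of_lt hq)
  refine h1.closure (hf.continuous_iteratedFDeriv (mod_cast le_top))
    (hg.continuous_iteratedFDeriv (mod_cast le_top)) ?_
  have h2 : {p : ℝ × ℝ × ℝ | 0 < p.2.2} = Set.univ ×ˢ Set.univ ×ˢ Set.Ioi 0 := by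
    ext
    simp
  rw [h2, closure_prod_eq, closure_prod_eq, closure_Ioi]
  simpa using hp

theorem approxOn_mirrorExtend {f : (Fin 3 → ℝ) → ℂ} (hf : IsHalfHeat (-1) f)
    {K : Set (ℝ × ℝ × ℝ)} (hK : IsCompact K) :
    ApproxOn (Submodule.span ℂ (Set.range fun ab : ℂ × ℂ => heat2DDirichletBasis ab.1 ab.2)) K
      fun p => mirrorExtend (-1) f (ofProd p) := by
  have hR := hf.contDiff_mirrorExtend
  have hK' : IsCompact (ofProd '' K ∪ mirror.comp ofProd '' K) :=
    (hK.image ofProd.continuous).union (hK.image (mirror.comp ofProd).continuous)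
  have h1 := (approxOn_expSpan_of_heat hR hf.heat_mirrorExtend hK').mul_left (S' := expSpan 0)
    (g := fun _ => 1 / 2) (fun s hs => contDiff_of_mem_expSpan hs) hK' hR contDiff_const
    fun s hs => (expSpan 0).smul_mem _ hs
  have h2 := h1.comp_sub_comp (K' := K) ofProd (mirror.comp ofProd)
    (S' := Submodule.span ℂ (Set.range fun ab : ℂ × ℂ => heat2DDirichletBasis ab.1 ab.2))
    (fun s hs => contDiff_of_mem_expSpan hs) (contDiff_const.mul hR)
    ((Set.mapsTo_image _ _).mono_right Set.subset_union_left)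
    ((Set.mapsTo_image _ _).mono_right Set.subset_union_right) fun s hs =>
      comp_mem_of_mem_span (LinearMap.funLeft ℂ ℂ ofProd -
        LinearMap.funLeft ℂ ℂ (mirror.comp ofProd)) (by
          rintro _ ⟨w, hw, rfl⟩
          exact Submodule.subset_span ⟨(w 1, w 2), (funext (expo_sub_expo_mirror hw)).symm⟩) hs
  refine h2.congr isOpen_univ (Set.subset_univ K) fun p _ => ?_
  simp only [ContinuousLinearMap.comp_apply, mirrorExtend_neg_one_mirror hf]
  ring

/-- The B-EPGP basis has dense span in the smooth solutions of the 2D heat equation on the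
halfspace `{y ≥ 0}` with Dirichlet boundary condition at `y = 0`. -/
theorem bepgp_heat2D_dirichlet_dense
    (u : ℝ × ℝ × ℝ → ℂ) (hu : ContDiff ℝ (⊤ : ℕ∞) u)
    (hheat : ∀ t x y : ℝ, 0 ≤ y →
      d1 u (t, x, y) = d2 (d2 u) (t, x, y) + d3 (d3 u) (t, x, y))
    (hbc : ∀ t x : ℝ, u (t, x, 0) = 0)
    (K : Set (ℝ × ℝ × ℝ)) (hKc : IsCompact K)
    (hK : K ⊆ Set.univ ×ˢ Set.univ ×ˢ Set.Ici (0 : ℝ))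
    (m : ℕ) (ε : ℝ) (hε : 0 < ε) :
    ∃ (r : ℕ) (a b : Fin r → ℂ) (c : Fin r → ℂ),
      ∀ k ≤ m, ∀ p ∈ K,
        ‖iteratedFDeriv ℝ k
            (fun q => u q - ∑ j, c j * heat2DDirichletBasis (a j) (b j) q) p‖ ≤ ε := by
  have hf := isHalfHeat_comp_toProd hu hheat hbc
  obtain ⟨s, hs, hs'⟩ := approxOn_mirrorExtend hf hKc m ε hε
  obtain ⟨r, c, g, hg⟩ := Submodule.mem_span_set'.1 hs
  choose ab hab using fun i => (g i).2
  have hsum : ∀ q, s q = ∑ j, c j * heat2DDirichletBasis (ab j).1 (ab j).2 q := fun q => by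
    simp [← hg, ← hab]
  have hsc : ContDiff ℝ ∞ s := by
    rw [funext hsum]
    exact ContDiff.sum fun j _ => contDiff_const.mul (contDiff_heat2DDirichletBasis _ _)
  refine ⟨r, fun j => (ab j).1, fun j => (ab j).2, c, fun k hk p hp => ?_⟩
  simp only [← hsum]
  rw [iteratedFDeriv_eq_of_eqOn_halfSpace (hu.sub hsc)
    ((hf.contDiff_mirrorExtend.comp ofProd.contDiff).sub hsc) (fun q hq => ?_) k (hK hp).2.2]
  · exact hs' k hk p hp
  · simp only [Function.comp_apply]
    rw [mirrorExtend_of_nonneg (by rwa [ofProd_apply_two]), toProd_ofProd]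
end
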